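/- Let 1<p≤2 and let U⊂(0,∞) be nonempty. If p_cr(U)<p, then the maximal operator 𝓜^U is bounded on L^p(ℝ²), i.e. there is a finite constant C with ‖𝓜^U f‖_{L^p(ℝ²)} ≤ C‖f‖_{L^p(ℝ²)} for all Schwartz functions f on ℝ². -/

import Mathlib

open MeasureTheory Filter Set Topology
open scoped ENNReal NNReal Topology Classical

noncomputable section

/-- The homogeneous curve of degree `b`: `γ_b(t) = c₊ t^b` for `t > 0`,
`γ_b(t) = c₋ (-t)^b` for `t < 0`, `γ_b(0) = 0`. -/
def curve (b cp cm t : ℝ) : ℝ :=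
  if 0 < t then cp * t ^ b else if t < 0 then cm * (-t) ^ b else 0

/-- The maximal function along the curve `(t, u γ_b(t))`. -/
def Mu (b cp cm u : ℝ) (f : ℝ × ℝ → ℝ) (x : ℝ × ℝ) : ℝ :=
  ⨆ R : {R : ℝ // 0 < R},
    ((R : ℝ))⁻¹ * ∫ t in (0:ℝ)..(R : ℝ), |f (x - (t, u * curve b cp cm t))|

/-- The maximal function `𝓜^U f = sup_{u ∈ U} M^{(u)} f`. -/
def calM (b cp cm : ℝ) (U : Set ℝ) (f : ℝ × ℝ → ℝ) (x : ℝ × ℝ) : ℝ :=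
  ⨆ u : U, Mu b cp cm (u : ℝ) f x

/-- The Hilbert transform along the curve `(t, u γ_b(t))` (principal value). -/
def Hu (b cp cm u : ℝ) (f : ℝ × ℝ → ℝ) (x : ℝ × ℝ) : ℝ :=
  limUnder (𝓝[>] (0:ℝ)) fun ε : ℝ =>
    ∫ t in {t : ℝ | ε < |t| ∧ |t| < ε⁻¹}, f (x - (t, u * curve b cp cm t)) / t

/-- The maximal function `𝓗^U f = sup_{u ∈ U} |H^{(u)} f|`, valued in `ℝ≥0∞`. -/
def calH (b cp cm : ℝ) (U : Set ℝ) (f : ℝ × ℝ → ℝ) (x : ℝ × ℝ) : ℝ≥0∞ :=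
  ⨆ u : U, ENNReal.ofReal |Hu b cp cm (u : ℝ) f x|

/-- The `L^p` norm of an `ℝ≥0∞`-valued function on `ℝ²`. -/
def lpN (g : ℝ × ℝ → ℝ≥0∞) (p : ℝ) : ℝ≥0∞ :=
  (∫⁻ x : ℝ × ℝ, g x ^ p) ^ (1 / p)

def eN (p : ℝ) : ℝ≥0∞ := ENNReal.ofReal p

/-- `U^r = r⁻¹ U ∩ [1,2] = {ρ ∈ [1,2] : rρ ∈ U}`. -/
def UrSet (U : Set ℝ) (r : ℝ) : Set ℝ := {ρ : ℝ | ρ ∈ Icc (1:ℝ) 2 ∧ r * ρ ∈ U}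

/-- `N(A,δ)`: minimal number of intervals of length `δ` needed to cover `A`. -/
def covN (A : Set ℝ) (δ : ℝ) : ℕ :=
  sInf {n : ℕ | ∃ F : Finset ℝ, F.card = n ∧ A ⊆ ⋃ a ∈ F, Icc a (a + δ)}

/-- `𝒦_p(U,δ) = δ^{1-1/p} sup_{r>0} N(U^r,δ)^{1/p}`. -/
def Kp (U : Set ℝ) (δ p : ℝ) : ℝ :=
  δ ^ (1 - 1 / p) * ⨆ r : {r : ℝ // 0 < r}, ((covN (UrSet U (r : ℝ)) δ : ℝ)) ^ (1 / p)

/-- `p_cr(U) = 1 + limsup_{δ→0+} sup_{r>0} log N(U^r,δ) / log(1/δ)`. -/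
def pcr (U : Set ℝ) : ℝ :=
  1 + limsup (fun δ : ℝ =>
      (⨆ r : {r : ℝ // 0 < r}, Real.log (covN (UrSet U (r : ℝ)) δ)) / Real.log δ⁻¹)
    (𝓝[>] (0:ℝ))

/-- `𝔑(U) = 1 + #{n ∈ ℤ : [2ⁿ, 2ⁿ⁺¹] ∩ U ≠ ∅}`. -/
def frakN (U : Set ℝ) : ℕ∞ :=
  1 + Set.encard {n : ℤ | (Icc ((2:ℝ) ^ n) ((2:ℝ) ^ (n + 1)) ∩ U).Nonempty}

/-- `√(log 𝔑(U))`, valued in `ℝ≥0∞` (equal to `∞` if `𝔑(U) = ∞`). -/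
def sqrtLogN (U : Set ℝ) : ℝ≥0∞ :=
  if frakN U = ⊤ then ⊤
  else ENNReal.ofReal (Real.sqrt (Real.log ((frakN U).toNat : ℝ)))

/-- The `L^p → L^p` operator norm of `𝓜^U` (smallest admissible constant, possibly `∞`). -/
def opNormM (b cp cm : ℝ) (U : Set ℝ) (p : ℝ) : ℝ≥0∞ :=
  sInf {C : ℝ≥0∞ | ∀ f : SchwartzMap (ℝ × ℝ) ℝ,
    eLpNorm (calM b cp cm U ⇑f) (eN p) volume ≤ C * eLpNorm ⇑f (eN p) volume}

/-- The `L^p → L^p` operator norm of `𝓗^U` (smallest admissible constant, possibly `∞`). -/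
def opNormH (b cp cm : ℝ) (U : Set ℝ) (p : ℝ) : ℝ≥0∞ :=
  sInf {C : ℝ≥0∞ | ∀ f : SchwartzMap (ℝ × ℝ) ℝ,
    lpN (calH b cp cm U ⇑f) p ≤ C * eLpNorm ⇑f (eN p) volume}

/-- `θ_{p,ℓ}`. -/
def theta (p : ℝ) (l : ℕ) : ℝ :=
  if (l : ℝ) ≤ (p - 1)⁻¹ then (p - 1) ^ (3 - 10 / p) else (l : ℝ) ^ (7 * (2 / p - 1))

/-- `Σ_{ℓ≥1} θ_{p,ℓ} 𝒦_p(U, 2^{-ℓ})`, valued in `ℝ≥0∞`. -/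
def KpSum (U : Set ℝ) (p : ℝ) : ℝ≥0∞ :=
  ∑' l : ℕ, ENNReal.ofReal (theta p (l + 1) * Kp U ((2:ℝ) ^ (-((l : ℝ) + 1))) p)

lemma scalar_gap_real {p η : ℝ} (hp : 1 < p) (hη : 0 < η) :
    ∃ κ : ℝ, 0 < κ ∧ ∀ t ∈ Icc η 1, κ ≤ ((1 + t) ^ p + (1 - t) ^ p) / 2 - 1 := by
  rcases lt_or_ge 1 η with h1 | h1
  · exact ⟨1, one_pos, fun t ht => absurd (ht.1.trans ht.2) (not_le.2 h1)⟩
  have hcont : ContinuousOn (fun t : ℝ => ((1 + t) ^ p + (1 - t) ^ p) / 2 - 1) (Icc η 1) := by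
    apply Continuous.continuousOn
    have : ∀ x : ℝ, x ≠ 0 ∨ 0 < p := fun x => Or.inr (by linarith)
    have h2 : Continuous fun x : ℝ => x ^ p := Real.continuous_rpow_const (by linarith)
    exact (((h2.comp (by fun_prop : Continuous fun t : ℝ => 1 + t)).add
      (h2.comp (by fun_prop : Continuous fun t : ℝ => 1 - t))).div_const 2).sub continuous_const
  obtain ⟨t0, ht0, hmin⟩ := isCompact_Icc.exists_isMinOn (nonempty_Icc.2 h1) hcont
  refine ⟨_, ?_, fun t ht => hmin ht⟩
  have hx : 1 + t0 ∈ Ici (0:ℝ) := by simp only [mem_Ici]; linarith [ht0.1]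
  have hy : 1 - t0 ∈ Ici (0:ℝ) := by simp only [mem_Ici]; linarith [ht0.2]
  have hs := (strictConvexOn_rpow hp).2 hx hy (by linarith [ht0.1])
    (show (0:ℝ) < 1 / 2 by norm_num) (show (0:ℝ) < 1 / 2 by norm_num) (by norm_num)
  simp only [smul_eq_mul] at hs
  have e : (1 / 2 : ℝ) * (1 + t0) + 1 / 2 * (1 - t0) = 1 := by ring
  rw [e, Real.one_rpow] at hs
  simp only
  linarith

lemma scalar_gap {p η : ℝ} (hp : 1 < p) (hη : 0 < η) :
    ∃ C : ℝ≥0, ∀ a b : ℝ≥0∞, a ≤ ENNReal.ofReal (1 + η) * ((a + b) / 2)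
      + C * ((a ^ p + b ^ p) / 2 - ((a + b) / 2) ^ p) ^ (1 / p) := by
  obtain ⟨κ, hκ, hmin⟩ := scalar_gap_real hp hη
  have hp0 : 0 < p := by linarith
  refine ⟨(2 / κ ^ (1 / p)).toNNReal, fun a b => ?_⟩
  have hη1 : ENNReal.ofReal (1 + η) ≠ 0 := by simp; linarith
  by_cases ha : a = ⊤
  · subst ha
    simp [ENNReal.top_div, ENNReal.mul_top hη1]
  by_cases hb : b = ⊤
  · subst hb
    simp [ENNReal.top_div, ENNReal.mul_top hη1]
  lift a to ℝ≥0 using ha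
  lift b to ℝ≥0 using hb
  by_cases hc : (a : ℝ) ≤ (1 + η) * ((a + b) / 2)
  · refine le_add_right ?_
    have : ((a : ℝ≥0∞) + b) / 2 = ENNReal.ofReal (((a : ℝ) + b) / 2) := by
      rw [ENNReal.ofReal_div_of_pos (by norm_num), ENNReal.ofReal_add (by positivity) (by positivity)]
      simp
    rw [this, ← ENNReal.ofReal_mul (by linarith), ← ENNReal.ofReal_coe_nnreal]
    exact ENNReal.ofReal_le_ofReal hc
  push Not at hc
  refine le_add_left ?_
  set M : ℝ := ((a : ℝ) + b) / 2 with hM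
  have ha0 : (0 : ℝ) ≤ a := a.2
  have hb0 : (0 : ℝ) ≤ b := b.2
  have hM0 : 0 < M := by
    rcases eq_or_lt_of_le (show 0 ≤ M by positivity) with h | h
    · rw [← h] at hc; simp only [mul_zero] at hc; linarith
    · exact h
  have e1 : ((a : ℝ≥0∞) + b) / 2 = ENNReal.ofReal M := by
    rw [hM, ENNReal.ofReal_div_of_pos (by norm_num), ENNReal.ofReal_add (by positivity) (by positivity)]
    simp
  have e2 : ((a : ℝ≥0∞) ^ p + (b : ℝ≥0∞) ^ p) / 2 = ENNReal.ofReal (((a : ℝ) ^ p + (b : ℝ) ^ p) / 2) := by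
    rw [ENNReal.ofReal_div_of_pos (by norm_num), ENNReal.ofReal_add (by positivity) (by positivity),
      ← ENNReal.ofReal_rpow_of_nonneg ha0 hp0.le, ← ENNReal.ofReal_rpow_of_nonneg hb0 hp0.le]
    simp
  rw [e1, e2, ENNReal.ofReal_rpow_of_nonneg hM0.le hp0.le, ← ENNReal.ofReal_sub _ (by positivity)]
  set t := (a : ℝ) / M - 1 with ht
  have hat : (a : ℝ) = M * (1 + t) := by rw [ht]; field_simp; ring
  have hbt : (b : ℝ) = M * (1 - t) := by
    rw [ht]; field_simp; rw [hM]; ring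
  have htη : η ≤ t := by
    by_contra hlt
    push Not at hlt
    have := mul_lt_mul_of_pos_left hlt hM0
    nlinarith
  have ht1 : t ≤ 1 := by
    by_contra hlt
    push Not at hlt
    nlinarith
  have hk := hmin t ⟨htη, ht1⟩
  have hE : M ^ p * κ ≤ ((a : ℝ) ^ p + (b : ℝ) ^ p) / 2 - M ^ p := by
    rw [hat, hbt, Real.mul_rpow hM0.le (by linarith), Real.mul_rpow hM0.le (by linarith)]
    have := mul_le_mul_of_nonneg_left hk (Real.rpow_nonneg hM0.le p)
    linarith
  have hE0 : 0 ≤ M ^ p * κ := by positivity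
  rw [ENNReal.ofReal_rpow_of_nonneg (hE0.trans hE) (by positivity), ← ENNReal.ofReal_coe_nnreal,
    ← ENNReal.ofReal.eq_1, ← ENNReal.ofReal_mul (by positivity)]
  apply ENNReal.ofReal_le_ofReal
  have h3 : (M ^ p * κ) ^ (1 / p) ≤ (((a : ℝ) ^ p + (b : ℝ) ^ p) / 2 - M ^ p) ^ (1 / p) :=
    Real.rpow_le_rpow hE0 hE (by positivity)
  rw [Real.mul_rpow (by positivity) hκ.le, ← Real.rpow_mul hM0.le, mul_one_div_cancel hp0.ne',
    Real.rpow_one] at h3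
  have h4 : (0:ℝ) < κ ^ (1 / p) := by positivity
  calc (a : ℝ) ≤ 2 * M := by rw [hM]; linarith
    _ = 2 / κ ^ (1 / p) * (M * κ ^ (1 / p)) := by field_simp
    _ ≤ _ := by
      gcongr

lemma lintegral_rpow_le_measure_mul {α : Type*} [MeasurableSpace α] (ν : Measure α)
    {p : ℝ} (hp : 1 < p) {f : α → ℝ≥0∞} (hf : AEMeasurable f ν) :
    (∫⁻ a, f a ∂ν) ^ p ≤ ν univ ^ (p - 1) * ∫⁻ a, f a ^ p ∂ν := by
  have hp0 : 0 < p := by linarith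
  have hpq : p.HolderConjugate (p / (p - 1)) := Real.HolderConjugate.conjExponent hp
  have h := ENNReal.lintegral_mul_le_Lp_mul_Lq ν hpq hf (aemeasurable_const (b := (1:ℝ≥0∞)))
  simp only [Pi.mul_apply, mul_one, ENNReal.one_rpow, lintegral_const, one_mul] at h
  calc (∫⁻ a, f a ∂ν) ^ p
      ≤ ((∫⁻ a, f a ^ p ∂ν) ^ (1 / p) * ν univ ^ (1 / (p / (p - 1)))) ^ p := by gcongr
    _ = ν univ ^ (p - 1) * ∫⁻ a, f a ^ p ∂ν := by
      rw [ENNReal.mul_rpow_of_nonneg _ _ hp0.le, ← ENNReal.rpow_mul, ← ENNReal.rpow_mul,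
        one_div_mul_cancel hp0.ne', ENNReal.rpow_one, mul_comm]
      congr 2
      field_simp

lemma lintegral_rpow_Ioo {s : ℝ} (hs : 0 < s) {a : ℝ} (ha : 0 ≤ a) :
    ∫⁻ l in Ioo (0:ℝ) a, ENNReal.ofReal (l ^ (s - 1)) = ENNReal.ofReal (a ^ s / s) := by
  rw [← ofReal_integral_eq_lintegral_ofReal, ← integral_Ioc_eq_integral_Ioo,
    ← intervalIntegral.integral_of_le ha, integral_rpow (Or.inl (by linarith))]
  · simp [hs.ne']
  · have := (intervalIntegral.intervalIntegrable_rpow' (a := 0) (b := a) (r := s - 1) (by linarith)).1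
    exact this.mono_set Ioo_subset_Ioc_self
  · filter_upwards [ae_restrict_mem measurableSet_Ioo] with l hl
    exact Real.rpow_nonneg hl.1.le _

lemma layer_cake_scalar {s : ℝ} (hs : 0 < s) (a : ℝ≥0∞) :
    ∫⁻ l in Ioi (0:ℝ), (if ENNReal.ofReal l < a then ENNReal.ofReal (l ^ (s - 1)) else 0)
      = ENNReal.ofReal (1 / s) * a ^ s := by
  have key : ∀ a : ℝ≥0, ∫⁻ l in Ioi (0:ℝ),
      (if ENNReal.ofReal l < a then ENNReal.ofReal (l ^ (s - 1)) else 0)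
      = ENNReal.ofReal (1 / s) * (a : ℝ≥0∞) ^ s := by
    intro a
    have : ∀ l ∈ Ioi (0:ℝ), (if ENNReal.ofReal l < a then ENNReal.ofReal (l ^ (s - 1)) else 0)
        = (Ioo (0:ℝ) a).indicator (fun l => ENNReal.ofReal (l ^ (s - 1))) l := by
      intro l hl
      have hl' : (0:ℝ) < l := hl
      have : ENNReal.ofReal l < a ↔ l < a := by
        rw [← ENNReal.ofReal_coe_nnreal, ENNReal.ofReal_lt_ofReal_iff']
        constructor
        · exact fun h => h.1
        · exact fun h => ⟨h, hl'.trans h⟩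
      simp [indicator, this, hl']
    rw [setLIntegral_congr_fun measurableSet_Ioi this,
      setLIntegral_indicator measurableSet_Ioo,
      inter_eq_left.2 (fun x hx => hx.1), lintegral_rpow_Ioo hs a.coe_nonneg,
      ← ENNReal.ofReal_coe_nnreal, ENNReal.ofReal_rpow_of_nonneg a.coe_nonneg hs.le,
      ← ENNReal.ofReal_mul (by positivity)]
    congr 1; ring
  by_cases ha : a = ⊤
  · subst ha
    have h1 : ENNReal.ofReal (1 / s) ≠ 0 := by simp [hs]
    rw [ENNReal.top_rpow_of_pos hs, ENNReal.mul_top h1]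
    refine ENNReal.eq_top_of_forall_nnreal_le fun r => ?_
    set t : ℝ≥0 := (r * s.toNNReal) ^ (1 / s) with ht
    calc (r : ℝ≥0∞) = ENNReal.ofReal (1 / s) * (t : ℝ≥0∞) ^ s := by
          rw [← ENNReal.coe_rpow_of_nonneg _ hs.le, ht, ← NNReal.rpow_mul,
            one_div_mul_cancel hs.ne', NNReal.rpow_one, ENNReal.coe_mul, mul_left_comm,
            ← ENNReal.ofReal.eq_1, ← ENNReal.ofReal_mul (by positivity),
            one_div_mul_cancel hs.ne']
          simp
      _ = _ := (key t).symm
      _ ≤ _ := by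
        apply lintegral_mono
        intro l
        by_cases h : ENNReal.ofReal l < t <;> simp [h]
  · lift a to ℝ≥0 using ha
    exact key a

lemma lintegral_rpow_layer_cake {α : Type*} [MeasurableSpace α] (μ : Measure α) [SFinite μ]
    {s : ℝ} (hs : 0 < s) {f : α → ℝ≥0∞} (hf : Measurable f) :
    ∫⁻ x, f x ^ s ∂μ = ENNReal.ofReal s *
      ∫⁻ l in Ioi (0:ℝ), ENNReal.ofReal (l ^ (s - 1)) * μ {x | ENNReal.ofReal l < f x} := by
  have h0 : ∀ x, f x ^ s = ENNReal.ofReal s * ∫⁻ l in Ioi (0:ℝ),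
      (if ENNReal.ofReal l < f x then ENNReal.ofReal (l ^ (s - 1)) else 0) := by
    intro x
    rw [layer_cake_scalar hs, ← mul_assoc, ← ENNReal.ofReal_mul hs.le]
    simp [hs.ne']
  have hm : Measurable fun z : α × ℝ =>
      (if ENNReal.ofReal z.2 < f z.1 then ENNReal.ofReal (z.2 ^ (s - 1)) else 0) := by
    refine Measurable.ite (measurableSet_lt (by fun_prop) (by fun_prop)) ?_ measurable_const
    exact ENNReal.measurable_ofReal.comp (measurable_snd.pow_const _)
  simp_rw [h0]
  rw [lintegral_const_mul _ (Measurable.lintegral_prod_right' hm), lintegral_lintegral_swap hm.aemeasurable]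
  congr 1
  refine lintegral_congr fun l => ?_
  have : ∀ x, (if ENNReal.ofReal l < f x then ENNReal.ofReal (l ^ (s - 1)) else 0)
    = {x | ENNReal.ofReal l < f x}.indicator (fun _ => ENNReal.ofReal (l ^ (s - 1))) x := by
    intro x; simp [indicator]
  simp_rw [this]
  rw [lintegral_indicator_const (measurableSet_lt (by fun_prop) hf)]

lemma lintegral_comp_affine {c : ℝ} (hc : c ≠ 0) (d : ℝ) (g : ℝ → ℝ≥0∞) :
    ∫⁻ r, g (c * r + d) = ENNReal.ofReal |c⁻¹| * ∫⁻ r, g r := by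
  have h1 : ∫⁻ r, g (c * r + d) = ∫⁻ r, (fun y => g (y + d)) r ∂(Measure.map (c * ·) volume) := by
    exact ((Homeomorph.mulLeft₀ c hc).measurableEmbedding.lintegral_map
      (μ := volume) (fun y => g (y + d))).symm
  rw [h1, Real.map_volume_mul_left hc, lintegral_smul_measure, smul_eq_mul]
  congr 1
  exact lintegral_add_right_eq_self g d

lemma setLIntegral_Ioc_comp_affine {c : ℝ} (hc : 0 < c) (a b d : ℝ) (g : ℝ → ℝ≥0∞) :
    ∫⁻ r in Ioc a b, g (c * r + d)
      = ENNReal.ofReal c⁻¹ * ∫⁻ r in Ioc (c * a + d) (c * b + d), g r := by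
  have h := lintegral_comp_affine hc.ne' d ((Ioc (c * a + d) (c * b + d)).indicator g)
  rw [abs_of_pos (inv_pos.2 hc), lintegral_indicator measurableSet_Ioc] at h
  rw [← h, ← lintegral_indicator measurableSet_Ioc]
  refine lintegral_congr fun r => ?_
  have : r ∈ Ioc a b ↔ c * r + d ∈ Ioc (c * a + d) (c * b + d) := by
    simp [hc]
  by_cases hr : r ∈ Ioc a b
  · rw [indicator_of_mem hr, indicator_of_mem (this.1 hr)]
  · rw [indicator_of_notMem hr, indicator_of_notMem (fun h => hr (this.2 h))]

lemma lintegral_avg_rpow_le {α : Type*} [MeasurableSpace α] (ν : Measure α) [IsFiniteMeasure ν]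
    {γ : α → ℝ × ℝ} (hγ : Measurable γ) {f : ℝ × ℝ → ℝ≥0∞} (hf : Measurable f)
    {p : ℝ} (hp : 1 < p) :
    ∫⁻ x, (∫⁻ r, f (x - γ r) ∂ν) ^ p ≤ ν univ ^ p * ∫⁻ x, f x ^ p := by
  have hm : Measurable fun z : (ℝ × ℝ) × α => f (z.1 - γ z.2) ^ p := by fun_prop
  calc ∫⁻ x, (∫⁻ r, f (x - γ r) ∂ν) ^ p
      ≤ ∫⁻ x, ν univ ^ (p - 1) * ∫⁻ r, f (x - γ r) ^ p ∂ν := by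
        refine lintegral_mono fun x => lintegral_rpow_le_measure_mul ν hp ?_
        exact Measurable.aemeasurable (by fun_prop)
    _ = ν univ ^ (p - 1) * ∫⁻ r, (∫⁻ x, f (x - γ r) ^ p) ∂ν := by
        rw [lintegral_const_mul _ (Measurable.lintegral_prod_right' hm),
          lintegral_lintegral_swap hm.aemeasurable]
    _ = ν univ ^ (p - 1) * (ν univ * ∫⁻ x, f x ^ p) := by
        simp_rw [lintegral_sub_right_eq_self (fun x => f x ^ p)]
        rw [lintegral_const, mul_comm (ν univ)]
    _ = _ := by
        rw [← mul_assoc]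
        congr 1
        by_cases h0 : ν univ = 0
        · rw [h0, ENNReal.zero_rpow_of_pos (by linarith), mul_zero,
            ENNReal.zero_rpow_of_pos (by linarith)]
        · conv_lhs => rw [← ENNReal.rpow_one (ν univ), ← ENNReal.rpow_mul, one_mul]
          rw [← ENNReal.rpow_add _ _ h0 (measure_ne_top ν _)]
          congr 1; ring

/-- Average of `f` over the segment from `x - v` to `x`. -/
def lbox (v : ℝ × ℝ) (f : ℝ × ℝ → ℝ≥0∞) (x : ℝ × ℝ) : ℝ≥0∞ :=
  ∫⁻ r in Ioc (0:ℝ) 1, f (x - r • v)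

@[fun_prop]
lemma measurable_lbox (v : ℝ × ℝ) {f : ℝ × ℝ → ℝ≥0∞} (hf : Measurable f) :
    Measurable (lbox v f) := by
  unfold lbox
  have hm : Measurable fun z : (ℝ × ℝ) × ℝ => f (z.1 - z.2 • v) := by fun_prop
  exact Measurable.lintegral_prod_right' hm

lemma lbox_mono (v : ℝ × ℝ) {f g : ℝ × ℝ → ℝ≥0∞} (h : ∀ x, f x ≤ g x) (x : ℝ × ℝ) :
    lbox v f x ≤ lbox v g x := lintegral_mono fun _ => h _

lemma lbox_add_smul (v : ℝ × ℝ) {f g : ℝ × ℝ → ℝ≥0∞} (hf : Measurable f) (c d : ℝ≥0)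
    (hg : Measurable g) (x : ℝ × ℝ) :
    lbox v (fun y => c * f y + d * g y) x = c * lbox v f x + d * lbox v g x := by
  unfold lbox
  rw [lintegral_add_left (by fun_prop), lintegral_const_mul _ (by fun_prop),
    lintegral_const_mul _ (by fun_prop)]

lemma lintegral_lbox_rpow_le (v : ℝ × ℝ) {f : ℝ × ℝ → ℝ≥0∞} (hf : Measurable f) {p : ℝ}
    (hp : 1 < p) : ∫⁻ x, lbox v f x ^ p ≤ ∫⁻ x, f x ^ p := by
  have := lintegral_avg_rpow_le (volume.restrict (Ioc (0:ℝ) 1)) (γ := fun r => r • v)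
    (by fun_prop) hf hp
  simpa [lbox] using this

lemma lbox_double (v : ℝ × ℝ) (f : ℝ × ℝ → ℝ≥0∞) (x : ℝ × ℝ) :
    lbox ((2:ℝ) • v) f x = (lbox v f x + lbox v f (x - v)) / 2 := by
  unfold lbox
  have h1 := setLIntegral_Ioc_comp_affine (c := 2) (by norm_num) 0 1 0 (fun r => f (x - r • v))
  have h2 := setLIntegral_Ioc_comp_affine (c := 1) (by norm_num) 0 1 1 (fun r => f (x - r • v))
  norm_num at h1 h2
  have e1 : ∀ r : ℝ, x - r • (2:ℝ) • v = x - (2 * r) • v := fun r => by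
    rw [smul_smul, mul_comm]
  have e2 : ∀ r : ℝ, x - v - r • v = x - (r + 1) • v := fun r => by
    rw [add_smul, one_smul, add_comm, sub_sub]
  simp_rw [e1, e2]
  rw [h1, h2, ← lintegral_union measurableSet_Ioc (by
    rw [Set.disjoint_left]; intro a ha hb; exact absurd ha.2 (not_le.2 hb.1)),
    Ioc_union_Ioc_eq_Ioc (by norm_num) (by norm_num), ENNReal.div_eq_inv_mul]
  congr 1
  rw [one_div, ENNReal.ofReal_inv_of_pos (by norm_num)]
  simp

/-- The defect in Jensen's inequality when passing from the scale `v` to the scale `2 v`. -/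
def lgap (p : ℝ) (v : ℝ × ℝ) (f : ℝ × ℝ → ℝ≥0∞) (x : ℝ × ℝ) : ℝ≥0∞ :=
  (lbox v f x ^ p + lbox v f (x - v) ^ p) / 2 - lbox ((2:ℝ) • v) f x ^ p

@[fun_prop]
lemma measurable_lgap (p : ℝ) (v : ℝ × ℝ) {f : ℝ × ℝ → ℝ≥0∞} (hf : Measurable f) :
    Measurable (lgap p v f) := by
  unfold lgap
  have := measurable_lbox v hf
  have := measurable_lbox ((2:ℝ) • v) hf
  fun_prop

lemma ENNReal.half_add_rpow_le {p : ℝ} (hp : 1 < p) (a b : ℝ≥0∞) :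
    ((a + b) / 2) ^ p ≤ (a ^ p + b ^ p) / 2 := by
  have h := ENNReal.rpow_arith_mean_le_arith_mean2_rpow 2⁻¹ 2⁻¹ a b
    (ENNReal.inv_two_add_inv_two) hp.le
  rwa [← mul_add, ← mul_add, ← ENNReal.div_eq_inv_mul, ← ENNReal.div_eq_inv_mul] at h

lemma lintegral_lgap_add {p : ℝ} (hp : 1 < p) (v : ℝ × ℝ) {f : ℝ × ℝ → ℝ≥0∞}
    (hf : Measurable f) :
    (∫⁻ x, lgap p v f x) + ∫⁻ x, lbox ((2:ℝ) • v) f x ^ p = ∫⁻ x, lbox v f x ^ p := by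
  have hm := measurable_lbox v hf
  rw [← lintegral_add_left (measurable_lgap p v hf)]
  have : ∀ x, lgap p v f x + lbox ((2:ℝ) • v) f x ^ p
      = 2⁻¹ * (lbox v f x ^ p + lbox v f (x - v) ^ p) := fun x => by
    unfold lgap
    rw [tsub_add_cancel_of_le, ENNReal.div_eq_inv_mul]
    rw [lbox_double v f]
    exact ENNReal.half_add_rpow_le hp _ _
  simp_rw [this]
  rw [lintegral_const_mul _ (by fun_prop), lintegral_add_left (by fun_prop),
    lintegral_sub_right_eq_self (fun x => lbox v f x ^ p), ← two_mul, ← mul_assoc,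
    ENNReal.inv_mul_cancel (by norm_num) (by norm_num), one_mul]

lemma two_zpow_succ_smul (m : ℤ) (v : ℝ × ℝ) :
    ((2:ℝ) ^ (m + 1)) • v = (2:ℝ) • ((2:ℝ) ^ m • v) := by
  rw [smul_smul, zpow_add_one₀ (by norm_num), mul_comm]

lemma sum_le_of_telescoping (a e : ℤ → ℝ≥0∞) (h : ∀ m, e m + a (m + 1) = a m) {A : ℝ≥0∞}
    (ha : ∀ m, a m ≤ A) (S : Finset ℤ) : ∑ m ∈ S, e m ≤ A := by
  obtain ⟨m0, hm0⟩ := S.bddBelow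
  have key : ∀ L : ℕ, ∑ l ∈ Finset.range L, e (m0 + l) + a (m0 + L) = a m0 := by
    intro L
    induction L with
    | zero => simp
    | succ L ih =>
      rw [Finset.sum_range_succ, ← ih, ← h (m0 + L), add_assoc]
      push_cast
      rw [add_assoc m0]
  obtain ⟨m1, hm1⟩ := S.bddAbove
  calc ∑ m ∈ S, e m ≤ ∑ m ∈ (Finset.range (m1 - m0 + 1).toNat).image (fun l : ℕ => m0 + l), e m := by
        refine Finset.sum_le_sum_of_subset fun m hm => ?_
        have h0 := hm0 hm
        have h1 := hm1 hm
        simp only [Finset.mem_image, Finset.mem_range]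
        exact ⟨(m - m0).toNat, by omega, by omega⟩
    _ = ∑ l ∈ Finset.range (m1 - m0 + 1).toNat, e (m0 + l) := by
        rw [Finset.sum_image]
        intro a _ b _ hab
        simpa using hab
    _ ≤ a m0 := by rw [← key (m1 - m0 + 1).toNat]; exact le_self_add
    _ ≤ A := ha _

lemma sum_lintegral_lgap_le {p : ℝ} (hp : 1 < p) (v : ℝ × ℝ) {f : ℝ × ℝ → ℝ≥0∞}
    (hf : Measurable f) (S : Finset ℤ) :
    ∑ m ∈ S, ∫⁻ x, lgap p ((2:ℝ) ^ m • v) f x ≤ ∫⁻ x, f x ^ p := by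
  refine sum_le_of_telescoping (fun m => ∫⁻ x, lbox ((2:ℝ) ^ m • v) f x ^ p) _ (fun m => ?_)
    (fun m => lintegral_lbox_rpow_le _ hf hp) S
  rw [two_zpow_succ_smul]
  exact lintegral_lgap_add hp _ hf

/-- A monotone sublinear operator on nonnegative functions, bounded on `L^p`. -/
structure SublinBdd (p : ℝ) (B : ℝ≥0∞) (T : (ℝ × ℝ → ℝ≥0∞) → (ℝ × ℝ → ℝ≥0∞)) : Prop where
  mono : ∀ f g, (∀ x, f x ≤ g x) → ∀ x, T f x ≤ T g x
  meas : ∀ f, Measurable f → Measurable (T f)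
  lin : ∀ f g, Measurable f → Measurable g → ∀ c d : ℝ≥0, ∀ x,
    T (fun y => c * f y + d * g y) x ≤ c * T f x + d * T g x
  bound : ∀ f, Measurable f → ∫⁻ x, T f x ^ p ≤ B * ∫⁻ x, f x ^ p

lemma ENNReal.iSup_mem_rpow_le {ι : Type*} {p : ℝ} (hp : 0 < p) (N : Finset ι) (a : ι → ℝ≥0∞)
    (X : ℝ≥0∞) (h : ∀ n ∈ N, a n ^ p ≤ X) : (⨆ n ∈ N, a n) ^ p ≤ X := by
  rw [← ENNReal.le_rpow_inv_iff hp]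
  exact iSup₂_le fun n hn => (ENNReal.le_rpow_inv_iff hp).2 (h n hn)

lemma measurable_biSup_finset {α ι : Type*} [MeasurableSpace α] (N : Finset ι)
    {f : ι → α → ℝ≥0∞} (hf : ∀ n, Measurable (f n)) : Measurable fun x => ⨆ n ∈ N, f n x :=
  Measurable.biSup (N : Set ι) N.countable_toSet fun n _ => hf n

lemma natCast_rpow_le_two_rpow {p ε : ℝ} (hp : 0 < p) (hε : 0 < ε) (j : ℕ) :
    (j : ℝ) ^ p ≤ (p / (ε * Real.log 2)) ^ p * 2 ^ (ε * j) := by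
  have hl : 0 < Real.log 2 := Real.log_pos (by norm_num)
  have h1 : (j : ℝ) ≤ p / (ε * Real.log 2) * 2 ^ (ε * j / p) := by
    have := Real.add_one_le_exp (Real.log 2 * (ε * j / p))
    rw [← Real.rpow_def_of_pos (by norm_num)] at this
    calc (j : ℝ) = p / (ε * Real.log 2) * (Real.log 2 * (ε * j / p)) := by field_simp
      _ ≤ _ := by
        gcongr
        linarith
  calc (j : ℝ) ^ p ≤ (p / (ε * Real.log 2) * 2 ^ (ε * j / p)) ^ p := by gcongr
    _ = _ := by
      rw [Real.mul_rpow (by positivity) (by positivity), ← Real.rpow_mul (by norm_num)]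
      congr 2
      field_simp

lemma SublinBdd.lbox_shift_le {p η : ℝ} {C : ℝ≥0} {B : ℝ≥0∞} (hη : 0 < η)
    (hC : ∀ a b : ℝ≥0∞, a ≤ ENNReal.ofReal (1 + η) * ((a + b) / 2)
      + C * ((a ^ p + b ^ p) / 2 - ((a + b) / 2) ^ p) ^ (1 / p))
    {T : (ℝ × ℝ → ℝ≥0∞) → (ℝ × ℝ → ℝ≥0∞)} (hT : SublinBdd p B T) (v : ℝ × ℝ)
    {f : ℝ × ℝ → ℝ≥0∞} (hf : Measurable f) (n : ℤ) (j : ℕ) (x : ℝ × ℝ) :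
    T (lbox ((2:ℝ) ^ (n - j) • v) f) x ≤ ENNReal.ofReal (1 + η) ^ j *
      (T (lbox ((2:ℝ) ^ n • v) f) x
        + C * ∑ i ∈ Finset.range j,
          T (fun y => lgap p ((2:ℝ) ^ (n - i - 1) • v) f y ^ (1 / p)) x) := by
  have h1η : 1 ≤ ENNReal.ofReal (1 + η) := by
    rw [← ENNReal.ofReal_one]; exact ENNReal.ofReal_le_ofReal (by linarith)
  induction j with
  | zero => simp
  | succ j ih =>
    have e : (n - ((j + 1 : ℕ) : ℤ)) = n - j - 1 := by push_cast; ring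
    rw [e]
    have hpt : ∀ y, lbox ((2:ℝ) ^ (n - j - 1) • v) f y ≤
        ((1 + η).toNNReal : ℝ≥0∞) * lbox ((2:ℝ) ^ (n - j) • v) f y
          + C * lgap p ((2:ℝ) ^ (n - j - 1) • v) f y ^ (1 / p) := by
      intro y
      have e2 := two_zpow_succ_smul (n - j - 1) v
      rw [sub_add_cancel] at e2
      unfold lgap
      rw [e2, lbox_double _ f]
      exact hC _ _
    calc T (lbox ((2:ℝ) ^ (n - j - 1) • v) f) x
        ≤ ((1 + η).toNNReal : ℝ≥0∞) * T (lbox ((2:ℝ) ^ (n - j) • v) f) x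
          + C * T (fun y => lgap p ((2:ℝ) ^ (n - j - 1) • v) f y ^ (1 / p)) x :=
          (hT.mono _ _ hpt x).trans (hT.lin _ _ (measurable_lbox _ hf)
            ((measurable_lgap _ _ hf).pow_const _) _ _ x)
      _ ≤ ENNReal.ofReal (1 + η) * (ENNReal.ofReal (1 + η) ^ j *
      (T (lbox ((2:ℝ) ^ n • v) f) x
        + C * ∑ i ∈ Finset.range j,
          T (fun y => lgap p ((2:ℝ) ^ (n - i - 1) • v) f y ^ (1 / p)) x)) +
          ENNReal.ofReal (1 + η) ^ (j + 1) *
            (C * T (fun y => lgap p ((2:ℝ) ^ (n - j - 1) • v) f y ^ (1 / p)) x) := by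
          refine add_le_add (mul_le_mul' le_rfl ih) ?_
          exact le_mul_of_one_le_left zero_le (one_le_pow₀ h1η)
      _ = _ := by
        rw [Finset.sum_range_succ]
        ring

theorem SublinBdd.exists_shifted_scale {p ε : ℝ} (hp : 1 < p) (hε : 0 < ε) :
    ∃ C : ℝ≥0, ∀ (v : ℝ × ℝ) (f : ℝ × ℝ → ℝ≥0∞), Measurable f → ∀ (N : Finset ℤ)
      (T : ℤ → (ℝ × ℝ → ℝ≥0∞) → (ℝ × ℝ → ℝ≥0∞)) (B : ℝ≥0∞), (∀ n, SublinBdd p B (T n)) → ∀ j : ℕ,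
      ∫⁻ x, (⨆ n ∈ N, T n (lbox ((2:ℝ) ^ (n - j) • v) f) x) ^ p ≤
        C * ENNReal.ofReal (2 ^ (ε * j)) *
          ((∫⁻ x, (⨆ n ∈ N, T n (lbox ((2:ℝ) ^ n • v) f) x) ^ p) + B * ∫⁻ x, f x ^ p) := by
  have hp0 : 0 < p := by linarith
  set η : ℝ := 2 ^ (ε / 2 / p) - 1 with hη
  have hη0 : 0 < η := by
    have := Real.one_lt_rpow (x := 2) (by norm_num) (show 0 < ε / 2 / p by positivity)
    linarith
  obtain ⟨C, hC⟩ := scalar_gap hp hη0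
  set C1 : ℝ := (p / (ε / 2 * Real.log 2)) ^ p with hC1
  have hl : 0 < Real.log 2 := Real.log_pos (by norm_num)
  have hC10 : 0 ≤ C1 := by positivity
  refine ⟨2 ^ (p - 1) * (1 + C ^ p * C1.toNNReal), fun v f hf N T B hT j => ?_⟩
  have hpow : (ENNReal.ofReal (1 + η) ^ j) ^ p = ENNReal.ofReal (2 ^ (ε / 2 * j)) := by
    rw [← ENNReal.ofReal_pow (by linarith), ENNReal.ofReal_rpow_of_nonneg (pow_nonneg (by linarith) _) hp0.le, hη]
    congr 1
    rw [add_sub_cancel, ← Real.rpow_natCast, ← Real.rpow_mul (by positivity),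
      ← Real.rpow_mul (by norm_num)]
    congr 1
    field_simp
  have hj : ((j : ℝ≥0∞)) ^ (p - 1) * j ≤ C1.toNNReal * ENNReal.ofReal (2 ^ (ε / 2 * j)) := by
    have h1 := natCast_rpow_le_two_rpow hp0 (half_pos hε) j
    have h2 : ((j : ℝ≥0∞)) ^ (p - 1) * j = ENNReal.ofReal ((j:ℝ) ^ p) := by
      rw [← ENNReal.ofReal_rpow_of_nonneg (by positivity) hp0.le, ENNReal.ofReal_natCast]
      rcases Nat.eq_zero_or_pos j with h | h
      · subst h; simp [hp0]
      · conv_lhs => rw [← ENNReal.rpow_one ((j:ℝ≥0∞)), ← ENNReal.rpow_mul, one_mul]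
        rw [← ENNReal.rpow_add _ _ (by simpa using h.ne') (by simp)]
        congr 1; ring
    rw [h2, ← ENNReal.ofReal.eq_1, ← ENNReal.ofReal_mul hC10]
    exact ENNReal.ofReal_le_ofReal h1
  set S : ℝ × ℝ → ℝ≥0∞ := fun x => ⨆ n ∈ N, T n (lbox ((2:ℝ) ^ n • v) f) x with hS
  set G : ℤ → ℕ → ℝ × ℝ → ℝ≥0∞ := fun n i =>
    T n (fun y => lgap p ((2:ℝ) ^ (n - i - 1) • v) f y ^ (1 / p)) with hG
  have hGm : ∀ n i, Measurable (G n i) := fun n i =>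
    (hT n).meas _ ((measurable_lgap _ _ hf).pow_const _)
  have hSm : Measurable S := by
    exact measurable_biSup_finset N fun n => (hT n).meas _ (measurable_lbox _ hf)
  have hpt : ∀ x, (⨆ n ∈ N, T n (lbox ((2:ℝ) ^ (n - j) • v) f) x) ^ p ≤
      ENNReal.ofReal (2 ^ (ε / 2 * j)) * (2 ^ (p - 1) * (S x ^ p + C ^ p * (j ^ (p - 1) *
        ∑ n ∈ N, ∑ i ∈ Finset.range j, G n i x ^ p))) := by
    intro x
    refine ENNReal.iSup_mem_rpow_le hp0 N _ _ fun n hn => ?_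
    calc T n (lbox ((2:ℝ) ^ (n - j) • v) f) x ^ p
        ≤ (ENNReal.ofReal (1 + η) ^ j * (T n (lbox ((2:ℝ) ^ n • v) f) x
          + C * ∑ i ∈ Finset.range j, G n i x)) ^ p := by
          gcongr
          exact (hT n).lbox_shift_le hη0 hC v hf n j x
      _ ≤ (ENNReal.ofReal (1 + η) ^ j * (S x + C * ∑ i ∈ Finset.range j, G n i x)) ^ p := by
          gcongr
          exact le_iSup₂ (f := fun n (_ : n ∈ N) => T n (lbox ((2:ℝ) ^ n • v) f) x) n hn
      _ = ENNReal.ofReal (2 ^ (ε / 2 * j)) * (S x + C * ∑ i ∈ Finset.range j, G n i x) ^ p := by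
          rw [ENNReal.mul_rpow_of_nonneg _ _ hp0.le, hpow]
      _ ≤ ENNReal.ofReal (2 ^ (ε / 2 * j)) *
          (2 ^ (p - 1) * (S x ^ p + (C * ∑ i ∈ Finset.range j, G n i x) ^ p)) := by
          gcongr
          exact ENNReal.rpow_add_le_mul_rpow_add_rpow _ _ hp.le
      _ ≤ _ := by
          rw [ENNReal.mul_rpow_of_nonneg _ _ hp0.le]
          gcongr
          calc (∑ i ∈ Finset.range j, G n i x) ^ p
              ≤ j ^ (p - 1) * ∑ i ∈ Finset.range j, G n i x ^ p := by
                have := ENNReal.rpow_sum_le_const_mul_sum_rpow (Finset.range j) (fun i => G n i x) hp.le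
                simpa using this
            _ ≤ _ := by
                gcongr
                exact Finset.single_le_sum (f := fun n => ∑ i ∈ Finset.range j, G n i x ^ p)
                  (fun _ _ => zero_le) hn
  have hsum : ∑ n ∈ N, ∑ i ∈ Finset.range j, ∫⁻ x, G n i x ^ p ≤ j * (B * ∫⁻ x, f x ^ p) := by
    rw [Finset.sum_comm]
    calc _ ≤ ∑ i ∈ Finset.range j, (B * ∫⁻ x, f x ^ p) := ?_
      _ = _ := by simp
    refine Finset.sum_le_sum fun i _ => ?_
    calc ∑ n ∈ N, ∫⁻ x, G n i x ^ p
        ≤ ∑ n ∈ N, B * ∫⁻ x, lgap p ((2:ℝ) ^ (n - i - 1) • v) f x := by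
          refine Finset.sum_le_sum fun n _ => ?_
          have := (hT n).bound _ ((measurable_lgap p ((2:ℝ) ^ (n - i - 1) • v) hf).pow_const (1 / p))
          simpa only [← ENNReal.rpow_mul, one_div_mul_cancel hp0.ne', ENNReal.rpow_one] using this
      _ = B * ∑ n ∈ N.image (fun n : ℤ => n - (i : ℤ) - 1), ∫⁻ x, lgap p ((2:ℝ) ^ n • v) f x := by
          rw [Finset.sum_image, Finset.mul_sum]
          intro a _ b _ hab
          simpa using hab
      _ ≤ _ := by
          gcongr
          exact sum_lintegral_lgap_le hp v hf _
  calc _ ≤ ∫⁻ x, ENNReal.ofReal (2 ^ (ε / 2 * j)) * (2 ^ (p - 1) * (S x ^ p + C ^ p * (j ^ (p - 1) *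
        ∑ n ∈ N, ∑ i ∈ Finset.range j, G n i x ^ p))) := lintegral_mono hpt
    _ = ENNReal.ofReal (2 ^ (ε / 2 * j)) * (2 ^ (p - 1) * ((∫⁻ x, S x ^ p) + C ^ p * (j ^ (p - 1) *
        ∑ n ∈ N, ∑ i ∈ Finset.range j, ∫⁻ x, G n i x ^ p))) := by
        rw [lintegral_const_mul _ (by fun_prop), lintegral_const_mul _ (by fun_prop),
          lintegral_add_left (by fun_prop), lintegral_const_mul _ (by fun_prop),
          lintegral_const_mul _ (by fun_prop), lintegral_finsetSum _ (by fun_prop)]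
        congr 6
        funext n
        rw [lintegral_finsetSum _ (by fun_prop)]
    _ ≤ ENNReal.ofReal (2 ^ (ε / 2 * j)) * (2 ^ (p - 1) * ((∫⁻ x, S x ^ p) + C ^ p * (j ^ (p - 1) *
        (j * (B * ∫⁻ x, f x ^ p))))) := by gcongr
    _ = ENNReal.ofReal (2 ^ (ε / 2 * j)) * (2 ^ (p - 1) * ((∫⁻ x, S x ^ p) + C ^ p * (
        (j ^ (p - 1) * j) * (B * ∫⁻ x, f x ^ p)))) := by ring
    _ ≤ ENNReal.ofReal (2 ^ (ε / 2 * j)) * (2 ^ (p - 1) * (ENNReal.ofReal (2 ^ (ε / 2 * j)) * (∫⁻ x, S x ^ p) + C ^ p * (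
        (C1.toNNReal * ENNReal.ofReal (2 ^ (ε / 2 * j))) * (B * ∫⁻ x, f x ^ p)))) := by
        gcongr
        refine le_mul_of_one_le_left (zero_le) ?_
        rw [← ENNReal.ofReal_one]
        exact ENNReal.ofReal_le_ofReal (Real.one_le_rpow (by norm_num) (by positivity))
    _ = (ENNReal.ofReal (2 ^ (ε / 2 * j)) * ENNReal.ofReal (2 ^ (ε / 2 * j))) * (2 ^ (p - 1) * ((∫⁻ x, S x ^ p) + C ^ p *
        C1.toNNReal * (B * ∫⁻ x, f x ^ p))) := by ring
    _ = ENNReal.ofReal (2 ^ (ε * j)) * (2 ^ (p - 1) * ((∫⁻ x, S x ^ p) + C ^ p *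
        C1.toNNReal * (B * ∫⁻ x, f x ^ p))) := by
        rw [← ENNReal.ofReal_mul (by positivity), ← Real.rpow_add (by norm_num)]
        congr 4; ring
    _ ≤ ENNReal.ofReal (2 ^ (ε * j)) * (2 ^ (p - 1) * ((1 + C ^ p * C1.toNNReal) * ((∫⁻ x, S x ^ p) +
        (B * ∫⁻ x, f x ^ p)))) := by
        gcongr
        rw [mul_add, add_mul]
        gcongr
        · rw [one_mul]; exact le_self_add
        · exact le_add_self
    _ = _ := by
        rw [ENNReal.coe_mul, ENNReal.coe_add, ENNReal.coe_mul, ENNReal.coe_one,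
          ENNReal.coe_rpow_of_nonneg _ (by linarith), ENNReal.coe_rpow_of_nonneg _ (by linarith)]
        simp only [ENNReal.coe_ofNat]
        ring

lemma lintegral_iSup_rpow_le {α ι : Type*} [MeasurableSpace α] {μ : Measure α} [Countable ι]
    {p : ℝ} (hp : 0 < p) {a : ι → α → ℝ≥0∞} (ha : ∀ n, Measurable (a n)) {X : ℝ≥0∞}
    (h : ∀ F : Finset ι, ∫⁻ x, (⨆ n ∈ F, a n x) ^ p ∂μ ≤ X) :
    ∫⁻ x, (⨆ n, a n x) ^ p ∂μ ≤ X := by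
  have e : ∀ x, (⨆ n, a n x) ^ p = ⨆ F : Finset ι, (⨆ n ∈ F, a n x) ^ p := by
    intro x
    rw [iSup_eq_iSup_finset]
    exact (ENNReal.orderIsoRpow p hp).map_iSup _
  simp_rw [e]
  rw [lintegral_iSup_directed]
  · exact iSup_le h
  · exact fun F => ((measurable_biSup_finset F ha).pow_const p).aemeasurable
  · intro F G
    refine ⟨F ∪ G, fun x => ?_, fun x => ?_⟩
    · exact ENNReal.rpow_le_rpow (biSup_mono fun n hn => Finset.mem_union_left _ hn) hp.le
    · exact ENNReal.rpow_le_rpow (biSup_mono fun n hn => Finset.mem_union_right _ hn) hp.le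

lemma setLIntegral_dyadic_le (k : ℤ) (h : ℝ → ℝ≥0∞) (x : ℝ) :
    ENNReal.ofReal (2 ^ k) * ∫⁻ r in Ioc (-1:ℝ) 1, h (x - 2 ^ k * r)
      ≤ ∫⁻ y in Metric.closedBall x (2 ^ k), h y := by
  have hk : (0:ℝ) < 2 ^ k := by positivity
  have h1 : ∫⁻ r in Ioc (-1:ℝ) 1, h (x - 2 ^ k * r)
      = ENNReal.ofReal (2 ^ k)⁻¹ * ∫⁻ y in Ioc (-x - 2 ^ k) (-x + 2 ^ k), h (-y) := by
    have := setLIntegral_Ioc_comp_affine hk (-1) 1 (-x) (fun y => h (-y))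
    rw [show (2:ℝ) ^ k * (-1) + -x = -x - 2 ^ k by ring,
      show (2:ℝ) ^ k * 1 + -x = -x + 2 ^ k by ring] at this
    rw [← this]
    refine lintegral_congr fun r => ?_
    congr 1; ring
  rw [h1, ← mul_assoc, ← ENNReal.ofReal_mul hk.le, mul_inv_cancel₀ hk.ne', ENNReal.ofReal_one,
    one_mul, ← lintegral_indicator measurableSet_Ioc,
    ← lintegral_indicator measurableSet_closedBall, ← lintegral_neg_eq_self]
  refine lintegral_mono fun y => ?_
  by_cases hy : -y ∈ Ioc (-x - 2 ^ k) (-x + 2 ^ k)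
  · rw [indicator_of_mem hy, indicator_of_mem]
    · simp
    · rw [mem_Ioc] at hy
      rw [Real.closedBall_eq_Icc, mem_Icc]
      constructor <;> linarith
  · rw [indicator_of_notMem hy]; exact zero_le

lemma dyadic_maximal_weak (F : Finset ℤ) {h : ℝ → ℝ≥0∞} (l : ℝ≥0∞) :
    l * volume {x | l < ⨆ k ∈ F, ∫⁻ r in Ioc (-1:ℝ) 1, h (x - 2 ^ k * r)} ≤ 10 * ∫⁻ x, h x := by
  set E := {x | l < ⨆ k ∈ F, ∫⁻ r in Ioc (-1:ℝ) 1, h (x - 2 ^ k * r)} with hE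
  have hex : ∀ x : ℝ, ∃ k : ℤ, x ∈ E → k ∈ F ∧
      l * ENNReal.ofReal (2 ^ k) ≤ ∫⁻ y in Metric.closedBall x (2 ^ k), h y := by
    intro x
    by_cases hx : x ∈ E
    · rw [hE, mem_ofPred_eq, lt_iSup_iff] at hx
      obtain ⟨k, hk⟩ := hx
      rw [lt_iSup_iff] at hk
      obtain ⟨hkF, hk⟩ := hk
      refine ⟨k, fun _ => ⟨hkF, le_trans ?_ (setLIntegral_dyadic_le k h x)⟩⟩
      rw [mul_comm]
      gcongr
    · exact ⟨0, fun h => absurd h hx⟩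
  choose k hk using hex
  obtain ⟨R, hR⟩ := (F.image fun k : ℤ => (2:ℝ) ^ k).bddAbove
  obtain ⟨u, hut, hdisj, hcov⟩ := Vitali.exists_disjoint_subfamily_covering_enlargement_closedBall
    E (fun x => x) (fun x => (2:ℝ) ^ k x) R (fun x hx => hR (by
      simp only [Finset.coe_image, mem_image, Finset.mem_coe]
      exact ⟨k x, (hk x hx).1, rfl⟩)) 5 (by norm_num)
  have hcount : u.Countable := hdisj.countable_of_nonempty_interior fun x _ => by
    rw [Real.closedBall_eq_Icc, interior_Icc, nonempty_Ioo]
    have : (0:ℝ) < 2 ^ k x := by positivity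
    linarith
  have hsub : E ⊆ ⋃ x ∈ u, Metric.closedBall x (5 * 2 ^ k x) := by
    intro x hx
    obtain ⟨b, hb, hb'⟩ := hcov x hx
    exact mem_biUnion hb (hb' (Metric.mem_closedBall_self (by positivity)))
  have hcount' : Countable u := hcount.to_subtype
  calc l * volume E ≤ l * ∑' x : u, volume (Metric.closedBall (x : ℝ) (5 * 2 ^ k x)) := by
        gcongr
        exact (measure_mono hsub).trans (measure_biUnion_le _ hcount _)
    _ = ∑' x : u, 10 * (l * ENNReal.ofReal (2 ^ k x)) := by
        rw [← ENNReal.tsum_mul_left]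
        congr 1
        funext x
        rw [Real.volume_closedBall, ← mul_assoc, ENNReal.ofReal_mul (by norm_num)]
        norm_num
        ring
    _ ≤ ∑' x : u, 10 * ∫⁻ y in Metric.closedBall (x : ℝ) (2 ^ k x), h y := by
        gcongr with x
        exact (hk x (hut x.2)).2
    _ = 10 * ∫⁻ y in ⋃ x ∈ u, Metric.closedBall (x : ℝ) (2 ^ k x), h y := by
        rw [ENNReal.tsum_mul_left, lintegral_biUnion hcount
          (fun _ _ => measurableSet_closedBall) hdisj]
    _ ≤ 10 * ∫⁻ x, h x := by
        exact mul_le_mul' le_rfl (setLIntegral_le_lintegral _ _)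

lemma dyadic_maximal_distribution (F : Finset ℤ) {h : ℝ → ℝ≥0∞} (hh : Measurable h) {l : ℝ}
    (hl : 0 < l) :
    ENNReal.ofReal l * volume {x | ENNReal.ofReal l < ⨆ k ∈ F, ∫⁻ r in Ioc (-1:ℝ) 1, h (x - 2 ^ k * r)}
      ≤ 20 * ∫⁻ x, (if ENNReal.ofReal l < 4 * h x then h x else 0) := by
  set g : ℝ → ℝ≥0∞ := fun x => if ENNReal.ofReal l < 4 * h x then h x else 0 with hg
  have hgm : Measurable g := Measurable.ite (measurableSet_lt (by fun_prop) (by fun_prop)) hh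
    measurable_const
  have hle : ∀ x, h x ≤ g x + ENNReal.ofReal (l / 4) := by
    intro x
    by_cases hx : ENNReal.ofReal l < 4 * h x
    · simp only [hg, hx, if_true]; exact le_self_add
    · simp only [hg, hx, if_false, zero_add]
      push Not at hx
      rw [ENNReal.ofReal_div_of_pos (by norm_num), ENNReal.le_div_iff_mul_le (by simp) (by simp),
        mul_comm]
      simpa using hx
  have hsub : {x | ENNReal.ofReal l < ⨆ k ∈ F, ∫⁻ r in Ioc (-1:ℝ) 1, h (x - 2 ^ k * r)}
      ⊆ {x | ENNReal.ofReal (l / 2) < ⨆ k ∈ F, ∫⁻ r in Ioc (-1:ℝ) 1, g (x - 2 ^ k * r)} := by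
    intro x hx
    simp only [mem_ofPred_eq, lt_iSup_iff] at hx ⊢
    obtain ⟨k, hk, hx⟩ := hx
    refine ⟨k, hk, ?_⟩
    have h1 : ∫⁻ r in Ioc (-1:ℝ) 1, h (x - 2 ^ k * r)
        ≤ (∫⁻ r in Ioc (-1:ℝ) 1, g (x - 2 ^ k * r)) + ENNReal.ofReal (l / 2) := by
      calc _ ≤ ∫⁻ r in Ioc (-1:ℝ) 1, (g (x - 2 ^ k * r) + ENNReal.ofReal (l / 4)) :=
            lintegral_mono fun r => hle _
        _ = _ := by
            rw [lintegral_add_right _ measurable_const, setLIntegral_const, Real.volume_Ioc,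
              ← ENNReal.ofReal_mul (by positivity)]
            congr 2; ring
    have h2 := hx.trans_le h1
    rw [show l = l / 2 + l / 2 by ring, ENNReal.ofReal_add (by positivity) (by positivity)] at h2
    simp only [add_halves] at h2
    exact lt_of_add_lt_add_right h2
  calc _ ≤ ENNReal.ofReal l * volume {x | ENNReal.ofReal (l / 2) < ⨆ k ∈ F, ∫⁻ r in Ioc (-1:ℝ) 1, g (x - 2 ^ k * r)} := by
        gcongr
    _ = 2 * (ENNReal.ofReal (l / 2) * volume {x | ENNReal.ofReal (l / 2) < ⨆ k ∈ F, ∫⁻ r in Ioc (-1:ℝ) 1, g (x - 2 ^ k * r)}) := by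
        rw [← mul_assoc, ← ENNReal.ofReal_ofNat, ← ENNReal.ofReal_mul (by norm_num)]
        congr 2; ring
    _ ≤ 2 * (10 * ∫⁻ x, g x) := by
        exact mul_le_mul' le_rfl (dyadic_maximal_weak F _)
    _ = _ := by rw [← mul_assoc]; norm_num

theorem dyadic_maximal_finset {p : ℝ} (hp : 1 < p) (F : Finset ℤ) {h : ℝ → ℝ≥0∞}
    (hh : Measurable h) :
    ∫⁻ x, (⨆ k ∈ F, ∫⁻ r in Ioc (-1:ℝ) 1, h (x - 2 ^ k * r)) ^ p
      ≤ (ENNReal.ofReal p * (20 * (ENNReal.ofReal (1 / (p - 1)) * 4 ^ (p - 1)))) * ∫⁻ x, h x ^ p := by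
  have hM : ∀ k : ℤ, Measurable fun x => ∫⁻ r in Ioc (-1:ℝ) 1, h (x - 2 ^ k * r) := fun k =>
    Measurable.lintegral_prod_right' (f := fun z : ℝ × ℝ => h (z.1 - 2 ^ k * z.2)) (by fun_prop)
  rw [lintegral_rpow_layer_cake volume (by linarith) (measurable_biSup_finset F hM)]
  have hm : Measurable fun z : ℝ × ℝ => ENNReal.ofReal (z.1 ^ (p - 1 - 1)) *
      (if ENNReal.ofReal z.1 < 4 * h z.2 then h z.2 else 0) := by
    refine Measurable.mul (ENNReal.measurable_ofReal.comp (measurable_fst.pow_const _)) ?_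
    exact Measurable.ite (measurableSet_lt (by fun_prop) (by fun_prop)) (by fun_prop)
      measurable_const
  calc _ ≤ ENNReal.ofReal p * ∫⁻ l in Ioi (0:ℝ), 20 * ∫⁻ x, ENNReal.ofReal (l ^ (p - 1 - 1)) *
          (if ENNReal.ofReal l < 4 * h x then h x else 0) := by
        gcongr ENNReal.ofReal p * ?_
        refine setLIntegral_mono' measurableSet_Ioi fun l hl => ?_
        have hl : 0 < l := hl
        rw [lintegral_const_mul']
        · have := dyadic_maximal_distribution F hh hl
          calc _ = ENNReal.ofReal (l ^ (p - 1 - 1)) * (ENNReal.ofReal l * volume {x | ENNReal.ofReal l < ⨆ k ∈ F, ∫⁻ r in Ioc (-1:ℝ) 1, h (x - 2 ^ k * r)}) := by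
                rw [← mul_assoc, ← ENNReal.ofReal_mul (by positivity),
                  Real.rpow_sub_one hl.ne' (p - 1), div_mul_cancel₀ _ hl.ne']
            _ ≤ _ := by
                rw [mul_left_comm 20]
                gcongr
        · simp
    _ = ENNReal.ofReal p * (20 * ∫⁻ x, h x * ∫⁻ l in Ioi (0:ℝ),
          (if ENNReal.ofReal l < 4 * h x then ENNReal.ofReal (l ^ (p - 1 - 1)) else 0)) := by
        rw [lintegral_const_mul _ (Measurable.lintegral_prod_right' hm),
          lintegral_lintegral_swap hm.aemeasurable]
        congr 3
        funext x
        rw [← lintegral_const_mul]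
        · refine lintegral_congr fun l => ?_
          simp only [mul_ite, mul_zero]
          congr 1
          rw [mul_comm]
        · refine Measurable.ite (measurableSet_lt (by fun_prop) (by fun_prop)) ?_ measurable_const
          exact ENNReal.measurable_ofReal.comp (measurable_id.pow_const _)
    _ = ENNReal.ofReal p * (20 * ∫⁻ x, (ENNReal.ofReal (1 / (p - 1)) * 4 ^ (p - 1)) * h x ^ p) := by
        congr 3
        funext x
        rw [layer_cake_scalar (by linarith), ENNReal.mul_rpow_of_nonneg _ _ (by linarith)]
        have : h x ^ p = h x * h x ^ (p - 1) := by
          conv_rhs => rw [← ENNReal.rpow_one (h x), ← ENNReal.rpow_mul, one_mul]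
          rw [← ENNReal.rpow_add_of_nonneg _ _ (by linarith) (by linarith)]
          congr 1; ring
        rw [this]; ring
    _ = _ := by
        rw [lintegral_const_mul _ (by fun_prop)]
        ring

/-- Dyadic maximal function in the direction `e`. -/
def dmax (e : ℝ × ℝ) (f : ℝ × ℝ → ℝ≥0∞) (x : ℝ × ℝ) : ℝ≥0∞ :=
  ⨆ k : ℤ, ∫⁻ r in Ioc (-1:ℝ) 1, f (x - ((2:ℝ) ^ k * r) • e)

lemma measurable_dmax_aux (e : ℝ × ℝ) {f : ℝ × ℝ → ℝ≥0∞} (hf : Measurable f) (k : ℤ) :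
    Measurable fun x : ℝ × ℝ => ∫⁻ r in Ioc (-1:ℝ) 1, f (x - ((2:ℝ) ^ k * r) • e) :=
  Measurable.lintegral_prod_right' (f := fun z : (ℝ × ℝ) × ℝ => f (z.1 - ((2:ℝ) ^ k * z.2) • e))
    (by fun_prop)

@[fun_prop]
lemma measurable_dmax (e : ℝ × ℝ) {f : ℝ × ℝ → ℝ≥0∞} (hf : Measurable f) :
    Measurable (dmax e f) := Measurable.iSup (measurable_dmax_aux e hf)

theorem exists_lintegral_dmax_fst_rpow_le {p : ℝ} (hp : 1 < p) : ∃ C : ℝ≥0,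
    ∀ f : ℝ × ℝ → ℝ≥0∞, Measurable f →
      ∫⁻ x, dmax (1, 0) f x ^ p ≤ C * ∫⁻ x, f x ^ p := by
  refine ⟨p.toNNReal * (20 * ((1 / (p - 1)).toNNReal * 4 ^ (p - 1))), fun f hf => ?_⟩
  refine lintegral_iSup_rpow_le (by linarith) (measurable_dmax_aux _ hf) fun F => ?_
  have hm := (measurable_biSup_finset F (measurable_dmax_aux (1, 0) hf)).pow_const p
  rw [Measure.volume_eq_prod, lintegral_prod_symm' _ hm, lintegral_prod_symm' _ (hf.pow_const p),
    ← lintegral_const_mul]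
  · refine lintegral_mono fun y => ?_
    have := dyadic_maximal_finset hp F (h := fun t => f (t, y)) (by fun_prop)
    rw [ENNReal.coe_mul, ENNReal.coe_mul, ENNReal.coe_mul, ENNReal.coe_rpow_of_nonneg _ (by linarith)]
    simpa [ENNReal.ofReal] using this
  · exact Measurable.lintegral_prod_left' (f := fun z : ℝ × ℝ => f z ^ p) (by fun_prop)

theorem exists_lintegral_dmax_snd_rpow_le {p : ℝ} (hp : 1 < p) : ∃ C : ℝ≥0,
    ∀ f : ℝ × ℝ → ℝ≥0∞, Measurable f →
      ∫⁻ x, dmax (0, 1) f x ^ p ≤ C * ∫⁻ x, f x ^ p := by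
  obtain ⟨C, hC⟩ := exists_lintegral_dmax_fst_rpow_le hp
  refine ⟨C, fun f hf => ?_⟩
  have h1 := hC (fun z => f z.swap) (by fun_prop)
  have e : ∀ g : ℝ × ℝ → ℝ≥0∞, ∫⁻ x : ℝ × ℝ, g x.swap = ∫⁻ x, g x := fun g => by
    rw [Measure.volume_eq_prod]
    exact lintegral_prod_swap g
  rw [e (fun z => f z ^ p), ← e] at h1
  convert h1 using 4 with x
  simp [dmax]

lemma exists_lbox_shift_le_dmax (A : ℝ) {w : ℝ} (hw : 0 < w) : ∃ C : ℝ≥0,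
    ∀ (e : ℝ × ℝ) (f : ℝ × ℝ → ℝ≥0∞) (k : ℤ) (a : ℝ), |a| ≤ A → ∀ x,
      lbox ((2:ℝ) ^ k • w • e) f (x - ((2:ℝ) ^ k * a) • e) ≤ C * dmax e f x := by
  obtain ⟨q, hq⟩ := pow_unbounded_of_one_lt (A + w) (one_lt_two (α := ℝ))
  have hq0 : (0:ℝ) < 2 ^ q := by positivity
  refine ⟨(w / 2 ^ q)⁻¹.toNNReal, fun e f k a ha x => ?_⟩
  have h1 := setLIntegral_Ioc_comp_affine (c := w / 2 ^ q) (by positivity) 0 1 (a / 2 ^ q)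
    (fun r => f (x - ((2:ℝ) ^ (k + q) * r) • e))
  have h2 : lbox ((2:ℝ) ^ k • w • e) f (x - ((2:ℝ) ^ k * a) • e)
      = ∫⁻ r in Ioc (0:ℝ) 1, f (x - ((2:ℝ) ^ (k + q) * (w / 2 ^ q * r + a / 2 ^ q)) • e) := by
    unfold lbox
    refine lintegral_congr fun r => ?_
    congr 1
    rw [smul_smul, smul_smul, sub_sub, ← add_smul, zpow_add₀ (by norm_num), zpow_natCast]
    congr 2
    field_simp
    ring
  rw [h2, h1, ← ENNReal.ofReal.eq_1]
  gcongr
  refine le_trans ?_ (le_iSup _ (k + q : ℤ))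
  refine lintegral_mono_set (Ioc_subset_Ioc ?_ ?_)
  · rw [mul_zero, zero_add, le_div_iff₀ hq0]
    linarith [neg_abs_le a]
  · rw [mul_one, ← add_div, div_le_one hq0]
    linarith [le_abs_self a]

lemma sublinBdd_translate {p : ℝ} (z : ℝ × ℝ) : SublinBdd p 1 (fun f x => f (x - z)) where
  mono _ _ h x := h _
  meas f hf := by fun_prop
  lin _ _ _ _ _ _ _ := le_rfl
  bound f _ := by
    rw [one_mul, lintegral_sub_right_eq_self (fun x => f x ^ p)]

theorem exists_shifted_maximal {p ε A w : ℝ} (hp : 1 < p) (hε : 0 < ε) (hw : 0 < w) :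
    ∃ C : ℝ≥0, ∀ (f : ℝ × ℝ → ℝ≥0∞), Measurable f → ∀ (K : Finset ℤ) (a : ℤ → ℝ),
      (∀ k, |a k| ≤ A) → ∀ i : ℕ,
      ∫⁻ x, (⨆ k ∈ K, lbox ((2:ℝ) ^ (k - i) • w • ((1:ℝ), (0:ℝ))) f
        (x - ((2:ℝ) ^ k * a k) • ((1:ℝ), (0:ℝ)))) ^ p
      ≤ C * ENNReal.ofReal (2 ^ (ε * i)) * ∫⁻ x, f x ^ p := by
  obtain ⟨C1, h1⟩ := exists_lbox_shift_le_dmax A hw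
  obtain ⟨C2, h2⟩ := exists_lintegral_dmax_fst_rpow_le hp
  obtain ⟨C3, h3⟩ := SublinBdd.exists_shifted_scale hp hε
  refine ⟨C3 * (C1 ^ p * C2 + 1), fun f hf K a ha i => ?_⟩
  refine (h3 (w • ((1:ℝ), (0:ℝ))) f hf K (fun k g x => g (x - ((2:ℝ) ^ k * a k) • ((1:ℝ), (0:ℝ)))) 1
    (fun k => sublinBdd_translate _) i).trans ?_
  have hb : ∫⁻ x, (⨆ k ∈ K, lbox ((2:ℝ) ^ k • w • ((1:ℝ), (0:ℝ))) f
        (x - ((2:ℝ) ^ k * a k) • ((1:ℝ), (0:ℝ)))) ^ p ≤ C1 ^ p * (C2 * ∫⁻ x, f x ^ p) := by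
    calc _ ≤ ∫⁻ x, (C1 : ℝ≥0∞) ^ p * dmax (1, 0) f x ^ p := by
          refine lintegral_mono fun x => ?_
          rw [← ENNReal.mul_rpow_of_nonneg _ _ (by linarith)]
          exact ENNReal.rpow_le_rpow (iSup₂_le fun k _ => h1 _ _ _ _ (ha k) _) (by linarith)
      _ = C1 ^ p * ∫⁻ x, dmax (1, 0) f x ^ p := lintegral_const_mul _ (by fun_prop)
      _ ≤ _ := by gcongr; exact h2 f hf
  calc _ ≤ C3 * ENNReal.ofReal (2 ^ (ε * i)) * (C1 ^ p * (C2 * ∫⁻ x, f x ^ p) + 1 * ∫⁻ x, f x ^ p) := by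
        gcongr
    _ = _ := by
        rw [ENNReal.coe_mul, ENNReal.coe_add, ENNReal.coe_mul,
          ENNReal.coe_rpow_of_nonneg _ (by linarith), ENNReal.coe_one]
        ring

lemma setLIntegral_curve_le {b ρ θ Y : ℝ} (hb : 1 ≤ b) (hρ : 1 ≤ ρ) (hρ4 : ρ ≤ 4)
    (hY : 4 * 2 ^ b + |θ| < Y) (G : ℝ → ℝ → ℝ≥0∞) :
    ∫⁻ s in Ioc (1:ℝ) 2, G s (ρ * s ^ b + θ)
      ≤ ∫⁻ σ in Ioc (-Y) Y, G (((σ - θ) / ρ) ^ (1 / b)) σ := by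
  have hρ0 : 0 < ρ := by linarith
  have hb0 : 0 < b := by linarith
  have hinv : ∀ s ∈ Ioc (1:ℝ) 2, ((ρ * s ^ b + θ - θ) / ρ) ^ (1 / b) = s := fun s hs => by
    have hs0 : 0 < s := by linarith [hs.1]
    rw [add_sub_cancel_right, mul_div_cancel_left₀ _ hρ0.ne', ← Real.rpow_mul hs0.le,
      mul_one_div_cancel hb0.ne', Real.rpow_one]
  have hinj : InjOn (fun s : ℝ => ρ * s ^ b + θ) (Ioc 1 2) := fun s hs t ht h => by
    rw [← hinv s hs, ← hinv t ht]
    simp only at h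
    rw [h]
  have hder : ∀ s ∈ Ioc (1:ℝ) 2, HasDerivWithinAt (fun s : ℝ => ρ * s ^ b + θ)
      (ρ * (b * s ^ (b - 1))) (Ioc 1 2) s := fun s hs =>
    (((Real.hasDerivAt_rpow_const (Or.inr hb)).const_mul ρ).add_const θ).hasDerivWithinAt
  calc _ ≤ ∫⁻ s in Ioc (1:ℝ) 2, ENNReal.ofReal |ρ * (b * s ^ (b - 1))| *
          (fun σ => G (((σ - θ) / ρ) ^ (1 / b)) σ) (ρ * s ^ b + θ) := by
        refine setLIntegral_mono' measurableSet_Ioc fun s hs => ?_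
        simp only [hinv s hs]
        refine le_mul_of_one_le_left zero_le ?_
        rw [← ENNReal.ofReal_one]
        refine ENNReal.ofReal_le_ofReal (le_trans ?_ (le_abs_self _))
        have : (1:ℝ) ≤ s ^ (b - 1) := Real.one_le_rpow hs.1.le (by linarith)
        exact one_le_mul_of_one_le_of_one_le hρ (one_le_mul_of_one_le_of_one_le hb this)
    _ = ∫⁻ σ in (fun s : ℝ => ρ * s ^ b + θ) '' Ioc 1 2, G (((σ - θ) / ρ) ^ (1 / b)) σ :=
        (lintegral_image_eq_lintegral_abs_deriv_mul measurableSet_Ioc hder hinj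
          (fun σ => G (((σ - θ) / ρ) ^ (1 / b)) σ)).symm
    _ ≤ _ := by
        refine lintegral_mono_set ?_
        rintro _ ⟨s, hs, rfl⟩
        have hs0 : 0 ≤ s := by linarith [hs.1]
        have h1 : s ^ b ≤ 2 ^ b := Real.rpow_le_rpow hs0 hs.2 hb0.le
        have h2 : 0 ≤ s ^ b := Real.rpow_nonneg hs0 _
        have h3 : ρ * s ^ b ≤ 4 * 2 ^ b := mul_le_mul hρ4 h1 h2 (by norm_num)
        have h4 : 0 ≤ ρ * s ^ b := by positivity
        constructor
        · simp only; linarith [neg_abs_le θ, show (0:ℝ) ≤ 4 * 2 ^ b by positivity]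
        · simp only; linarith [le_abs_self θ]

/-- Average of the smoothed function `lbox v f` along the pieces `s ∈ (1,2]` of the curves
`(2 ^ k s, 2 ^ n ρ s ^ b)`, followed by a supremum over `k`. -/
def curveSup (b : ℝ) (K : Finset ℤ) (n : ℤ) (v : ℤ → ℝ × ℝ) (ρ θ₁ θ₂ : ℤ → ℝ)
    (f : ℝ × ℝ → ℝ≥0∞) (x : ℝ × ℝ) : ℝ≥0∞ :=
  ⨆ k ∈ K, ∫⁻ s in Ioc (1:ℝ) 2, lbox (v k) f
    (x - ((2:ℝ) ^ k * (s + θ₁ k), (2:ℝ) ^ n * (ρ k * s ^ b + θ₂ k)))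

lemma measurable_curve_integrand {g : ℝ × ℝ → ℝ≥0∞} (hg : Measurable g) (b a c ρ θ₁ θ₂ : ℝ) :
    Measurable fun z : (ℝ × ℝ) × ℝ => g (z.1 - (a * (z.2 + θ₁), c * (ρ * z.2 ^ b + θ₂))) := by
  have : Measurable fun z : (ℝ × ℝ) × ℝ => z.2 ^ b := measurable_snd.pow_const _
  fun_prop

lemma exists_sublinBdd_curveSup {p ε A w b : ℝ} (hp : 1 < p) (hε : 0 < ε) (hw : 0 < w)
    (hb : 1 ≤ b) : ∃ C : ℝ≥0, ∀ (K : Finset ℤ) (n : ℤ) (ρ θ₁ θ₂ : ℤ → ℝ) (i : ℕ),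
      (∀ k, ρ k ∈ Icc (1:ℝ) 4) → (∀ k, |θ₁ k| ≤ A) → (∀ k, |θ₂ k| ≤ A) →
      SublinBdd p (C * ENNReal.ofReal (2 ^ (ε * i)))
        (curveSup b K n (fun k => (2:ℝ) ^ (k - i) • w • ((1:ℝ), (0:ℝ))) ρ θ₁ θ₂) := by
  obtain ⟨C, hC⟩ := exists_shifted_maximal (A := 2 + A) hp hε hw
  set Y : ℝ := 4 * 2 ^ b + A + 1 with hY
  refine ⟨(2 * Y).toNNReal ^ p * C, fun K n ρ θ₁ θ₂ i hρ hθ₁ hθ₂ => ⟨?_, ?_, ?_, ?_⟩⟩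
  · intro f g h x
    exact iSup₂_mono fun k _ => lintegral_mono fun s => lbox_mono _ h _
  · intro f hf
    refine measurable_biSup_finset K fun k => ?_
    exact Measurable.lintegral_prod_right'
      (measurable_curve_integrand (measurable_lbox _ hf) b _ _ (ρ k) (θ₁ k) (θ₂ k))
  · intro f g hf hg c d x
    refine iSup₂_le fun k hk => ?_
    simp_rw [lbox_add_smul _ hf c d hg]
    have hmf : Measurable fun s : ℝ => lbox ((2:ℝ) ^ (k - i) • w • ((1:ℝ), (0:ℝ))) f
        (x - ((2:ℝ) ^ k * (s + θ₁ k), (2:ℝ) ^ n * (ρ k * s ^ b + θ₂ k))) := (measurable_curve_integrand (measurable_lbox ((2:ℝ) ^ (k - i) • w • ((1:ℝ), (0:ℝ))) hf)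
      b ((2:ℝ) ^ k) ((2:ℝ) ^ n) (ρ k) (θ₁ k) (θ₂ k)).comp (measurable_prodMk_left (x := x))
    have hmg : Measurable fun s : ℝ => lbox ((2:ℝ) ^ (k - i) • w • ((1:ℝ), (0:ℝ))) g
        (x - ((2:ℝ) ^ k * (s + θ₁ k), (2:ℝ) ^ n * (ρ k * s ^ b + θ₂ k))) := (measurable_curve_integrand (measurable_lbox ((2:ℝ) ^ (k - i) • w • ((1:ℝ), (0:ℝ))) hg)
      b ((2:ℝ) ^ k) ((2:ℝ) ^ n) (ρ k) (θ₁ k) (θ₂ k)).comp (measurable_prodMk_left (x := x))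
    rw [lintegral_add_left (hmf.const_mul _), lintegral_const_mul _ hmf, lintegral_const_mul _ hmg]
    gcongr
    · exact le_iSup₂ (f := fun k (_ : k ∈ K) => ∫⁻ s in Ioc (1:ℝ) 2, lbox _ f
        (x - ((2:ℝ) ^ k * (s + θ₁ k), (2:ℝ) ^ n * (ρ k * s ^ b + θ₂ k)))) k hk
    · exact le_iSup₂ (f := fun k (_ : k ∈ K) => ∫⁻ s in Ioc (1:ℝ) 2, lbox _ g
        (x - ((2:ℝ) ^ k * (s + θ₁ k), (2:ℝ) ^ n * (ρ k * s ^ b + θ₂ k)))) k hk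
  · intro f hf
    set a : ℤ → ℝ → ℝ := fun k σ =>
      max (-(2 + A)) (min (2 + A) (((σ - θ₂ k) / ρ k) ^ (1 / b) + θ₁ k)) with ha
    have hA0 : 0 ≤ A := (abs_nonneg _).trans (hθ₁ 0)
    have haA : ∀ k σ, |a k σ| ≤ 2 + A := fun k σ => by
      rw [abs_le]
      refine ⟨le_max_left _ _, max_le (by linarith) (min_le_left _ _)⟩
    have ham : ∀ k, Measurable (a k) := fun k => by
      have : Measurable fun σ : ℝ => ((σ - θ₂ k) / ρ k) ^ (1 / b) :=
        Measurable.pow_const (by fun_prop) _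
      fun_prop
    set H : ℝ × ℝ → ℝ → ℝ≥0∞ := fun x σ => ⨆ k ∈ K, lbox ((2:ℝ) ^ (k - i) • w • ((1:ℝ), (0:ℝ))) f
        (x - ((2:ℝ) ^ n * σ) • ((0:ℝ), (1:ℝ)) - ((2:ℝ) ^ k * a k σ) • ((1:ℝ), (0:ℝ))) with hH
    have hHm : Measurable fun z : (ℝ × ℝ) × ℝ => H z.1 z.2 := by
      refine measurable_biSup_finset K fun k => ?_
      have := ham k
      have := measurable_lbox ((2:ℝ) ^ (k - i) • w • ((1:ℝ), (0:ℝ))) hf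
      fun_prop
    have hpt : ∀ x, curveSup b K n (fun k => (2:ℝ) ^ (k - i) • w • ((1:ℝ), (0:ℝ))) ρ θ₁ θ₂ f x
        ≤ ∫⁻ σ in Ioc (-Y) Y, H x σ := by
      intro x
      refine iSup₂_le fun k hk => ?_
      have h1 := setLIntegral_curve_le (Y := Y) hb (hρ k).1 (hρ k).2 (θ := θ₂ k)
        (by linarith [hθ₂ k]) (fun s σ => lbox ((2:ℝ) ^ (k - i) • w • ((1:ℝ), (0:ℝ))) f
        (x - ((2:ℝ) ^ n * σ) • ((0:ℝ), (1:ℝ)) -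
          ((2:ℝ) ^ k * max (-(2 + A)) (min (2 + A) (s + θ₁ k))) • ((1:ℝ), (0:ℝ))))
      calc _ = ∫⁻ s in Ioc (1:ℝ) 2, lbox ((2:ℝ) ^ (k - i) • w • ((1:ℝ), (0:ℝ))) f
            (x - ((2:ℝ) ^ n * (ρ k * s ^ b + θ₂ k)) • ((0:ℝ), (1:ℝ)) -
          ((2:ℝ) ^ k * max (-(2 + A)) (min (2 + A) (s + θ₁ k))) • ((1:ℝ), (0:ℝ))) := by
            refine setLIntegral_congr_fun measurableSet_Ioc fun s hs => ?_
            have h2 := abs_le.1 (hθ₁ k)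
            simp only
            rw [min_eq_right (by linarith [hs.2]), max_eq_right (by linarith [hs.1])]
            congr 1
            ext <;> simp
        _ ≤ _ := h1
        _ ≤ _ := lintegral_mono fun σ => le_iSup₂ (f := fun k (_ : k ∈ K) =>
          lbox ((2:ℝ) ^ (k - i) • w • ((1:ℝ), (0:ℝ))) f (x - ((2:ℝ) ^ n * σ) • ((0:ℝ), (1:ℝ)) -
            ((2:ℝ) ^ k * a k σ) • ((1:ℝ), (0:ℝ)))) k hk
    have hvol : volume.restrict (Ioc (-Y) Y) univ = ENNReal.ofReal (2 * Y) := by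
      rw [Measure.restrict_apply_univ, Real.volume_Ioc]; congr 1; ring
    have hYpos : 0 < 2 * Y := by positivity
    calc _ ≤ ∫⁻ x, (∫⁻ σ in Ioc (-Y) Y, H x σ) ^ p :=
          lintegral_mono fun x => ENNReal.rpow_le_rpow (hpt x) (by linarith)
      _ ≤ ∫⁻ x, ENNReal.ofReal (2 * Y) ^ (p - 1) * ∫⁻ σ in Ioc (-Y) Y, H x σ ^ p := by
          refine lintegral_mono fun x => ?_
          rw [← hvol]
          exact lintegral_rpow_le_measure_mul _ hp
            (hHm.comp (measurable_prodMk_left (x := x))).aemeasurable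
      _ = ENNReal.ofReal (2 * Y) ^ (p - 1) * ∫⁻ σ in Ioc (-Y) Y, ∫⁻ x, H x σ ^ p := by
          have hm : Measurable fun z : (ℝ × ℝ) × ℝ => H z.1 z.2 ^ p := hHm.pow_const p
          rw [lintegral_const_mul _ (Measurable.lintegral_prod_right' hm),
            lintegral_lintegral_swap hm.aemeasurable]
      _ ≤ ENNReal.ofReal (2 * Y) ^ (p - 1) * ∫⁻ σ in Ioc (-Y) Y,
            C * ENNReal.ofReal (2 ^ (ε * i)) * ∫⁻ x, f x ^ p := by
          gcongr with σ
          have := hC f hf K (fun k => a k σ) (fun k => haA k σ) i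
          rwa [← lintegral_sub_right_eq_self _ (((2:ℝ) ^ n * σ) • ((0:ℝ), (1:ℝ)))] at this
      _ = _ := by
          rw [lintegral_const, hvol]
          have : ((2 * Y).toNNReal : ℝ≥0∞) ^ p
              = ENNReal.ofReal (2 * Y) ^ (p - 1) * ENNReal.ofReal (2 * Y) := by
            rw [← ENNReal.ofReal.eq_1]
            conv_rhs => rw [← ENNReal.rpow_one (ENNReal.ofReal (2 * Y)), ← ENNReal.rpow_mul, one_mul]
            rw [← ENNReal.rpow_add_of_nonneg _ _ (by linarith) (by linarith)]
            congr 1; ring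
          rw [ENNReal.coe_mul, ENNReal.coe_rpow_of_nonneg _ (by linarith), this]
          ring

lemma exists_curveSup_base_le {A w b : ℝ} (hw : 0 < w) :
    ∃ C : ℝ≥0, ∀ (K : Finset ℤ) (n : ℤ) (ρ θ₁ θ₂ : ℤ → ℝ) (i : ℕ) (f : ℝ × ℝ → ℝ≥0∞),
      Measurable f → 0 ≤ b →
      (∀ k, ρ k ∈ Icc (1:ℝ) 4) → (∀ k, |θ₁ k| ≤ A) → (∀ k, |θ₂ k| ≤ A) → ∀ x,
      curveSup b K n (fun k => (2:ℝ) ^ (k - i) • w • ((1:ℝ), (0:ℝ))) ρ θ₁ θ₂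
        (lbox ((2:ℝ) ^ n • w • ((0:ℝ), (1:ℝ))) f) x ≤ C * dmax (1, 0) (dmax (0, 1) f) x := by
  obtain ⟨C1, h1⟩ := exists_lbox_shift_le_dmax (4 * 2 ^ b + A) hw
  obtain ⟨C2, h2⟩ := exists_lbox_shift_le_dmax (1 + A + w) one_pos
  refine ⟨C1 * C2, fun K n ρ θ₁ θ₂ i f hf hb hρ hθ₁ hθ₂ x => iSup₂_le fun k _ => ?_⟩
  have hm2 := measurable_dmax (0, 1) hf
  set e1 : ℝ × ℝ := ((1:ℝ), (0:ℝ)) with he1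
  have hpt : ∀ s ∈ Ioc (1:ℝ) 2, lbox ((2:ℝ) ^ (k - i) • w • e1)
      (lbox ((2:ℝ) ^ n • w • ((0:ℝ), (1:ℝ))) f)
      (x - ((2:ℝ) ^ k * (s + θ₁ k), (2:ℝ) ^ n * (ρ k * s ^ b + θ₂ k)))
      ≤ C1 * lbox ((2:ℝ) ^ (k - i) • w • e1) (dmax (0, 1) f)
        (x - ((2:ℝ) ^ k * (s + θ₁ k)) • e1) := by
    intro s hs
    unfold lbox
    rw [← lintegral_const_mul _ (by fun_prop)]
    refine lintegral_mono fun r => ?_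
    have hs0 : 0 ≤ s := by linarith [hs.1]
    have hs2 : s ^ b ≤ 2 ^ b := Real.rpow_le_rpow hs0 hs.2 hb
    have hs3 : 0 ≤ s ^ b := Real.rpow_nonneg hs0 _
    have h4 := h1 ((0:ℝ), (1:ℝ)) f n (ρ k * s ^ b + θ₂ k) (by
      have h3 : ρ k * s ^ b ≤ 4 * 2 ^ b := mul_le_mul (hρ k).2 hs2 hs3 (by norm_num)
      have h5 : 0 ≤ ρ k * s ^ b := mul_nonneg (by linarith [(hρ k).1]) hs3
      calc _ ≤ |ρ k * s ^ b| + |θ₂ k| := abs_add_le _ _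
        _ ≤ _ := by rw [abs_of_nonneg h5]; linarith [hθ₂ k])
      (x - ((2:ℝ) ^ k * (s + θ₁ k)) • e1 - r • (2:ℝ) ^ (k - i) • w • e1)
    refine le_trans (le_of_eq ?_) h4
    unfold lbox
    refine lintegral_congr fun t => ?_
    congr 1
    ext <;> simp [he1]
  calc _ ≤ ∫⁻ s in Ioc (1:ℝ) 2, C1 * lbox ((2:ℝ) ^ (k - i) • w • e1) (dmax (0, 1) f)
        (x - ((2:ℝ) ^ k * (s + θ₁ k)) • e1) := setLIntegral_mono' measurableSet_Ioc hpt
    _ = C1 * ∫⁻ s in Ioc (1:ℝ) 2, lbox ((2:ℝ) ^ (k - i) • w • e1) (dmax (0, 1) f)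
        (x - ((2:ℝ) ^ k * (s + θ₁ k)) • e1) := by
        have := measurable_lbox ((2:ℝ) ^ (k - i) • w • e1) hm2
        exact lintegral_const_mul _ (by fun_prop)
    _ = C1 * ∫⁻ r in Ioc (0:ℝ) 1, ∫⁻ s in Ioc (1:ℝ) 2, dmax (0, 1) f
        (x - ((2:ℝ) ^ k * (s + θ₁ k)) • e1 - r • (2:ℝ) ^ (k - i) • w • e1) := by
        unfold lbox
        rw [lintegral_lintegral_swap]
        exact Measurable.aemeasurable (by simp only [Function.uncurry_def]; fun_prop)
    _ ≤ C1 * ∫⁻ r in Ioc (0:ℝ) 1, C2 * dmax (1, 0) (dmax (0, 1) f) x := by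
        gcongr C1 * ?_
        refine setLIntegral_mono' measurableSet_Ioc fun r hr => ?_
        have hwi : 0 ≤ w / 2 ^ i * r ∧ w / 2 ^ i * r ≤ w := by
          have h3 : w / 2 ^ i ≤ w := div_le_self hw.le (one_le_pow₀ (by norm_num))
          have h4 : 0 ≤ w / 2 ^ i := by positivity
          exact ⟨mul_nonneg h4 hr.1.le, by nlinarith [hr.1, hr.2]⟩
        have h4 := h2 e1 (dmax (0, 1) f) k (1 + θ₁ k + w / 2 ^ i * r) (by
          have := abs_le.1 (hθ₁ k)
          rw [abs_le]; constructor <;> linarith) x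
        refine le_trans (le_of_eq ?_) h4
        unfold lbox
        have h5 := setLIntegral_Ioc_comp_affine (c := 1) one_pos 0 1 1 (fun s => dmax (0, 1) f
          (x - ((2:ℝ) ^ k * (s + θ₁ k)) • e1 - r • (2:ℝ) ^ (k - i) • w • e1))
        norm_num at h5
        rw [← h5]
        refine lintegral_congr fun s => ?_
        congr 1
        rw [zpow_sub₀ (by norm_num), zpow_natCast]
        ext
        · simp [he1]; field_simp; ring
        · simp [he1]
    _ = _ := by
        rw [setLIntegral_const, ENNReal.coe_mul]
        simp [mul_assoc, he1]

/-- Lacunary maximal bound losing at most `2 ^ (ε * (i + j))` in the smoothing parameters `i`, `j`. -/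
theorem exists_lacunary_maximal {p ε A w b : ℝ} (hp : 1 < p) (hε : 0 < ε)
    (hw : 0 < w) (hb : 1 ≤ b) : ∃ C : ℝ≥0, ∀ (N K : Finset ℤ) (ρ θ₁ θ₂ : ℤ → ℤ → ℝ) (i j : ℕ)
      (f : ℝ × ℝ → ℝ≥0∞), Measurable f →
      (∀ n k, ρ n k ∈ Icc (1:ℝ) 4) → (∀ n k, |θ₁ n k| ≤ A) → (∀ n k, |θ₂ n k| ≤ A) →
      ∫⁻ x, (⨆ n ∈ N, curveSup b K n (fun k => (2:ℝ) ^ (k - i) • w • ((1:ℝ), (0:ℝ)))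
        (ρ n) (θ₁ n) (θ₂ n) (lbox ((2:ℝ) ^ (n - j) • w • ((0:ℝ), (1:ℝ))) f) x) ^ p
      ≤ C * ENNReal.ofReal (2 ^ (ε * i)) * ENNReal.ofReal (2 ^ (ε * j)) * ∫⁻ x, f x ^ p := by
  obtain ⟨C1, h1⟩ := exists_sublinBdd_curveSup (A := A) hp hε hw hb
  obtain ⟨C2, h2⟩ := exists_curveSup_base_le (A := A) (b := b) hw
  obtain ⟨C3, h3⟩ := SublinBdd.exists_shifted_scale hp hε
  obtain ⟨C4, h4⟩ := exists_lintegral_dmax_fst_rpow_le hp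
  obtain ⟨C5, h5⟩ := exists_lintegral_dmax_snd_rpow_le hp
  refine ⟨C3 * (C2 ^ p * (C4 * C5) + C1), fun N K ρ θ₁ θ₂ i j f hf hρ hθ₁ hθ₂ => ?_⟩
  refine (h3 (w • ((0:ℝ), (1:ℝ))) f hf N _ _ (fun n => h1 K n (ρ n) (θ₁ n) (θ₂ n) i (hρ n) (hθ₁ n)
    (hθ₂ n)) j).trans ?_
  have hm2 := measurable_dmax (0, 1) hf
  have hb' : ∫⁻ x, (⨆ n ∈ N, curveSup b K n (fun k => (2:ℝ) ^ (k - i) • w • ((1:ℝ), (0:ℝ)))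
        (ρ n) (θ₁ n) (θ₂ n) (lbox ((2:ℝ) ^ n • w • ((0:ℝ), (1:ℝ))) f) x) ^ p
        ≤ C2 ^ p * (C4 * (C5 * ∫⁻ x, f x ^ p)) := by
    calc _ ≤ ∫⁻ x, (C2 : ℝ≥0∞) ^ p * dmax (1, 0) (dmax (0, 1) f) x ^ p := by
          refine lintegral_mono fun x => ?_
          rw [← ENNReal.mul_rpow_of_nonneg _ _ (by linarith)]
          exact ENNReal.rpow_le_rpow (iSup₂_le fun n _ => h2 K n _ _ _ i f hf (by linarith)
            (hρ n) (hθ₁ n) (hθ₂ n) x) (by linarith)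
      _ = C2 ^ p * ∫⁻ x, dmax (1, 0) (dmax (0, 1) f) x ^ p := lintegral_const_mul _ (by fun_prop)
      _ ≤ _ := by
          gcongr
          refine (h4 _ hm2).trans ?_
          gcongr
          exact h5 f hf
  have h1i : (1:ℝ≥0∞) ≤ ENNReal.ofReal (2 ^ (ε * i)) := by
    rw [← ENNReal.ofReal_one]
    exact ENNReal.ofReal_le_ofReal (Real.one_le_rpow (by norm_num) (by positivity))
  calc _ ≤ C3 * ENNReal.ofReal (2 ^ (ε * j)) * (ENNReal.ofReal (2 ^ (ε * i)) *
        (C2 ^ p * (C4 * (C5 * ∫⁻ x, f x ^ p)))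
          + C1 * ENNReal.ofReal (2 ^ (ε * i)) * ∫⁻ x, f x ^ p) := by
        gcongr
        exact hb'.trans (le_mul_of_one_le_left zero_le h1i)
    _ = _ := by
        rw [ENNReal.coe_mul, ENNReal.coe_add, ENNReal.coe_mul, ENNReal.coe_mul,
          ENNReal.coe_rpow_of_nonneg _ (by linarith)]
        ring

lemma rpow_le_of_mem_Icc {β s : ℝ} (hs : s ∈ Icc 1 β) (r : ℝ) : s ^ r ≤ β ^ |r| :=
  (Real.rpow_le_rpow_of_exponent_le hs.1 (le_abs_self r)).trans
    (Real.rpow_le_rpow (by linarith [hs.1]) hs.2 (abs_nonneg r))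

lemma le_rpow_of_mem_Icc {β s : ℝ} (hs : s ∈ Icc 1 β) (r : ℝ) : β ^ (-|r|) ≤ s ^ r :=
  (Real.rpow_le_rpow_of_nonpos (by linarith [hs.1]) hs.2 (by simp)).trans
    (Real.rpow_le_rpow_of_exponent_le hs.1 (neg_abs_le r))

lemma exists_rpow_sub_rpow_eq {β s t : ℝ} (hs : s ∈ Icc 1 β) (ht : t ∈ Icc 1 β) (r : ℝ) :
    ∃ ξ ∈ Icc 1 β, t ^ r - s ^ r = r * ξ ^ (r - 1) * (t - s) := by
  wlog h : s ≤ t generalizing s t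
  · obtain ⟨ξ, hξ, h'⟩ := this ht hs (by linarith)
    exact ⟨ξ, hξ, by linarith⟩
  rcases h.eq_or_lt with rfl | h
  · exact ⟨s, hs, by simp⟩
  have hd : ∀ x ∈ Icc s t, HasDerivAt (fun x : ℝ => x ^ r) (r * x ^ (r - 1)) x := fun x hx =>
    Real.hasDerivAt_rpow_const (Or.inl (by linarith [hx.1, hs.1]))
  obtain ⟨ξ, hξ, h'⟩ := exists_hasDerivAt_eq_slope (fun x : ℝ => x ^ r) _ h
    (fun x hx => (hd x hx).continuousAt.continuousWithinAt) (fun x hx => hd x ⟨hx.1.le, hx.2.le⟩)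
  refine ⟨ξ, ⟨hs.1.trans hξ.1.le, hξ.2.le.trans ht.2⟩, ?_⟩
  rw [h']
  field_simp [sub_ne_zero.2 h.ne']

lemma abs_rpow_sub_rpow_le {β s t : ℝ} (hs : s ∈ Icc 1 β) (ht : t ∈ Icc 1 β) (r : ℝ) :
    |t ^ r - s ^ r| ≤ |r| * β ^ |r - 1| * |t - s| := by
  obtain ⟨ξ, hξ, h⟩ := exists_rpow_sub_rpow_eq hs ht r
  rw [h, abs_mul, abs_mul, abs_of_nonneg (Real.rpow_nonneg (by linarith [hξ.1]) _)]
  gcongr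
  exact rpow_le_of_mem_Icc hξ _

lemma le_abs_rpow_sub_rpow {β s t : ℝ} (hs : s ∈ Icc 1 β) (ht : t ∈ Icc 1 β) (r : ℝ) :
    |r| * β ^ (-|r - 1|) * |t - s| ≤ |t ^ r - s ^ r| := by
  obtain ⟨ξ, hξ, h⟩ := exists_rpow_sub_rpow_eq hs ht r
  rw [h, abs_mul, abs_mul, abs_of_nonneg (Real.rpow_nonneg (by linarith [hξ.1]) _)]
  gcongr
  exact le_rpow_of_mem_Icc hξ _

/-- A van der Corput type estimate: the second difference of `k` is small on average along
the phase `(s + v) ^ b - s ^ b`. -/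
lemma exists_abs_integral_second_difference_le {b β : ℝ} (hb0 : b ≠ 0) (hb1 : b ≠ 1) (hβ : 1 ≤ β)
    (e : ℝ) : ∃ C : ℝ, 0 ≤ C ∧ ∀ (k : ℝ → ℝ) (M δ v lo hi : ℝ), Continuous k → (∀ t, |k t| ≤ M) →
      0 ≤ δ → v ≠ 0 → lo ≤ hi → 1 ≤ lo → 1 ≤ lo + v → hi ≤ β → hi + v ≤ β →
      |∫ s in lo..hi, s ^ e * (s + v) ^ e * (2 * k ((s + v) ^ b - s ^ b)
        - k ((s + v) ^ b - s ^ b - δ) - k ((s + v) ^ b - s ^ b + δ))| ≤ C * (δ / |v|) * M := by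
  set R : ℝ := β ^ |e| with hR
  set R1 : ℝ := 2 * |e| * (β ^ |e - 1| * β ^ |e|) with hR1
  set c : ℝ := |b| * (|b - 1| * β ^ (-|b - 1 - 1|)) with hc
  set D : ℝ := |b| * (|b - 1| * β ^ |b - 1 - 1|) with hD
  set D' : ℝ := |b| * |b - 1| * (|b - 2| * β ^ |b - 2 - 1|) with hD'
  have hβ0 : 0 < β := by linarith
  have hc0 : 0 < c := by
    have := abs_pos.2 hb0
    have := abs_pos.2 (sub_ne_zero.2 hb1)
    positivity
  have hR0 : 0 ≤ R := by positivity
  set L : ℝ := (R1 * D + R * R * D') / c ^ 2 with hL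
  have hL0 : 0 ≤ L := by positivity
  refine ⟨4 * (R * R / c) + 2 * L * β, by positivity, ?_⟩
  intro k M δ v lo hi hk hM hδ hv hlh hlo hlov hhi hhiv
  have hM0 : 0 ≤ M := (abs_nonneg _).trans (hM 0)
  have hv0 : 0 < |v| := abs_pos.2 hv
  have hmem : ∀ s ∈ Icc lo hi, s ∈ Icc 1 β ∧ s + v ∈ Icc 1 β := fun s hs =>
    ⟨⟨hlo.trans hs.1, hs.2.trans hhi⟩, ⟨by linarith [hs.1], by linarith [hs.2]⟩⟩
  set P : ℝ → ℝ := fun w => ∫ t in (0:ℝ)..w, k t with hP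
  have hPd : ∀ w, HasDerivAt P (k w) w := fun w => hk.integral_hasStrictDerivAt 0 w |>.hasDerivAt
  set H : ℝ → ℝ := fun w => 2 * P w - P (w - δ) - P (w + δ) with hH
  have hHd : ∀ w, HasDerivAt H (2 * k w - k (w - δ) - k (w + δ)) w := fun w =>
    (((hPd w).const_mul 2).sub ((hPd (w - δ)).comp_sub_const w δ)).sub
      ((hPd (w + δ)).comp_add_const w δ)
  have hPb : ∀ x y, |P x - P y| ≤ M * |x - y| := by
    intro x y
    rw [hP]
    simp only
    rw [intervalIntegral.integral_interval_sub_left (hk.intervalIntegrable _ _)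
      (hk.intervalIntegrable _ _)]
    rw [← Real.norm_eq_abs, ← Real.norm_eq_abs]
    exact intervalIntegral.norm_integral_le_of_norm_le_const fun t _ => hM t
  have hHb : ∀ w, |H w| ≤ 2 * δ * M := by
    intro w
    have h1 := hPb w (w - δ)
    have h2 := hPb w (w + δ)
    have e1 : |w - (w - δ)| = δ := by rw [sub_sub_cancel, abs_of_nonneg hδ]
    have e2 : |w - (w + δ)| = δ := by rw [sub_add_cancel_left, abs_neg, abs_of_nonneg hδ]
    rw [e1] at h1; rw [e2] at h2
    calc |H w| = |(P w - P (w - δ)) + (P w - P (w + δ))| := by rw [hH]; congr 1; ring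
      _ ≤ M * δ + M * δ := (abs_add_le _ _).trans (add_le_add h1 h2)
      _ = _ := by ring
  set φ : ℝ → ℝ := fun s => (s + v) ^ b - s ^ b with hφ
  set ψ : ℝ → ℝ := fun s => b * ((s + v) ^ (b - 1) - s ^ (b - 1)) with hψ
  set ψ' : ℝ → ℝ := fun s => b * ((b - 1) * ((s + v) ^ (b - 2) - s ^ (b - 2))) with hψ'
  set W : ℝ → ℝ := fun s => s ^ e * (s + v) ^ e with hW
  set W' : ℝ → ℝ := fun s => e * s ^ (e - 1) * (s + v) ^ e + s ^ e * (e * (s + v) ^ (e - 1)) with hW'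
  have hpow : ∀ s ∈ Icc lo hi, ∀ r : ℝ, HasDerivAt (fun s : ℝ => s ^ r) (r * s ^ (r - 1)) s ∧
      HasDerivAt (fun s : ℝ => (s + v) ^ r) (r * (s + v) ^ (r - 1)) s := by
    intro s hs r
    obtain ⟨h1, h2⟩ := hmem s hs
    exact ⟨Real.hasDerivAt_rpow_const (Or.inl (by linarith [h1.1])),
      (Real.hasDerivAt_rpow_const (x := s + v) (Or.inl (by linarith [h2.1]))).comp_add_const s v⟩
  have hφd : ∀ s ∈ Icc lo hi, HasDerivAt φ (ψ s) s := by
    intro s hs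
    exact ((hpow s hs b).2.sub (hpow s hs b).1).congr_deriv (by simp only [hψ]; ring)
  have hψd : ∀ s ∈ Icc lo hi, HasDerivAt ψ (ψ' s) s := by
    intro s hs
    refine (((hpow s hs (b - 1)).2.sub (hpow s hs (b - 1)).1).const_mul b).congr_deriv ?_
    simp only [hψ', show b - 1 - 1 = b - 2 by ring]; ring
  have hWd : ∀ s ∈ Icc lo hi, HasDerivAt W (W' s) s := fun s hs =>
    (hpow s hs e).1.mul (hpow s hs e).2
  have hψlow : ∀ s ∈ Icc lo hi, c * |v| ≤ |ψ s| := by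
    intro s hs
    have := le_abs_rpow_sub_rpow (hmem s hs).1 (hmem s hs).2 (b - 1)
    rw [add_sub_cancel_left] at this
    rw [hψ, abs_mul, hc, mul_assoc]
    gcongr
  have hψup : ∀ s ∈ Icc lo hi, |ψ s| ≤ D * |v| := by
    intro s hs
    have := abs_rpow_sub_rpow_le (hmem s hs).1 (hmem s hs).2 (b - 1)
    rw [add_sub_cancel_left] at this
    rw [hψ, abs_mul, hD, mul_assoc]
    gcongr
  have hψ'up : ∀ s ∈ Icc lo hi, |ψ' s| ≤ D' * |v| := by
    intro s hs
    have := abs_rpow_sub_rpow_le (hmem s hs).1 (hmem s hs).2 (b - 2)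
    rw [add_sub_cancel_left] at this
    rw [hψ', abs_mul, abs_mul, ← mul_assoc, hD', mul_assoc (|b| * |b - 1|)]
    gcongr
  have hpos : ∀ s ∈ Icc 1 β, ∀ r : ℝ, |s ^ r| ≤ β ^ |r| := fun s hs r => by
    rw [abs_of_nonneg (Real.rpow_nonneg (by linarith [hs.1]) _)]
    exact rpow_le_of_mem_Icc hs r
  have hWup : ∀ s ∈ Icc lo hi, |W s| ≤ R * R := by
    intro s hs
    rw [hW, abs_mul]
    exact mul_le_mul (hpos _ (hmem s hs).1 e) (hpos _ (hmem s hs).2 e) (abs_nonneg _) hR0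
  have hW'up : ∀ s ∈ Icc lo hi, |W' s| ≤ R1 := by
    intro s hs
    have h1 := hpos _ (hmem s hs).1 e
    have h2 := hpos _ (hmem s hs).2 e
    have h3 := hpos _ (hmem s hs).1 (e - 1)
    have h4 := hpos _ (hmem s hs).2 (e - 1)
    rw [hW']
    refine (abs_add_le _ _).trans ?_
    rw [abs_mul, abs_mul, abs_mul, abs_mul]
    calc _ ≤ |e| * β ^ |e - 1| * β ^ |e| + β ^ |e| * (|e| * β ^ |e - 1|) := by gcongr
      _ = _ := by rw [hR1]; ring
  have hψne : ∀ s ∈ Icc lo hi, ψ s ≠ 0 := fun s hs =>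
    abs_pos.1 (lt_of_lt_of_le (by positivity) (hψlow s hs))
  set u : ℝ → ℝ := fun s => W s / ψ s with hu
  set u' : ℝ → ℝ := fun s => (W' s * ψ s - W s * ψ' s) / ψ s ^ 2 with hu'
  have hud : ∀ s ∈ Icc lo hi, HasDerivAt u (u' s) s := fun s hs =>
    (hWd s hs).div (hψd s hs) (hψne s hs)
  have huup : ∀ s ∈ Icc lo hi, |u s| ≤ R * R / (c * |v|) := by
    intro s hs
    rw [hu, abs_div]
    exact div_le_div₀ (by positivity) (hWup s hs) (by positivity) (hψlow s hs)
  have hu'up : ∀ s ∈ Icc lo hi, |u' s| ≤ L / |v| := by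
    intro s hs
    have h1 : |W' s * ψ s - W s * ψ' s| ≤ (R1 * D + R * R * D') * |v| := by
      refine (abs_sub _ _).trans ?_
      rw [abs_mul (W' s), abs_mul (W s)]
      calc _ ≤ R1 * (D * |v|) + R * R * (D' * |v|) :=
            add_le_add (mul_le_mul (hW'up s hs) (hψup s hs) (abs_nonneg _) (by positivity))
              (mul_le_mul (hWup s hs) (hψ'up s hs) (abs_nonneg _) (by positivity))
        _ = _ := by ring
    rw [hu', abs_div, abs_pow]
    calc _ ≤ ((R1 * D + R * R * D') * |v|) / (c * |v|) ^ 2 := by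
          gcongr
          exact hψlow s hs
      _ = _ := by rw [hL]; field_simp
  have hcp : ∀ r : ℝ, ContinuousOn (fun s : ℝ => s ^ r) (Icc lo hi) ∧
      ContinuousOn (fun s : ℝ => (s + v) ^ r) (Icc lo hi) := fun r =>
    ⟨fun s hs => (hpow s hs r).1.continuousAt.continuousWithinAt,
      fun s hs => (hpow s hs r).2.continuousAt.continuousWithinAt⟩
  have hcψ : ContinuousOn ψ (Icc lo hi) := fun s hs => (hψd s hs).continuousAt.continuousWithinAt
  have hcφ : ContinuousOn φ (Icc lo hi) := fun s hs => (hφd s hs).continuousAt.continuousWithinAt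
  have hcW : ContinuousOn W (Icc lo hi) := fun s hs => (hWd s hs).continuousAt.continuousWithinAt
  have hcψ' : ContinuousOn ψ' (Icc lo hi) :=
    (((hcp (b - 2)).2.sub (hcp (b - 2)).1).const_mul (b - 1)).const_mul b
  have hcW' : ContinuousOn W' (Icc lo hi) :=
    (((hcp (e - 1)).1.const_mul e).mul (hcp e).2).add
      ((hcp e).1.mul ((hcp (e - 1)).2.const_mul e))
  have hcu' : ContinuousOn u' (Icc lo hi) :=
    ((hcW'.mul hcψ).sub (hcW.mul hcψ')).div (hcψ.pow 2) fun s hs => pow_ne_zero 2 (hψne s hs)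
  have hcH : Continuous fun w => 2 * k w - k (w - δ) - k (w + δ) := by fun_prop
  have hparts := intervalIntegral.integral_mul_deriv_eq_deriv_mul (a := lo) (b := hi) (u := u)
    (u' := u') (v := fun s => H (φ s))
    (v' := fun s => (2 * k (φ s) - k (φ s - δ) - k (φ s + δ)) * ψ s)
    (by rw [uIcc_of_le hlh]; exact hud)
    (by rw [uIcc_of_le hlh]; exact fun s hs => (hHd (φ s)).comp s (hφd s hs))
    (by refine ContinuousOn.intervalIntegrable ?_; rwa [uIcc_of_le hlh])
    (by
      refine ContinuousOn.intervalIntegrable ?_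
      rw [uIcc_of_le hlh]
      exact (hcH.comp_continuousOn hcφ).mul hcψ)
  have heq : ∫ s in lo..hi, s ^ e * (s + v) ^ e * (2 * k ((s + v) ^ b - s ^ b)
        - k ((s + v) ^ b - s ^ b - δ) - k ((s + v) ^ b - s ^ b + δ))
      = ∫ s in lo..hi, u s * ((2 * k (φ s) - k (φ s - δ) - k (φ s + δ)) * ψ s) := by
    refine intervalIntegral.integral_congr fun s hs => ?_
    rw [uIcc_of_le hlh] at hs
    have := hψne s hs
    simp only [hu, hW, hφ]
    field_simp
  have hmul : ∀ {x y A B : ℝ}, |x| ≤ A → |y| ≤ B → |x * y| ≤ A * B := fun {x y A B} hx hy => by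
    rw [abs_mul]
    exact mul_le_mul hx hy (abs_nonneg _) ((abs_nonneg _).trans hx)
  have h1 := hmul (huup hi (right_mem_Icc.2 hlh)) (hHb (φ hi))
  have h2 := hmul (huup lo (left_mem_Icc.2 hlh)) (hHb (φ lo))
  have h3 : |∫ s in lo..hi, u' s * H (φ s)| ≤ L / |v| * (2 * δ * M) * |hi - lo| := by
    rw [← Real.norm_eq_abs, ← Real.norm_eq_abs (hi - lo)]
    refine intervalIntegral.norm_integral_le_of_norm_le_const fun s hs => ?_
    rw [uIoc_of_le hlh] at hs
    exact hmul (hu'up s (Ioc_subset_Icc_self hs)) (hHb _)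
  have h4 : |hi - lo| ≤ β := by rw [abs_of_nonneg (by linarith)]; linarith
  rw [heq, hparts]
  calc _ ≤ R * R / (c * |v|) * (2 * δ * M) + R * R / (c * |v|) * (2 * δ * M)
        + L / |v| * (2 * δ * M) * β := by
        refine (abs_sub _ _).trans (add_le_add ((abs_sub _ _).trans (add_le_add h1 h2)) ?_)
        exact h3.trans (by gcongr)
    _ = _ := by field_simp; ring

/-- Bounded, continuous and integrable functions on the plane. -/
structure BCI (f : ℝ × ℝ → ℝ) : Prop where
  cont : Continuous f
  int : Integrable f
  bdd : ∃ C, ∀ x, |f x| ≤ C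

namespace BCI

variable {f g : ℝ × ℝ → ℝ}

lemma translate (hf : BCI f) (a : ℝ × ℝ) : BCI fun x => f (x - a) := by
  obtain ⟨C, hC⟩ := hf.bdd
  exact ⟨hf.cont.comp (by fun_prop), hf.int.comp_sub_right a, C, fun x => hC _⟩

lemma sub (hf : BCI f) (hg : BCI g) : BCI fun x => f x - g x := by
  obtain ⟨C, hC⟩ := hf.bdd
  obtain ⟨D, hD⟩ := hg.bdd
  exact ⟨hf.cont.sub hg.cont, hf.int.sub hg.int, C + D, fun x =>
    (abs_sub _ _).trans (add_le_add (hC x) (hD x))⟩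

lemma add (hf : BCI f) (hg : BCI g) : BCI fun x => f x + g x := by
  obtain ⟨C, hC⟩ := hf.bdd
  obtain ⟨D, hD⟩ := hg.bdd
  exact ⟨hf.cont.add hg.cont, hf.int.add hg.int, C + D, fun x =>
    (abs_add_le _ _).trans (add_le_add (hC x) (hD x))⟩

lemma const_mul (hf : BCI f) (c : ℝ) : BCI fun x => c * f x := by
  obtain ⟨C, hC⟩ := hf.bdd
  exact ⟨continuous_const.mul hf.cont, hf.int.const_mul c, |c| * C, fun x => by
    rw [abs_mul]; exact mul_le_mul_of_nonneg_left (hC x) (abs_nonneg c)⟩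

lemma mul (hf : BCI f) (hg : BCI g) : BCI fun x => f x * g x := by
  obtain ⟨C, hC⟩ := hf.bdd
  obtain ⟨D, hD⟩ := hg.bdd
  refine ⟨hf.cont.mul hg.cont, ?_, C * D, fun x => ?_⟩
  · exact hg.int.bdd_mul hf.cont.aestronglyMeasurable (Eventually.of_forall hC)
  · rw [abs_mul]
    exact mul_le_mul (hC x) (hD x) (abs_nonneg _) ((abs_nonneg _).trans (hC x))

lemma integrable_sq (hf : BCI f) : Integrable fun x => f x ^ 2 := by
  simpa only [sq] using (hf.mul hf).int

lemma ofReal_integral_sq (hf : BCI f) :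
    ENNReal.ofReal (∫ x, f x ^ 2) = ∫⁻ x, ‖f x‖ₑ ^ 2 := by
  rw [ofReal_integral_eq_lintegral_ofReal hf.integrable_sq (Eventually.of_forall fun x => sq_nonneg _)]
  refine lintegral_congr fun x => ?_
  rw [← sq_abs, ENNReal.ofReal_pow (abs_nonneg _), Real.enorm_eq_ofReal_abs]

/-- The autocorrelation of `f`. -/
lemma continuous_autocorr (hf : BCI f) : Continuous fun y => ∫ x, f x * f (x - y) := by
  obtain ⟨C, hC⟩ := hf.bdd
  refine continuous_of_dominated (bound := fun x => |f x| * C) (fun y => ?_) (fun y => ?_) ?_ ?_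
  · exact (hf.cont.mul (hf.cont.comp (by fun_prop))).aestronglyMeasurable
  · refine Eventually.of_forall fun x => ?_
    rw [Real.norm_eq_abs, abs_mul]
    exact mul_le_mul_of_nonneg_left (hC _) (abs_nonneg _)
  · exact hf.int.abs.mul_const C
  · exact Eventually.of_forall fun x => continuous_const.mul (hf.cont.comp (by fun_prop))

lemma abs_autocorr_le (hf : BCI f) (y : ℝ × ℝ) : |∫ x, f x * f (x - y)| ≤ ∫ x, f x ^ 2 := by
  have h1 := hf.integrable_sq
  have h2 := (hf.translate y).integrable_sq
  calc |∫ x, f x * f (x - y)| ≤ ∫ x, |f x * f (x - y)| := abs_integral_le_integral_abs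
    _ ≤ ∫ x, (f x ^ 2 + f (x - y) ^ 2) / 2 := by
        refine integral_mono (hf.mul (hf.translate y)).int.abs ((h1.add h2).div_const 2) fun x => ?_
        simp only
        rw [abs_le]
        constructor <;> nlinarith [sq_nonneg (f x + f (x - y)), sq_nonneg (f x - f (x - y))]
    _ = _ := by
        rw [integral_div, integral_add h1 h2, integral_sub_right_eq_self (fun x => f x ^ 2)]
        ring

lemma autocorr_difference (hf : BCI f) (d y : ℝ × ℝ) :
    ∫ x, (f x - f (x - d)) * (f (x - y) - f (x - y - d))
      = 2 * (∫ x, f x * f (x - y)) - (∫ x, f x * f (x - (y - d)))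
        - ∫ x, f x * f (x - (y + d)) := by
  have e1 : ∫ x, f (x - d) * f (x - y) = ∫ x, f x * f (x - (y - d)) := by
    rw [← integral_sub_right_eq_self (fun x => f x * f (x - (y - d))) d]
    congr 1; ext x; congr 2; abel
  have e2 : ∫ x, f (x - d) * f (x - y - d) = ∫ x, f x * f (x - y) := by
    rw [← integral_sub_right_eq_self (fun x => f x * f (x - y)) d]
    congr 1; ext x; congr 2; abel
  have e3 : ∫ x, f x * f (x - y - d) = ∫ x, f x * f (x - (y + d)) := by
    congr 1; ext x; congr 2; abel
  have i1 := (hf.mul (hf.translate y)).int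
  have i2 := (hf.mul ((hf.translate d).translate y)).int
  have i3 := ((hf.translate d).mul (hf.translate y)).int
  have i4 := ((hf.translate d).mul ((hf.translate d).translate y)).int
  calc _ = ∫ x, ((f x * f (x - y) - f x * f (x - y - d)) -
        (f (x - d) * f (x - y) - f (x - d) * f (x - y - d))) := by
        congr 1; ext x; ring
    _ = ((∫ x, f x * f (x - y)) - ∫ x, f x * f (x - y - d)) -
        ((∫ x, f (x - d) * f (x - y)) - ∫ x, f (x - d) * f (x - y - d)) := by
        have j1 : Integrable fun x => f x * f (x - y) - f x * f (x - y - d) := i1.sub i2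
        have j2 : Integrable fun x => f (x - d) * f (x - y) - f (x - d) * f (x - y - d) := i3.sub i4
        rw [integral_sub j1 j2, integral_sub i1 i2, integral_sub i3 i4]
    _ = _ := by rw [e1, e2, e3]; ring

/-- The square of the `L²` norm of a weighted average of translates, in terms of the
autocorrelation. -/
lemma integral_sq_average (hf : BCI f) {w : ℝ → ℝ} (hw : Integrable w) (hwm : Measurable w)
    {γ : ℝ → ℝ × ℝ} (hγ : Measurable γ) :
    Integrable (fun x => (∫ s, w s * f (x - γ s)) ^ 2) ∧
    ∫ x, (∫ s, w s * f (x - γ s)) ^ 2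
      = ∫ v, ∫ s, w s * w (s + v) * ∫ x, f x * f (x - (γ (s + v) - γ s)) := by
  obtain ⟨C, hC⟩ := hf.bdd
  have hC0 : 0 ≤ C := (abs_nonneg _).trans (hC 0)
  set F : (ℝ × ℝ) × (ℝ × ℝ) → ℝ := fun z =>
    (w z.2.1 * f (z.1 - γ z.2.1)) * (w z.2.2 * f (z.1 - γ z.2.2)) with hF
  have hfm := hf.cont.measurable
  have hFm : Measurable F := by fun_prop
  have hFi : Integrable F (volume.prod volume) := by
    rw [integrable_prod_iff' hFm.aestronglyMeasurable]
    have hx : ∀ z : ℝ × ℝ, Integrable fun x => F (x, z) := fun z =>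
      (((hf.translate (γ z.1)).const_mul (w z.1)).mul
        ((hf.translate (γ z.2)).const_mul (w z.2))).int
    refine ⟨Eventually.of_forall hx, ?_⟩
    refine Integrable.mono' ((hw.norm.mul_prod hw.norm).mul_const (C * ∫ x, |f x|)) ?_ ?_
    · exact hFm.norm.aestronglyMeasurable.prod_swap.integral_prod_right'
    · refine Eventually.of_forall fun z => ?_
      rw [Real.norm_of_nonneg (integral_nonneg fun x => norm_nonneg _)]
      calc _ ≤ ∫ x, ‖w z.1‖ * ‖w z.2‖ * C * |f (x - γ z.1)| := by
            refine integral_mono (hx z).norm ((hf.translate (γ z.1)).int.abs.const_mul _) fun x => ?_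
            simp only [hF, Real.norm_eq_abs, abs_mul]
            calc _ = |w z.1| * |w z.2| * |f (x - γ z.2)| * |f (x - γ z.1)| := by ring
              _ ≤ _ := by gcongr; exact hC _
        _ = _ := by
            rw [integral_const_mul, integral_sub_right_eq_self (fun x => |f x|)]; ring
  set Φ : ℝ × ℝ → ℝ := fun z => w z.1 * w z.2 * ∫ x, f x * f (x - (γ z.2 - γ z.1)) with hΦ
  have hFΦ : ∀ z, ∫ x, F (x, z) = Φ z := by
    intro z
    calc _ = ∫ x, w z.1 * w z.2 * (f (x - γ z.1) * f (x - γ z.2)) := by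
          congr 1; ext x; simp only [hF]; ring
      _ = _ := by
          rw [integral_const_mul]
          simp only [hΦ]
          rw [← integral_sub_right_eq_self (fun x => f x * f (x - (γ z.2 - γ z.1))) (γ z.1)]
          congr 3; ext x; congr 2; abel
  have hsq : ∀ x, (∫ s, w s * f (x - γ s)) ^ 2 = ∫ z, F (x, z) := by
    intro x
    rw [sq, ← integral_prod_mul]
    rfl
  have hΦi : Integrable Φ (volume.prod volume) := by
    have := hFi.integral_prod_right
    simp_rw [hFΦ] at this
    exact this
  have hmp := measurePreserving_prod_add (volume : Measure ℝ) (volume : Measure ℝ)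
  have hΦi' : Integrable (fun z : ℝ × ℝ => Φ (z.1, z.1 + z.2)) (volume.prod volume) :=
    hmp.integrable_comp_of_integrable hΦi
  refine ⟨?_, ?_⟩
  · simp_rw [hsq]
    exact hFi.integral_prod_left
  · simp_rw [hsq]
    rw [integral_integral_swap (f := fun x z => F (x, z)) hFi]
    simp_rw [hFΦ]
    calc ∫ z, Φ z = ∫ s, ∫ t, Φ (s, t) := integral_prod Φ hΦi
      _ = ∫ s, ∫ v, Φ (s, s + v) := by
          congr 1; ext s
          rw [integral_add_left_eq_self (fun t => Φ (s, t))]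
      _ = ∫ v, ∫ s, Φ (s, s + v) := integral_integral_swap hΦi'

end BCI

lemma integrableOn_abs_rpow {β r : ℝ} (hr : -1 < r) :
    IntegrableOn (fun v : ℝ => |v| ^ r) (Icc (-β) β) := by
  rcases lt_or_ge β 0 with hβ | hβ
  · rw [Icc_eq_empty (by linarith)]; exact integrableOn_empty
  have h1 : IntervalIntegrable (fun v : ℝ => |v| ^ r) volume 0 β := by
    refine (intervalIntegral.intervalIntegrable_rpow' hr).congr fun v hv => ?_
    rw [uIoc_of_le hβ] at hv
    rw [abs_of_pos hv.1]
  have h2 : IntervalIntegrable (fun v : ℝ => |v| ^ r) volume (-β) 0 := by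
    have := (IntervalIntegrable.iff_comp_neg (f := fun v : ℝ => |v| ^ r)).1 h1
    simpa using this.symm
  rw [integrableOn_Icc_iff_integrableOn_Ioc, ← intervalIntegrable_iff_integrableOn_Ioc_of_le (by linarith)]
  exact h2.trans h1

/-- Smoothing of averages over curves in `L²`: differences in the vertical direction. -/
theorem exists_integral_sq_curve_difference_le {b β ε : ℝ} (hb0 : b ≠ 0) (hb1 : b ≠ 1)
    (hβ : 1 ≤ β) (e : ℝ) (hε : 0 < ε) (hε1 : ε < 1) : ∃ C : ℝ, 0 ≤ C ∧
      ∀ (g : ℝ × ℝ → ℝ) (l m δ : ℝ), BCI g → 0 < δ →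
      Integrable (fun x : ℝ × ℝ => (∫ s in Ioc 1 β, s ^ e * (g (x - (l * s, m * s ^ b))
        - g (x - (l * s, m * s ^ b) - (0, m * δ)))) ^ 2) ∧
      ∫ x : ℝ × ℝ, (∫ s in Ioc 1 β, s ^ e * (g (x - (l * s, m * s ^ b))
        - g (x - (l * s, m * s ^ b) - (0, m * δ)))) ^ 2 ≤ C * δ ^ (1 - ε) * ∫ x, g x ^ 2 := by
  obtain ⟨C1, hC1, h7⟩ := exists_abs_integral_second_difference_le hb0 hb1 hβ e
  set R : ℝ := β ^ |e| with hR
  have hβ0 : 0 < β := by linarith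
  have hR0 : 0 ≤ R := by positivity
  set C2 : ℝ := C1 + R * R * 4 * β with hC2
  have hC20 : 0 ≤ C2 := by positivity
  set I : ℝ := ∫ v in Icc (-β) β, |v| ^ (ε - 1) with hI
  have hI0 : 0 ≤ I := integral_nonneg fun v => Real.rpow_nonneg (abs_nonneg _) _
  refine ⟨C2 * I, by positivity, fun g l m δ hg hδ => ?_⟩
  set K0 : ℝ := ∫ x, g x ^ 2 with hK0
  have hK00 : 0 ≤ K0 := integral_nonneg fun x => sq_nonneg _
  set h : ℝ × ℝ → ℝ := fun x => g x - g (x - (0, m * δ)) with hh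
  have hhB : BCI h := hg.sub (hg.translate _)
  set w : ℝ → ℝ := (Ioc 1 β).indicator fun s => s ^ e with hw
  set γ : ℝ → ℝ × ℝ := fun s => (l * s, m * s ^ b) with hγ
  have hγm : Measurable γ := by
    have : Measurable fun s : ℝ => s ^ b := measurable_id.pow_const _
    fun_prop
  have hwm : Measurable w := (measurable_id.pow_const _).indicator measurableSet_Ioc
  have hwb : ∀ s ∈ Ioc 1 β, |s ^ e| ≤ R := fun s hs => by
    rw [abs_of_nonneg (Real.rpow_nonneg (by linarith [hs.1]) _)]
    exact rpow_le_of_mem_Icc (Ioc_subset_Icc_self hs) e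
  have hwi : Integrable w := by
    rw [hw, integrable_indicator_iff measurableSet_Ioc]
    exact Measure.integrableOn_of_bounded (M := R) (by simp)
      (measurable_id.pow_const _).aestronglyMeasurable
      ((ae_restrict_iff' measurableSet_Ioc).2 (Eventually.of_forall hwb))
  have hT : ∀ x : ℝ × ℝ, ∫ s in Ioc 1 β, s ^ e * (g (x - (l * s, m * s ^ b))
        - g (x - (l * s, m * s ^ b) - (0, m * δ))) = ∫ s, w s * h (x - γ s) := by
    intro x
    rw [← integral_indicator measurableSet_Ioc]
    congr 1; ext s
    simp only [hw, indicator]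
    split_ifs <;> simp [hh, hγ]
  simp_rw [hT]
  obtain ⟨hintg, heq⟩ := hhB.integral_sq_average hwi hwm hγm
  refine ⟨hintg, ?_⟩
  rw [heq]
  set Γ : ℝ × ℝ → ℝ := fun y => ∫ x, g x * g (x - y) with hΓ
  have hJ : ∀ v : ℝ, v ≠ 0 → |∫ s, w s * w (s + v) * ∫ x, h x * h (x - (γ (s + v) - γ s))|
      ≤ (Icc (-β) β).indicator (fun v => C2 * K0 * δ ^ (1 - ε) * |v| ^ (ε - 1)) v := by
    intro v hv
    have hv0 := abs_pos.2 hv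
    set lo : ℝ := max 1 (1 - v) with hlo
    set hi : ℝ := min β (β - v) with hhi
    set k : ℝ → ℝ := fun t => Γ (l * v, m * t) with hk
    have hkc : Continuous k := hg.continuous_autocorr.comp (by fun_prop)
    have hkb : ∀ t, |k t| ≤ K0 := fun t => hg.abs_autocorr_le _
    set Q : ℝ → ℝ := fun s => s ^ e * (s + v) ^ e * (2 * k ((s + v) ^ b - s ^ b)
        - k ((s + v) ^ b - s ^ b - δ) - k ((s + v) ^ b - s ^ b + δ)) with hQ
    have hmem : ∀ s, s ∈ Ioc lo hi ↔ s ∈ Ioc 1 β ∧ s + v ∈ Ioc 1 β := by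
      intro s
      simp only [mem_Ioc, hlo, hhi, max_lt_iff, le_min_iff, sub_lt_iff_lt_add, le_sub_iff_add_le]
      tauto
    have hid : ∫ s, w s * w (s + v) * ∫ x, h x * h (x - (γ (s + v) - γ s))
        = ∫ s in Ioc lo hi, Q s := by
      rw [← integral_indicator measurableSet_Ioc]
      congr 1; ext s
      by_cases hs : s ∈ Ioc lo hi
      · rw [indicator_of_mem hs]
        obtain ⟨h1, h2⟩ := (hmem s).1 hs
        simp only [hw, indicator_of_mem h1, indicator_of_mem h2, hQ]
        congr 1
        rw [hg.autocorr_difference (0, m * δ) (γ (s + v) - γ s)]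
        have e1 : γ (s + v) - γ s = (l * v, m * ((s + v) ^ b - s ^ b)) := by
          ext <;> simp [hγ] <;> ring
        have e2 : γ (s + v) - γ s - (0, m * δ) = (l * v, m * ((s + v) ^ b - s ^ b - δ)) := by
          rw [e1]; ext <;> simp; ring
        have e3 : γ (s + v) - γ s + (0, m * δ) = (l * v, m * ((s + v) ^ b - s ^ b + δ)) := by
          rw [e1]; ext <;> simp; ring
        rw [e2, e3, e1]
      · rw [indicator_of_notMem hs]
        rw [hmem, not_and_or] at hs
        rcases hs with hs | hs <;> simp [hw, indicator_of_notMem hs]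
    rw [hid]
    rcases lt_or_ge hi lo with hlt | hle
    · rw [Ioc_eq_empty (by linarith), setIntegral_empty, abs_zero]
      exact indicator_nonneg (fun v _ => by positivity) _
    have l1 : (1:ℝ) ≤ lo := le_max_left _ _
    have l2 : 1 - v ≤ lo := le_max_right _ _
    have l3 : hi ≤ β := min_le_left _ _
    have l4 : hi ≤ β - v := min_le_right _ _
    rw [indicator_of_mem (by constructor <;> linarith)]
    have hx0 : 0 < δ / |v| := by positivity
    have hxe : (δ / |v|) ^ (1 - ε) = δ ^ (1 - ε) * |v| ^ (ε - 1) := by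
      rw [Real.div_rpow hδ.le hv0.le, show ε - 1 = -(1 - ε) by ring, Real.rpow_neg hv0.le]
      rfl
    rw [mul_assoc, ← hxe]
    rcases le_total (δ / |v|) 1 with hx1 | hx1
    · have := h7 k K0 δ v lo hi hkc hkb hδ.le hv hle l1 (by linarith) l3 (by linarith)
      rw [intervalIntegral.integral_of_le hle] at this
      calc _ ≤ C1 * (δ / |v|) * K0 := this
        _ ≤ C2 * (δ / |v|) ^ (1 - ε) * K0 := by
            gcongr
            · rw [hC2]; linarith [show 0 ≤ R * R * 4 * β by positivity]
            · calc δ / |v| = (δ / |v|) ^ (1:ℝ) := (Real.rpow_one _).symm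
                _ ≤ _ := Real.rpow_le_rpow_of_exponent_ge hx0 hx1 (by linarith)
        _ = _ := by ring
    · have hQb : ∀ s ∈ Ioc lo hi, ‖Q s‖ ≤ R * R * (4 * K0) := by
        intro s hs
        obtain ⟨h1, h2⟩ := (hmem s).1 hs
        rw [Real.norm_eq_abs]
        simp only [hQ]
        rw [abs_mul, abs_mul]
        gcongr
        · exact hwb s h1
        · exact hwb _ h2
        · have a1 := abs_le.1 (hkb ((s + v) ^ b - s ^ b))
          have a2 := abs_le.1 (hkb ((s + v) ^ b - s ^ b - δ))
          have a3 := abs_le.1 (hkb ((s + v) ^ b - s ^ b + δ))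
          rw [abs_le]; constructor <;> linarith
      have := norm_setIntegral_le_of_norm_le_const (μ := volume) (by simp) hQb
      rw [Real.norm_eq_abs, measureReal_def, Real.volume_Ioc,
        ENNReal.toReal_ofReal (by linarith)] at this
      calc _ ≤ R * R * (4 * K0) * (hi - lo) := this
        _ ≤ R * R * (4 * K0) * β := by gcongr; linarith
        _ = R * R * 4 * β * K0 * 1 := by ring
        _ ≤ C2 * K0 * (δ / |v|) ^ (1 - ε) := by
            gcongr
            · rw [hC2]; linarith
            · exact Real.one_le_rpow hx1 (by linarith)
  have hae : ∀ᵐ v : ℝ, v ≠ 0 := by simp [ae_iff]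
  calc _ ≤ ‖∫ v, ∫ s, w s * w (s + v) * ∫ x, h x * h (x - (γ (s + v) - γ s))‖ := le_abs_self _
    _ ≤ ∫ v, (Icc (-β) β).indicator (fun v => C2 * K0 * δ ^ (1 - ε) * |v| ^ (ε - 1)) v := by
        refine norm_integral_le_of_norm_le ?_ (hae.mono hJ)
        rw [integrable_indicator_iff measurableSet_Icc]
        exact (integrableOn_abs_rpow (by linarith)).const_mul _
    _ = _ := by
        rw [integral_indicator measurableSet_Icc, integral_const_mul]
        ring

/-- The space of bounded, continuous and integrable functions on the plane. -/
def bciSpace : Submodule ℝ (ℝ × ℝ → ℝ) where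
  carrier := {f | BCI f}
  add_mem' := fun hf hg => BCI.add hf hg
  zero_mem' := ⟨continuous_const, integrable_zero _ _ _, 0, fun _ => by simp⟩
  smul_mem' := fun c _ hf => BCI.const_mul hf c

lemma bci (f : bciSpace) : BCI (f : ℝ × ℝ → ℝ) := f.2

lemma integrable_comp_sub {α : Type*} [MeasurableSpace α] (ν : Measure α) [IsFiniteMeasure ν]
    {f : ℝ × ℝ → ℝ} (hf : BCI f) {γ : α → ℝ × ℝ} (hγ : Measurable γ) (x : ℝ × ℝ) :
    Integrable (fun s => f (x - γ s)) ν := by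
  obtain ⟨C, hC⟩ := hf.bdd
  exact Integrable.of_bound (C := C) (hf.cont.measurable.comp (by fun_prop)).aestronglyMeasurable
    (Eventually.of_forall fun s => hC _)

lemma BCI.convolution {f : ℝ × ℝ → ℝ} (hf : BCI f) (μ : Measure (ℝ × ℝ)) [IsFiniteMeasure μ] :
    BCI fun x => ∫ y, f (x - y) ∂μ := by
  obtain ⟨C, hC⟩ := hf.bdd
  have hfm := hf.cont.measurable
  refine ⟨?_, ?_, C * μ.real univ, fun x => ?_⟩
  · refine continuous_of_dominated (bound := fun _ => C) (fun x => ?_) (fun x => ?_)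
      (integrable_const C) ?_
    · exact (hfm.comp (by fun_prop)).aestronglyMeasurable
    · exact Eventually.of_forall fun y => hC _
    · exact Eventually.of_forall fun y => hf.cont.comp (by fun_prop)
  · have hm : Measurable fun z : (ℝ × ℝ) × (ℝ × ℝ) => f (z.1 - z.2) := by fun_prop
    have : Integrable (fun z : (ℝ × ℝ) × (ℝ × ℝ) => f (z.1 - z.2)) (volume.prod μ) := by
      rw [integrable_prod_iff' hm.aestronglyMeasurable]
      refine ⟨Eventually.of_forall fun y => hf.int.comp_sub_right y, ?_⟩
      simp only
      simp_rw [integral_sub_right_eq_self (fun x => ‖f x‖)]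
      exact integrable_const _
    exact this.integral_prod_left
  · rw [← Real.norm_eq_abs]
    exact norm_integral_le_of_norm_le_const (Eventually.of_forall fun y => hC _)

/-- Convolution with a finite measure as an operator on `bciSpace`. -/
def cv (μ : Measure (ℝ × ℝ)) [IsFiniteMeasure μ] : Module.End ℝ bciSpace where
  toFun f := ⟨fun x => ∫ y, (f : ℝ × ℝ → ℝ) (x - y) ∂μ, (bci f).convolution μ⟩
  map_add' f g := by
    ext x
    exact integral_add (integrable_comp_sub μ (bci f) measurable_id x)
      (integrable_comp_sub μ (bci g) measurable_id x)
  map_smul' c f := by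
    ext x
    exact integral_const_mul c _

lemma cv_apply (μ : Measure (ℝ × ℝ)) [IsFiniteMeasure μ] (f : bciSpace) (x : ℝ × ℝ) :
    (cv μ f : ℝ × ℝ → ℝ) x = ∫ y, (f : ℝ × ℝ → ℝ) (x - y) ∂μ := rfl

lemma cv_map_apply {α : Type*} [MeasurableSpace α] (ν : Measure α) [IsFiniteMeasure ν]
    {γ : α → ℝ × ℝ} (hγ : Measurable γ) (f : bciSpace) (x : ℝ × ℝ) :
    (cv (ν.map γ) f : ℝ × ℝ → ℝ) x = ∫ s, (f : ℝ × ℝ → ℝ) (x - γ s) ∂ν := by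
  rw [cv_apply, integral_map hγ.aemeasurable]
  exact ((bci f).cont.comp (by fun_prop)).aestronglyMeasurable

lemma cv_commute (μ ν : Measure (ℝ × ℝ)) [IsFiniteMeasure μ] [IsFiniteMeasure ν] :
    Commute (cv μ) (cv ν) := by
  ext f x
  simp only [Module.End.mul_apply, cv_apply]
  obtain ⟨C, hC⟩ := (bci f).bdd
  have hfm := (bci f).cont.measurable
  rw [integral_integral_swap]
  · simp_rw [sub_right_comm]
  · refine Integrable.of_bound (C := C) ?_ (Eventually.of_forall fun z => hC _)
    exact Measurable.aestronglyMeasurable (by simp only [Function.uncurry_def]; fun_prop)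

/-- Translation by `a`. -/
def tr (a : ℝ × ℝ) : Module.End ℝ bciSpace := cv (Measure.dirac a)

lemma tr_apply (a : ℝ × ℝ) (f : bciSpace) (x : ℝ × ℝ) :
    (tr a f : ℝ × ℝ → ℝ) x = (f : ℝ × ℝ → ℝ) (x - a) := by
  rw [tr, cv_apply, integral_dirac]

/-- Average over the segment from `x` to `x - v`. -/
def bx (v : ℝ × ℝ) : Module.End ℝ bciSpace :=
  cv ((volume.restrict (Ioc (0:ℝ) 1)).map fun r : ℝ => r • v)

lemma bx_apply (v : ℝ × ℝ) (f : bciSpace) (x : ℝ × ℝ) :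
    (bx v f : ℝ × ℝ → ℝ) x = ∫ r in Ioc (0:ℝ) 1, (f : ℝ × ℝ → ℝ) (x - r • v) :=
  cv_map_apply _ (by fun_prop) f x

/-- Average over a piece of the curve `(l s, m s ^ b)`. -/
def crv (b l m : ℝ) : Module.End ℝ bciSpace :=
  cv ((volume.restrict (Ioc (1:ℝ) 2)).map fun s : ℝ => (l * s, m * s ^ b))

lemma measurable_curve (b l m : ℝ) : Measurable fun s : ℝ => (l * s, m * s ^ b) := by
  have : Measurable fun s : ℝ => s ^ b := measurable_id.pow_const _
  fun_prop

lemma crv_apply (b l m : ℝ) (f : bciSpace) (x : ℝ × ℝ) :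
    (crv b l m f : ℝ × ℝ → ℝ) x
      = ∫ s in Ioc (1:ℝ) 2, (f : ℝ × ℝ → ℝ) (x - (l * s, m * s ^ b)) :=
  cv_map_apply _ (measurable_curve b l m) f x

/-- The gap operator `(1 - τ_v) B_v`. -/
def gp (v : ℝ × ℝ) : Module.End ℝ bciSpace := (1 - tr v) * bx v

lemma tr_mul_tr (a c : ℝ × ℝ) : tr a * tr c = tr (a + c) := by
  ext f x
  simp only [Module.End.mul_apply, tr_apply, sub_sub]

lemma bx_two_smul (v : ℝ × ℝ) : bx ((2:ℝ) • v) = (1 / 2 : ℝ) • ((1 + tr v) * bx v) := by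
  ext f x
  have hi : ∀ a c : ℝ, IntervalIntegrable (fun r : ℝ => (f : ℝ × ℝ → ℝ) (x - r • v)) volume a c :=
    fun a c => ((bci f).cont.comp (by fun_prop)).intervalIntegrable _ _
  have h2 : (bx ((2:ℝ) • v) f : ℝ × ℝ → ℝ) x
      = (1 / 2) * ∫ r in (0:ℝ)..2, (f : ℝ × ℝ → ℝ) (x - r • v) := by
    rw [bx_apply, ← intervalIntegral.integral_of_le zero_le_one]
    have := intervalIntegral.integral_comp_mul_left (a := 0) (b := 1)
      (fun r : ℝ => (f : ℝ × ℝ → ℝ) (x - r • v)) (c := 2) two_ne_zero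
    rw [mul_zero, mul_one, smul_eq_mul] at this
    rw [one_div, ← this]
    refine intervalIntegral.integral_congr fun r _ => ?_
    simp only [smul_smul, mul_comm r]
  have h3 : (bx v f : ℝ × ℝ → ℝ) (x - v) = ∫ r in (1:ℝ)..2, (f : ℝ × ℝ → ℝ) (x - r • v) := by
    rw [bx_apply, ← intervalIntegral.integral_of_le zero_le_one]
    have := intervalIntegral.integral_comp_add_right (a := 0) (b := 1)
      (fun r : ℝ => (f : ℝ × ℝ → ℝ) (x - r • v)) 1
    norm_num at this
    rw [← this]
    refine intervalIntegral.integral_congr fun r _ => ?_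
    simp only [add_smul, one_smul]
    rw [add_comm (r • v), ← sub_sub]
  rw [h2, ← intervalIntegral.integral_add_adjacent_intervals (hi 0 1) (hi 1 2), ← h3,
    intervalIntegral.integral_of_le zero_le_one, ← bx_apply]
  simp only [one_div, LinearMap.smul_apply, Module.End.mul_apply, LinearMap.add_apply,
    Module.End.one_apply, Submodule.coe_smul, Submodule.coe_add, Pi.smul_apply, Pi.add_apply,
    tr_apply, smul_eq_mul]

/-- Centred average with a tent weight. -/
def tent (v : ℝ × ℝ) : Module.End ℝ bciSpace := tr (-v) * (bx v * bx v)

/-- The difference of two consecutive tents. -/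
def tentGap (v : ℝ × ℝ) : Module.End ℝ bciSpace :=
  (-(1 / 4) : ℝ) • (tr (-((2:ℝ) • v)) * (gp v * gp v))

lemma tent_identity {R : Type*} [Ring R] [Algebra ℝ R] {T B : R} (S : R) (h : T * B = B * T) :
    S * (((1 / 2 : ℝ) • ((1 + T) * B)) * ((1 / 2 : ℝ) • ((1 + T) * B)))
      + (-(1 / 4) : ℝ) • (S * ((1 - T) * B * ((1 - T) * B))) = S * T * (B * B) := by
  have h' : ∀ X, B * (T * X) = T * (B * X) := fun X => by rw [← mul_assoc, ← h, mul_assoc]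
  simp only [mul_smul_comm, smul_mul_assoc, add_mul, mul_add, sub_mul, mul_sub, one_mul, mul_assoc,
    h']
  module

lemma tent_two_smul (v : ℝ × ℝ) : tent ((2:ℝ) • v) + tentGap v = tent v := by
  have hc : tr v * bx v = bx v * tr v := cv_commute _ _
  have ht : tr (-v) = tr (-((2:ℝ) • v)) * tr v := by
    rw [tr_mul_tr]
    congr 1
    module
  unfold tent tentGap gp
  rw [bx_two_smul, ht]
  exact tent_identity (R := Module.End ℝ bciSpace) _ hc

lemma lbox_comp_add (v a : ℝ × ℝ) (f : ℝ × ℝ → ℝ≥0∞) (x : ℝ × ℝ) :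
    lbox v (fun y => f (y + a)) x = lbox v f (x + a) := by
  unfold lbox
  refine lintegral_congr fun r => ?_
  simp only [sub_add_eq_add_sub]

lemma lbox_const_mul (v : ℝ × ℝ) (c : ℝ≥0∞) {f : ℝ × ℝ → ℝ≥0∞} (hf : Measurable f) (x : ℝ × ℝ) :
    lbox v (fun y => c * f y) x = c * lbox v f x := by
  unfold lbox
  exact lintegral_const_mul _ (by fun_prop)

lemma lbox_lbox_shift_le (v : ℝ × ℝ) (f : ℝ × ℝ → ℝ≥0∞) {c : ℝ} (hc : 0 ≤ c) (hc2 : c ≤ 2)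
    (x : ℝ × ℝ) : lbox v (lbox v f) (x - c • v) ≤ 4 * lbox ((4:ℝ) • v) f x := by
  have h4 : 4 * lbox ((4:ℝ) • v) f x = ∫⁻ t in Ioc (0:ℝ) 4, f (x - t • v) := by
    have h1 := setLIntegral_Ioc_comp_affine (c := 4) (by norm_num) 0 1 0 (fun r => f (x - r • v))
    norm_num at h1
    have e1 : lbox ((4:ℝ) • v) f x = ∫⁻ r in Ioc (0:ℝ) 1, f (x - (4 * r) • v) := by
      unfold lbox
      refine lintegral_congr fun r => ?_
      rw [smul_smul, mul_comm]
    rw [e1, h1, one_div, ENNReal.ofReal_inv_of_pos (by norm_num), ← mul_assoc]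
    norm_num
    rw [ENNReal.mul_inv_cancel (by norm_num) (by norm_num), one_mul]
  rw [h4]
  have hpt : ∀ r ∈ Ioc (0:ℝ) 1, lbox v f (x - c • v - r • v)
      ≤ ∫⁻ t in Ioc (0:ℝ) 4, f (x - t • v) := by
    intro r hr
    have h2 := setLIntegral_Ioc_comp_affine (c := 1) one_pos 0 1 (r + c) (fun r => f (x - r • v))
    norm_num at h2
    have : lbox v f (x - c • v - r • v) = ∫⁻ t in Ioc (0:ℝ) 1, f (x - (t + (r + c)) • v) := by
      unfold lbox
      refine lintegral_congr fun t => ?_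
      congr 1
      module
    rw [this, h2]
    exact lintegral_mono_set (Ioc_subset_Ioc (by linarith [hr.1]) (by linarith [hr.2]))
  calc _ ≤ ∫⁻ r in Ioc (0:ℝ) 1, ∫⁻ t in Ioc (0:ℝ) 4, f (x - t • v) :=
        setLIntegral_mono' measurableSet_Ioc hpt
    _ = _ := by simp

lemma enorm_bx_bx_le (v : ℝ × ℝ) (f : bciSpace) (x : ℝ × ℝ) :
    ‖(bx v (bx v f) : ℝ × ℝ → ℝ) x‖ₑ ≤ lbox v (lbox v fun y => ‖(f : ℝ × ℝ → ℝ) y‖ₑ) x := by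
  have h : ∀ (g : bciSpace) y, ‖(bx v g : ℝ × ℝ → ℝ) y‖ₑ
      ≤ lbox v (fun y => ‖(g : ℝ × ℝ → ℝ) y‖ₑ) y := fun g y => by
    rw [bx_apply]
    exact enorm_integral_le_lintegral_enorm _
  exact (h _ x).trans (lbox_mono _ (h f) x)

lemma enorm_tent_le (v : ℝ × ℝ) (f : bciSpace) (x : ℝ × ℝ) : ‖(tent v f : ℝ × ℝ → ℝ) x‖ₑ
    ≤ 4 * lbox ((4:ℝ) • v) (fun y => ‖(f : ℝ × ℝ → ℝ) y‖ₑ) (x + (2:ℝ) • v) := by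
  refine le_trans ?_ (lbox_lbox_shift_le v _ (c := 1) (by norm_num) (by norm_num) _)
  rw [tent, Module.End.mul_apply, tr_apply, Module.End.mul_apply]
  rw [show x + (2:ℝ) • v - (1:ℝ) • v = x - -v by module]
  exact enorm_bx_bx_le v f _

lemma one_sub_mul_sq {R : Type*} [Ring R] {T B : R} (h : T * B = B * T) :
    (1 - T) * B * ((1 - T) * B) = (1 - T) * ((1 - T) * (B * B)) := by
  have h' : ∀ X, B * (T * X) = T * (B * X) := fun X => by rw [← mul_assoc, ← h, mul_assoc]
  simp only [sub_mul, mul_sub, one_mul, mul_assoc, h']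

lemma enorm_tentGap_le (v : ℝ × ℝ) (f : bciSpace) (x : ℝ × ℝ) :
    ‖(tentGap v f : ℝ × ℝ → ℝ) x‖ₑ
    ≤ 4 * lbox ((4:ℝ) • v) (fun y => ‖(f : ℝ × ℝ → ℝ) y‖ₑ) (x + (2:ℝ) • v) := by
  set X := 4 * lbox ((4:ℝ) • v) (fun y => ‖(f : ℝ × ℝ → ℝ) y‖ₑ) (x + (2:ℝ) • v) with hX
  have hc : tr v * bx v = bx v * tr v := cv_commute _ _
  have hg : gp v * gp v = (1 - tr v) * ((1 - tr v) * (bx v * bx v)) :=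
    one_sub_mul_sq (R := Module.End ℝ bciSpace) hc
  have hb : ∀ c : ℝ, 0 ≤ c → c ≤ 2 →
      ‖(bx v (bx v f) : ℝ × ℝ → ℝ) (x + (2:ℝ) • v - c • v)‖ₑ ≤ X := fun c h0 h2 =>
    (enorm_bx_bx_le v f _).trans (lbox_lbox_shift_le v _ h0 h2 _)
  have e : (tentGap v f : ℝ × ℝ → ℝ) x = -(1 / 4) * (
      (bx v (bx v f) : ℝ × ℝ → ℝ) (x + (2:ℝ) • v - (0:ℝ) • v)
      - (bx v (bx v f) : ℝ × ℝ → ℝ) (x + (2:ℝ) • v - (1:ℝ) • v)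
      - ((bx v (bx v f) : ℝ × ℝ → ℝ) (x + (2:ℝ) • v - (1:ℝ) • v)
      - (bx v (bx v f) : ℝ × ℝ → ℝ) (x + (2:ℝ) • v - (2:ℝ) • v))) := by
    rw [tentGap, hg]
    simp only [LinearMap.smul_apply, Module.End.mul_apply, LinearMap.sub_apply,
      Module.End.one_apply, Submodule.coe_smul, Submodule.coe_sub, Pi.smul_apply, Pi.sub_apply,
      tr_apply, smul_eq_mul, sub_neg_eq_add, zero_smul, sub_zero, one_smul]
    rw [show x + (2:ℝ) • v - (2:ℝ) • v = x + (2:ℝ) • v - v - v by module]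
  rw [e, enorm_mul]
  refine (mul_le_mul' le_rfl (enorm_sub_le.trans (add_le_add enorm_sub_le enorm_sub_le))).trans ?_
  refine (mul_le_mul' le_rfl (add_le_add (add_le_add (hb 0 le_rfl (by norm_num))
    (hb 1 (by norm_num) (by norm_num))) (add_le_add (hb 1 (by norm_num) (by norm_num))
    (hb 2 (by norm_num) le_rfl)))).trans ?_
  rw [Real.enorm_eq_ofReal_abs]
  have : ENNReal.ofReal |(-(1 / 4) : ℝ)| = 4⁻¹ := by
    rw [abs_neg, abs_of_pos (by norm_num), one_div, ENNReal.ofReal_inv_of_pos (by norm_num)]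
    norm_num
  rw [this, show X + X + (X + X) = 4 * X by ring, ← mul_assoc,
    ENNReal.inv_mul_cancel (by norm_num) (by norm_num), one_mul]

/-- Majorant of the two-parameter pieces of the averages along the curve. -/
def crvBox (b : ℝ) (k n : ℤ) (ρ : ℝ) (i j : ℕ) (F : ℝ × ℝ → ℝ≥0∞) (x : ℝ × ℝ) : ℝ≥0∞ :=
  ∫⁻ s in Ioc (1:ℝ) 2, lbox ((2:ℝ) ^ (k - i) • (4:ℝ) • ((1:ℝ), (0:ℝ)))
    (lbox ((2:ℝ) ^ (n - j) • (4:ℝ) • ((0:ℝ), (1:ℝ))) F)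
    (x - ((2:ℝ) ^ k * (s + -(2 / 2 ^ i)), (2:ℝ) ^ n * (ρ * s ^ b + -(2 / 2 ^ j))))

lemma enorm_crv_mul_le (b : ℝ) (k n : ℤ) (ρ : ℝ) (i j : ℕ) {T₁ T₂ : Module.End ℝ bciSpace}
    (h₁ : ∀ f x, ‖(T₁ f : ℝ × ℝ → ℝ) x‖ₑ ≤ 4 * lbox ((4:ℝ) • (2:ℝ) ^ (k - i) • ((1:ℝ), (0:ℝ)))
      (fun y => ‖(f : ℝ × ℝ → ℝ) y‖ₑ) (x + (2:ℝ) • (2:ℝ) ^ (k - i) • ((1:ℝ), (0:ℝ))))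
    (h₂ : ∀ f x, ‖(T₂ f : ℝ × ℝ → ℝ) x‖ₑ ≤ 4 * lbox ((4:ℝ) • (2:ℝ) ^ (n - j) • ((0:ℝ), (1:ℝ)))
      (fun y => ‖(f : ℝ × ℝ → ℝ) y‖ₑ) (x + (2:ℝ) • (2:ℝ) ^ (n - j) • ((0:ℝ), (1:ℝ))))
    (f : bciSpace) (x : ℝ × ℝ) :
    ‖(crv b (2 ^ k) (2 ^ n * ρ) (T₁ (T₂ f)) : ℝ × ℝ → ℝ) x‖ₑ
      ≤ 16 * crvBox b k n ρ i j (fun y => ‖(f : ℝ × ℝ → ℝ) y‖ₑ) x := by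
  have hfm : Measurable fun y => ‖(f : ℝ × ℝ → ℝ) y‖ₑ := (bci f).cont.measurable.enorm
  have hm := measurable_lbox ((4:ℝ) • (2:ℝ) ^ (n - j) • ((0:ℝ), (1:ℝ))) hfm
  have hm2 := measurable_lbox ((4:ℝ) • (2:ℝ) ^ (k - i) • ((1:ℝ), (0:ℝ))) hm
  rw [crv_apply]
  refine (enorm_integral_le_lintegral_enorm _).trans ?_
  have hmeas : Measurable fun s : ℝ => s ^ b := measurable_id.pow_const _
  unfold crvBox
  simp only [smul_comm (_ : ℝ) (4:ℝ) (_ : ℝ × ℝ)]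
  rw [← lintegral_const_mul _ (by fun_prop)]
  refine lintegral_mono fun s => ?_
  refine (h₁ _ _).trans ?_
  refine (mul_le_mul' le_rfl (lbox_mono _ (h₂ f) _)).trans ?_
  rw [lbox_const_mul _ _ (by fun_prop), lbox_comp_add, ← mul_assoc]
  norm_num
  refine mul_le_mul' le_rfl (le_of_eq ?_)
  congr 1
  rw [zpow_sub₀ (by norm_num), zpow_sub₀ (by norm_num), zpow_natCast, zpow_natCast]
  ext <;> simp <;> ring

lemma lbox_comm {f : ℝ × ℝ → ℝ≥0∞} (hf : Measurable f) (v w x : ℝ × ℝ) :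
    lbox v (lbox w f) x = lbox w (lbox v f) x := by
  unfold lbox
  rw [lintegral_lintegral_swap]
  · simp_rw [sub_right_comm]
  · exact Measurable.aemeasurable (by simp only [Function.uncurry_def]; fun_prop)

lemma exists_crvBox_zero_snd_le (b : ℝ) (hb : 0 ≤ b) : ∃ C : ℝ≥0, ∀ (k n : ℤ) (ρ : ℝ) (i : ℕ)
    (F : ℝ × ℝ → ℝ≥0∞), ρ ∈ Icc (1:ℝ) 4 → Measurable F → ∀ x,
      crvBox b k n ρ i 0 F x ≤ C * dmax (1, 0) (dmax (0, 1) F) x := by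
  obtain ⟨C, hC⟩ := exists_curveSup_base_le (A := 2) (w := 4) (b := b) (by norm_num)
  refine ⟨C, fun k n ρ i F hρ hF x => ?_⟩
  have h2 : |(-(2 / 2 ^ i) : ℝ)| ≤ 2 := by
    rw [abs_neg, abs_of_nonneg (by positivity)]
    exact div_le_self (by norm_num) (one_le_pow₀ (by norm_num))
  have := hC {k} n (fun _ => ρ) (fun _ => -(2 / 2 ^ i)) (fun _ => -(2 / 2 ^ 0)) i F hF hb
    (fun _ => hρ) (fun _ => h2) (fun _ => by norm_num) x
  simpa [curveSup, crvBox] using this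

lemma exists_crvBox_zero_fst_le (b : ℝ) (hb : 1 ≤ b) : ∃ C : ℝ≥0, ∀ (k n : ℤ) (ρ : ℝ) (j : ℕ)
    (F : ℝ × ℝ → ℝ≥0∞), ρ ∈ Icc (1:ℝ) 4 → Measurable F → ∀ x,
      crvBox b k n ρ 0 j F x ≤ C * dmax (0, 1) (dmax (1, 0) F) x := by
  obtain ⟨C1, h1⟩ := exists_lbox_shift_le_dmax 4 (w := 4) (by norm_num)
  set Y : ℝ := 4 * 2 ^ b + 3 with hYd
  have hYpos : 0 < 2 * Y := by positivity
  obtain ⟨C2, h2⟩ := exists_lbox_shift_le_dmax (Y + 4) hYpos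
  refine ⟨C1 * ((2 * Y).toNNReal * C2), fun k n ρ j F hρ hF x => ?_⟩
  have hm2 := measurable_dmax (1, 0) hF
  set e2 : ℝ × ℝ := ((0:ℝ), (1:ℝ)) with he2
  set θ : ℝ := -(2 / 2 ^ j) with hθ
  have hθ2 : |θ| ≤ 2 := by
    rw [hθ, abs_neg, abs_of_nonneg (by positivity)]
    exact div_le_self (by norm_num) (one_le_pow₀ (by norm_num))
  set v := (2:ℝ) ^ (n - j) • (4:ℝ) • e2 with hv
  have hpt : ∀ s ∈ Ioc (1:ℝ) 2, lbox ((2:ℝ) ^ (k - (0:ℕ)) • (4:ℝ) • ((1:ℝ), (0:ℝ))) (lbox v F)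
      (x - ((2:ℝ) ^ k * (s + -(2 / 2 ^ 0)), (2:ℝ) ^ n * (ρ * s ^ b + θ)))
      ≤ C1 * lbox v (dmax (1, 0) F) (x - ((2:ℝ) ^ n * (ρ * s ^ b + θ)) • e2) := by
    intro s hs
    rw [lbox_comm hF, ← lbox_const_mul _ _ hm2]
    unfold lbox
    refine lintegral_mono fun r => ?_
    have := h1 ((1:ℝ), (0:ℝ)) F k (s + -2) (by rw [abs_le]; constructor <;> linarith [hs.1, hs.2])
      (x - ((2:ℝ) ^ n * (ρ * s ^ b + θ)) • e2 - r • v)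
    refine le_trans (le_of_eq ?_) this
    unfold lbox
    refine lintegral_congr fun t => ?_
    congr 1
    ext <;> simp [he2, hv]
  have hcm2 : Measurable fun s : ℝ => lbox v (dmax (1, 0) F)
      (x - ((2:ℝ) ^ n * (ρ * s ^ b + θ)) • e2) := by
    have h3 : Measurable fun s : ℝ => s ^ b := measurable_id.pow_const _
    have := measurable_lbox v hm2
    fun_prop
  calc _ ≤ ∫⁻ s in Ioc (1:ℝ) 2, C1 * lbox v (dmax (1, 0) F)
        (x - ((2:ℝ) ^ n * (ρ * s ^ b + θ)) • e2) := setLIntegral_mono' measurableSet_Ioc hpt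
    _ = C1 * ∫⁻ s in Ioc (1:ℝ) 2, lbox v (dmax (1, 0) F)
        (x - ((2:ℝ) ^ n * (ρ * s ^ b + θ)) • e2) := lintegral_const_mul _ hcm2
    _ ≤ C1 * ∫⁻ σ in Ioc (-Y) Y, lbox v (dmax (1, 0) F) (x - ((2:ℝ) ^ n * σ) • e2) :=
        mul_le_mul' le_rfl (setLIntegral_curve_le hb hρ.1 hρ.2 (by linarith)
          (fun _ σ => lbox v (dmax (1, 0) F) (x - ((2:ℝ) ^ n * σ) • e2)))
    _ = C1 * ∫⁻ r in Ioc (0:ℝ) 1, ∫⁻ σ in Ioc (-Y) Y,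
          dmax (1, 0) F (x - ((2:ℝ) ^ n * σ) • e2 - r • v) := by
        unfold lbox
        rw [lintegral_lintegral_swap]
        exact Measurable.aemeasurable (by simp only [Function.uncurry_def]; fun_prop)
    _ ≤ C1 * ∫⁻ r in Ioc (0:ℝ) 1, (2 * Y).toNNReal * (C2 * dmax (0, 1) (dmax (1, 0) F) x) := by
        refine mul_le_mul' le_rfl (setLIntegral_mono' measurableSet_Ioc fun r hr => ?_)
        have hr4 : 0 ≤ 4 * r / 2 ^ j ∧ 4 * r / 2 ^ j ≤ 4 := by
          have : 0 ≤ 4 * r := by linarith [hr.1]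
          refine ⟨by positivity, (div_le_self this (one_le_pow₀ (by norm_num))).trans ?_⟩
          linarith [hr.2]
        have h4 := h2 e2 (dmax (1, 0) F) n (-Y + 4 * r / 2 ^ j) (by
          rw [abs_le]; constructor <;> linarith) x
        refine le_trans (le_of_eq ?_) (mul_le_mul' le_rfl h4)
        unfold lbox
        have h5 := setLIntegral_Ioc_comp_affine (c := 2 * Y) hYpos 0 1 (-Y) (fun σ =>
          dmax (1, 0) F (x - ((2:ℝ) ^ n * σ) • e2 - r • v))
        rw [mul_zero, zero_add, mul_one, show 2 * Y + -Y = Y by ring] at h5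
        have h6 : ((2 * Y).toNNReal : ℝ≥0∞) * ENNReal.ofReal (2 * Y)⁻¹ = 1 := by
          rw [← ENNReal.ofReal.eq_1, ← ENNReal.ofReal_mul hYpos.le, mul_inv_cancel₀ hYpos.ne',
            ENNReal.ofReal_one]
        rw [← one_mul (∫⁻ σ in Ioc (-Y) Y, _), ← h6, mul_assoc, ← h5]
        congr 1
        refine lintegral_congr fun s => ?_
        congr 1
        rw [hv, zpow_sub₀ (by norm_num), zpow_natCast]
        ext
        · simp [he2]
        · simp [he2]; field_simp; ring
    _ = _ := by
        rw [setLIntegral_const, ENNReal.coe_mul, ENNReal.coe_mul]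
        simp [mul_assoc, he2]

lemma abs_setIntegral_sub_le {a c : ℝ} (hac : c - a = 1) {f g : bciSpace} {ε : ℝ}
    {γ δ : ℝ → ℝ × ℝ}
    (hγ : Measurable γ) (hδ : Measurable δ) (x : ℝ × ℝ)
    (h : ∀ s ∈ Ioc a c, |(g : ℝ × ℝ → ℝ) (x - γ s) - (f : ℝ × ℝ → ℝ) (x - δ s)| ≤ ε) :
    |(∫ s in Ioc a c, (g : ℝ × ℝ → ℝ) (x - γ s)) - ∫ s in Ioc a c, (f : ℝ × ℝ → ℝ) (x - δ s)|
      ≤ ε := by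
  rw [← integral_sub (integrable_comp_sub _ (bci g) hγ x) (integrable_comp_sub _ (bci f) hδ x),
    ← Real.norm_eq_abs]
  refine (norm_setIntegral_le_of_norm_le_const (C := ε) (by simp) h).trans ?_
  simp [Measure.real, hac]

lemma abs_bx_sub_le (v : ℝ × ℝ) {f g : bciSpace} {ε : ℝ}
    (h : ∀ x, |(g : ℝ × ℝ → ℝ) x - (f : ℝ × ℝ → ℝ) x| ≤ ε) (x : ℝ × ℝ) :
    |(bx v g : ℝ × ℝ → ℝ) x - (bx v f : ℝ × ℝ → ℝ) x| ≤ ε := by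
  rw [bx_apply, bx_apply]
  exact abs_setIntegral_sub_le (by norm_num) (by fun_prop) (by fun_prop) x fun s _ => h _

lemma abs_crv_sub_le (b l m : ℝ) {f g : bciSpace} {ε : ℝ}
    (h : ∀ x, |(g : ℝ × ℝ → ℝ) x - (f : ℝ × ℝ → ℝ) x| ≤ ε) (x : ℝ × ℝ) :
    |(crv b l m g : ℝ × ℝ → ℝ) x - (crv b l m f : ℝ × ℝ → ℝ) x| ≤ ε := by
  rw [crv_apply, crv_apply]
  exact abs_setIntegral_sub_le (by norm_num) (measurable_curve b l m) (measurable_curve b l m) x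
    fun s _ => h _

lemma abs_bx_sub_self_le (v : ℝ × ℝ) {f : bciSpace} {ε : ℝ}
    (h : ∀ x w, ‖w‖ ≤ ‖v‖ → |(f : ℝ × ℝ → ℝ) (x - w) - (f : ℝ × ℝ → ℝ) x| ≤ ε) (x : ℝ × ℝ) :
    |(bx v f : ℝ × ℝ → ℝ) x - (f : ℝ × ℝ → ℝ) x| ≤ ε := by
  have h1 := abs_setIntegral_sub_le (a := 0) (c := 1) (by norm_num) (f := f) (g := f) (ε := ε)
    (γ := fun r => r • v) (δ := fun _ => 0) (by fun_prop) (by fun_prop) x (fun r hr => by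
      rw [sub_zero]
      refine h x _ ?_
      rw [norm_smul, Real.norm_of_nonneg hr.1.le]
      exact mul_le_of_le_one_left (norm_nonneg _) hr.2)
  rw [bx_apply]
  simpa using h1

lemma abs_tent_sub_le (v : ℝ × ℝ) {f g : bciSpace} {ε : ℝ}
    (h : ∀ x, |(g : ℝ × ℝ → ℝ) x - (f : ℝ × ℝ → ℝ) x| ≤ ε) (x : ℝ × ℝ) :
    |(tent v g : ℝ × ℝ → ℝ) x - (tent v f : ℝ × ℝ → ℝ) x| ≤ ε := by
  simp only [tent, Module.End.mul_apply, tr_apply]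
  exact abs_bx_sub_le v (abs_bx_sub_le v h) _

lemma abs_tent_sub_self_le (v : ℝ × ℝ) {f : bciSpace} {ε : ℝ}
    (h : ∀ x w, ‖w‖ ≤ ‖v‖ → |(f : ℝ × ℝ → ℝ) (x - w) - (f : ℝ × ℝ → ℝ) x| ≤ ε) (x : ℝ × ℝ) :
    |(tent v f : ℝ × ℝ → ℝ) x - (f : ℝ × ℝ → ℝ) x| ≤ 3 * ε := by
  simp only [tent, Module.End.mul_apply, tr_apply]
  have h1 := abs_bx_sub_le v (abs_bx_sub_self_le v h) (x - -v)
  have h2 := abs_bx_sub_self_le v h (x - -v)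
  have h3 := h x (-v) (by rw [norm_neg])
  rw [abs_le] at *
  constructor <;> linarith

lemma exists_scale_norm_le (k : ℤ) (e : ℝ × ℝ) (he : ‖e‖ ≤ 1) {η : ℝ} (hη : 0 < η) :
    ∀ᶠ L : ℕ in atTop, ‖(2:ℝ) ^ (k - L) • e‖ ≤ η := by
  have h1 : Tendsto (fun L : ℕ => (2:ℝ) ^ k * (1 / 2) ^ L) atTop (𝓝 ((2:ℝ) ^ k * 0)) :=
    (tendsto_pow_atTop_nhds_zero_of_lt_one (by norm_num) (by norm_num)).const_mul _
  rw [mul_zero] at h1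
  filter_upwards [h1.eventually (gt_mem_nhds hη)] with L hL
  rw [norm_smul, Real.norm_of_nonneg (by positivity), zpow_sub₀ (by norm_num), zpow_natCast]
  refine (mul_le_of_le_one_right (by positivity) he).trans (le_of_eq_of_le ?_ hL.le)
  rw [one_div, inv_pow, div_eq_mul_inv]

/-- The two-parameter pieces of the averages along the curve. -/
def Dop (b : ℝ) (k n : ℤ) (ρ : ℝ) (i j : ℕ) (f : bciSpace) (x : ℝ × ℝ) : ℝ :=
  (crv b (2 ^ k) (2 ^ n * ρ) (tentGap ((2:ℝ) ^ (k - (i + 1 : ℕ)) • ((1:ℝ), (0:ℝ)))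
    (tentGap ((2:ℝ) ^ (n - (j + 1 : ℕ)) • ((0:ℝ), (1:ℝ))) f)) : ℝ × ℝ → ℝ) x

lemma tent_succ (k : ℤ) (i : ℕ) (e : ℝ × ℝ) : tent ((2:ℝ) ^ (k - (i + 1 : ℕ)) • e)
    - tent ((2:ℝ) ^ (k - i) • e) = tentGap ((2:ℝ) ^ (k - (i + 1 : ℕ)) • e) := by
  have h := two_zpow_succ_smul (k - (i + 1 : ℕ)) e
  rw [show k - ((i + 1 : ℕ) : ℤ) + 1 = k - i by push_cast; ring] at h
  rw [h]
  refine (sub_eq_iff_eq_add (G := Module.End ℝ bciSpace)).2 ?_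
  rw [← tent_two_smul, add_comm]

lemma mul_mul_eq_sum {R : Type*} [Ring R] (A : R) (a c d e : ℕ → R)
    (ha : ∀ i, a (i + 1) - a i = d i) (hc : ∀ i, c (i + 1) - c i = e i) (L : ℕ) :
    A * (a L * c L) = A * (a 0 * c L) + A * (a L * c 0) - A * (a 0 * c 0)
      + ∑ z ∈ Finset.range L ×ˢ Finset.range L, A * (d z.1 * e z.2) := by
  have h1 : a L - a 0 = ∑ i ∈ Finset.range L, d i := by
    rw [← Finset.sum_range_sub]; simp only [ha]
  have h2 : c L - c 0 = ∑ i ∈ Finset.range L, e i := by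
    rw [← Finset.sum_range_sub]; simp only [hc]
  rw [← Finset.mul_sum, Finset.sum_product, ← Finset.sum_mul_sum, ← h1, ← h2]
  simp only [mul_sub, sub_mul]
  abel

theorem exists_enorm_crv_le {b : ℝ} (hb : 1 ≤ b) : ∃ C : ℝ≥0, ∀ (k n : ℤ) (ρ : ℝ) (f : bciSpace),
    ρ ∈ Icc (1:ℝ) 4 → UniformContinuous (f : ℝ × ℝ → ℝ) → ∀ x,
      ‖(crv b (2 ^ k) (2 ^ n * ρ) f : ℝ × ℝ → ℝ) x‖ₑ
      ≤ C * dmax (0, 1) (dmax (1, 0) fun y => ‖(f : ℝ × ℝ → ℝ) y‖ₑ) x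
        + C * dmax (1, 0) (dmax (0, 1) fun y => ‖(f : ℝ × ℝ → ℝ) y‖ₑ) x
        + ∑' z : ℕ × ℕ, ‖Dop b k n ρ z.1 z.2 f x‖ₑ := by
  obtain ⟨C1, h1⟩ := exists_crvBox_zero_fst_le b hb
  obtain ⟨C2, h2⟩ := exists_crvBox_zero_snd_le b (by linarith)
  refine ⟨16 * C1 + 32 * C2, fun k n ρ f hρ hf x => ?_⟩
  refine ENNReal.le_of_forall_pos_le_add fun ε hε _ => ?_
  set F : ℝ × ℝ → ℝ≥0∞ := fun y => ‖(f : ℝ × ℝ → ℝ) y‖ₑ with hF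
  have hFm : Measurable F := (bci f).cont.measurable.enorm
  set e1 : ℝ × ℝ := ((1:ℝ), (0:ℝ)) with he1
  set e2 : ℝ × ℝ := ((0:ℝ), (1:ℝ)) with he2
  set a : ℕ → Module.End ℝ bciSpace := fun i => tent ((2:ℝ) ^ (k - i) • e1) with had
  set c : ℕ → Module.End ℝ bciSpace := fun i => tent ((2:ℝ) ^ (n - i) • e2) with hcd
  set A := crv b (2 ^ k) (2 ^ n * ρ) with hA
  obtain ⟨η, hη, hfη⟩ := Metric.uniformContinuous_iff.1 hf (ε / 6) (by positivity)
  have hfη' : ∀ x w, ‖w‖ ≤ η / 2 → |(f : ℝ × ℝ → ℝ) (x - w) - (f : ℝ × ℝ → ℝ) x| ≤ ε / 6 := by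
    intro x w hw
    have := @hfη (x - w) x (by rw [dist_eq_norm, sub_sub_cancel_left, norm_neg]; linarith)
    rw [Real.dist_eq] at this
    exact this.le
  have hn1 : ‖e1‖ ≤ 1 := by simp [he1, Prod.norm_def]
  have hn2 : ‖e2‖ ≤ 1 := by simp [he2, Prod.norm_def]
  obtain ⟨L, hL1, hL2⟩ := ((exists_scale_norm_le k e1 hn1 (half_pos hη)).and
    (exists_scale_norm_le n e2 hn2 (half_pos hη))).exists
  have hlim : |(A (a L (c L f)) : ℝ × ℝ → ℝ) x - (A f : ℝ × ℝ → ℝ) x| ≤ ε := by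
    refine abs_crv_sub_le _ _ _ (fun y => ?_) x
    have t1 := abs_tent_sub_le ((2:ℝ) ^ (k - L) • e1)
      (abs_tent_sub_self_le ((2:ℝ) ^ (n - L) • e2) (f := f) (ε := ε / 6)
        fun x w hw => hfη' x w (hw.trans hL2)) y
    have t2 := abs_tent_sub_self_le ((2:ℝ) ^ (k - L) • e1) (f := f) (ε := ε / 6)
        (fun x w hw => hfη' x w (hw.trans hL1)) y
    have : (a L (c L f) : ℝ × ℝ → ℝ) y = (tent ((2:ℝ) ^ (k - L) • e1)
      (tent ((2:ℝ) ^ (n - L) • e2) f) : ℝ × ℝ → ℝ) y := rfl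
    rw [this]
    rw [abs_le] at *
    constructor <;> linarith
  have hbox : ∀ i j : ℕ, ‖(A (a i (c j f)) : ℝ × ℝ → ℝ) x‖ₑ ≤ 16 * crvBox b k n ρ i j F x :=
    fun i j => enorm_crv_mul_le b k n ρ i j (enorm_tent_le _) (enorm_tent_le _) f x
  have hdec := mul_mul_eq_sum (R := Module.End ℝ bciSpace) A a c
    (fun i => tentGap ((2:ℝ) ^ (k - (i + 1 : ℕ)) • e1))
    (fun j => tentGap ((2:ℝ) ^ (n - (j + 1 : ℕ)) • e2)) (fun i => tent_succ k i e1)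
    (fun j => tent_succ n j e2) L
  have hdec' : (A (a L (c L f)) : ℝ × ℝ → ℝ) x = (A (a 0 (c L f)) : ℝ × ℝ → ℝ) x
      + (A (a L (c 0 f)) : ℝ × ℝ → ℝ) x - (A (a 0 (c 0 f)) : ℝ × ℝ → ℝ) x
      + ∑ z ∈ Finset.range L ×ˢ Finset.range L, Dop b k n ρ z.1 z.2 f x := by
    have := congrArg (fun T : Module.End ℝ bciSpace => (T f : ℝ × ℝ → ℝ) x) hdec
    simp only [LinearMap.add_apply, LinearMap.sub_apply, Module.End.mul_apply,
      LinearMap.sum_apply, Submodule.coe_add, Submodule.coe_sub, Submodule.coe_sum, Pi.add_apply,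
      Pi.sub_apply, Finset.sum_apply] at this
    exact this
  have hPL : ‖(A (a L (c L f)) : ℝ × ℝ → ℝ) x‖ₑ
      ≤ 16 * (C1 * dmax (0, 1) (dmax (1, 0) F) x) + 16 * (C2 * dmax (1, 0) (dmax (0, 1) F) x)
        + 16 * (C2 * dmax (1, 0) (dmax (0, 1) F) x)
        + ∑' z : ℕ × ℕ, ‖Dop b k n ρ z.1 z.2 f x‖ₑ := by
    rw [hdec']
    refine (enorm_add_le _ _).trans (add_le_add (enorm_sub_le.trans
      (add_le_add ((enorm_add_le _ _).trans (add_le_add ?_ ?_)) ?_)) ?_)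
    · exact (hbox 0 L).trans (mul_le_mul' le_rfl (h1 k n ρ L F hρ hFm x))
    · exact (hbox L 0).trans (mul_le_mul' le_rfl (h2 k n ρ L F hρ hFm x))
    · exact (hbox 0 0).trans (mul_le_mul' le_rfl (h2 k n ρ 0 F hρ hFm x))
    · exact (enorm_sum_le _ _).trans (ENNReal.sum_le_tsum _)
  calc ‖(A f : ℝ × ℝ → ℝ) x‖ₑ
      = ‖(A (a L (c L f)) : ℝ × ℝ → ℝ) x
        - ((A (a L (c L f)) : ℝ × ℝ → ℝ) x - (A f : ℝ × ℝ → ℝ) x)‖ₑ := by rw [sub_sub_cancel]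
    _ ≤ ‖(A (a L (c L f)) : ℝ × ℝ → ℝ) x‖ₑ + ε := by
        refine enorm_sub_le.trans (add_le_add le_rfl ?_)
        rw [Real.enorm_eq_ofReal_abs]
        exact (ENNReal.ofReal_le_ofReal hlim).trans (by simp)
    _ ≤ _ := by
        refine add_le_add (hPL.trans ?_) le_rfl
        refine add_le_add ?_ le_rfl
        push_cast
        have hC : (16 * (C1 * dmax (0, 1) (dmax (1, 0) F) x)
          + 16 * (C2 * dmax (1, 0) (dmax (0, 1) F) x)
          + 16 * (C2 * dmax (1, 0) (dmax (0, 1) F) x) : ℝ≥0∞)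
          = (16 * C1) * dmax (0, 1) (dmax (1, 0) F) x
            + (32 * C2) * dmax (1, 0) (dmax (0, 1) F) x := by ring
        rw [hC]
        exact add_le_add (mul_le_mul' le_self_add le_rfl) (mul_le_mul' le_add_self le_rfl)

/-- The square of the `L²` norm. -/
def n2 (f : ℝ × ℝ → ℝ) : ℝ≥0∞ := ∫⁻ x, ‖f x‖ₑ ^ 2

lemma enorm_sq_eq_ofReal (a : ℝ) : ‖a‖ₑ ^ 2 = ENNReal.ofReal (a ^ 2) := by
  rw [Real.enorm_eq_ofReal_abs, ← ENNReal.ofReal_pow (abs_nonneg a), sq_abs]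

lemma n2_le_of_integral_le {F : ℝ × ℝ → ℝ} {g : ℝ × ℝ → ℝ} {C : ℝ} (hC : 0 ≤ C) (hg : BCI g)
    (hF : Integrable fun x => F x ^ 2) (h : ∫ x, F x ^ 2 ≤ C * ∫ x, g x ^ 2) :
    n2 F ≤ ENNReal.ofReal C * n2 g := by
  unfold n2
  rw [← hg.ofReal_integral_sq, ← ENNReal.ofReal_mul hC]
  simp_rw [enorm_sq_eq_ofReal]
  rw [← ofReal_integral_eq_lintegral_ofReal hF (Eventually.of_forall fun x => sq_nonneg _)]
  exact ENNReal.ofReal_le_ofReal h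

/-- Weighted average over a piece of the curve `(l s, m s ^ b)`. -/
def wcrv (b e l m : ℝ) (f : ℝ × ℝ → ℝ) (x : ℝ × ℝ) : ℝ :=
  ∫ s in Ioc (1:ℝ) 2, s ^ e * f (x - (l * s, m * s ^ b))

lemma exists_n2_wcrv_snd_le {b ε : ℝ} (hb : 1 < b) (e : ℝ) (hε : 0 < ε) (hε1 : ε < 1) :
    ∃ C : ℝ≥0, ∀ (k n : ℤ) (r : ℝ) (j : ℕ) (g : bciSpace), r ∈ Icc (1:ℝ) 4 →
      n2 (wcrv b e (2 ^ k) (2 ^ n * r)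
        ((1 - tr ((2:ℝ) ^ (n - (j + 1 : ℕ)) • ((0:ℝ), (1:ℝ)))) g : bciSpace))
      ≤ C * ENNReal.ofReal (2 ^ (-((1 - ε) * j))) * n2 g := by
  obtain ⟨C, hC, h⟩ := exists_integral_sq_curve_difference_le (b := b) (β := 2) (by linarith)
    hb.ne' (by norm_num) e hε hε1
  refine ⟨C.toNNReal, fun k n r j g hr => ?_⟩
  have hr0 : 0 < r := by linarith [hr.1]
  set δ : ℝ := 1 / (2 ^ (j + 1) * r) with hδ
  have hδ0 : 0 < δ := by positivity
  obtain ⟨h1, h2⟩ := h g (2 ^ k) (2 ^ n * r) δ (bci g) hδ0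
  have hle : δ ^ (1 - ε) ≤ 2 ^ (-((1 - ε) * j)) := by
    have : δ ≤ 2 ^ (-(j:ℝ)) := by
      rw [Real.rpow_neg (by norm_num), Real.rpow_natCast, hδ, ← one_div]
      refine one_div_le_one_div_of_le (by positivity) ?_
      rw [pow_succ]
      have := hr.1
      have h3 : (0:ℝ) < 2 ^ j := by positivity
      nlinarith
    calc δ ^ (1 - ε) ≤ ((2:ℝ) ^ (-(j:ℝ))) ^ (1 - ε) :=
          Real.rpow_le_rpow hδ0.le this (by linarith)
      _ = _ := by rw [← Real.rpow_mul (by norm_num)]; congr 1; ring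
  rw [← ENNReal.ofReal.eq_1, ← ENNReal.ofReal_mul hC]
  have hw : ∀ x, wcrv b e (2 ^ k) (2 ^ n * r)
        ((1 - tr ((2:ℝ) ^ (n - (j + 1 : ℕ)) • ((0:ℝ), (1:ℝ)))) g : bciSpace) x
      = ∫ s in Ioc (1:ℝ) 2, s ^ e * ((g : ℝ × ℝ → ℝ) (x - (2 ^ k * s, 2 ^ n * r * s ^ b))
        - (g : ℝ × ℝ → ℝ) (x - (2 ^ k * s, 2 ^ n * r * s ^ b) - (0, 2 ^ n * r * δ))) := by
    intro x
    unfold wcrv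
    have hv : (2:ℝ) ^ (n - (j + 1 : ℕ)) • ((0:ℝ), (1:ℝ)) = (0, 2 ^ n * r * δ) := by
      rw [zpow_sub₀ (by norm_num), zpow_natCast, hδ]
      ext
      · simp
      · simp; field_simp
    rw [hv]
    simp only [LinearMap.sub_apply, Module.End.one_apply, Submodule.coe_sub, Pi.sub_apply, tr_apply]
  refine n2_le_of_integral_le (by positivity) (bci g) ?_ ?_
  · simp_rw [hw]
    exact h1
  · simp_rw [hw]
    refine h2.trans ?_
    have : 0 ≤ ∫ x, (g : ℝ × ℝ → ℝ) x ^ 2 := integral_nonneg fun x => sq_nonneg _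
    gcongr

lemma setIntegral_curve_swap {b : ℝ} (hb : 0 < b) (e : ℝ) (G : ℝ → ℝ → ℝ) :
    ∫ s in Ioc (1:ℝ) 2, s ^ e * G s (s ^ b)
      = (1 / b) * ∫ σ in Ioc (1:ℝ) (2 ^ b), σ ^ (e / b + (1 / b - 1)) * G (σ ^ (1 / b)) σ := by
  have hpos : ∀ σ ∈ Ioc (1:ℝ) (2 ^ b), 0 < σ := fun σ hσ => by linarith [hσ.1]
  have hinv : ∀ σ : ℝ, 0 < σ → (σ ^ (1 / b)) ^ b = σ := fun σ h => by
    rw [← Real.rpow_mul h.le, one_div_mul_cancel hb.ne', Real.rpow_one]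
  have himg : (fun σ : ℝ => σ ^ (1 / b)) '' Ioc (1:ℝ) (2 ^ b) = Ioc 1 2 := by
    ext s
    constructor
    · rintro ⟨σ, hσ, rfl⟩
      have h0 := hpos σ hσ
      refine ⟨Real.one_lt_rpow hσ.1 (by positivity), ?_⟩
      calc σ ^ (1 / b) ≤ ((2:ℝ) ^ b) ^ (1 / b) := Real.rpow_le_rpow h0.le hσ.2 (by positivity)
        _ = 2 := by rw [← Real.rpow_mul (by norm_num), mul_one_div_cancel hb.ne', Real.rpow_one]
    · intro hs
      have h0 : 0 < s := by linarith [hs.1]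
      refine ⟨s ^ b, ⟨Real.one_lt_rpow hs.1 hb, Real.rpow_le_rpow h0.le hs.2 hb.le⟩, ?_⟩
      simp only
      rw [← Real.rpow_mul h0.le, mul_one_div_cancel hb.ne', Real.rpow_one]
  have hder : ∀ σ ∈ Ioc (1:ℝ) (2 ^ b), HasDerivWithinAt (fun σ : ℝ => σ ^ (1 / b))
      (1 / b * σ ^ (1 / b - 1)) (Ioc 1 (2 ^ b)) σ := fun σ hσ =>
    (Real.hasDerivAt_rpow_const (Or.inl (hpos σ hσ).ne')).hasDerivWithinAt
  have hinj : InjOn (fun σ : ℝ => σ ^ (1 / b)) (Ioc (1:ℝ) (2 ^ b)) := fun σ hσ τ hτ h => by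
    simp only at h
    rw [← hinv σ (hpos σ hσ), ← hinv τ (hpos τ hτ), h]
  have := integral_image_eq_integral_abs_deriv_smul measurableSet_Ioc hder hinj
    (fun s => s ^ e * G s (s ^ b))
  rw [himg] at this
  rw [this, ← integral_const_mul]
  refine setIntegral_congr_fun measurableSet_Ioc fun σ hσ => ?_
  have h0 := hpos σ hσ
  simp only [smul_eq_mul]
  rw [hinv σ h0, abs_of_pos (by positivity), Real.rpow_add h0, ← Real.rpow_mul h0.le,
    one_div_mul_eq_div]
  ring_nf

lemma exists_n2_wcrv_fst_le {b ε : ℝ} (hb : 1 < b) (e : ℝ) (hε : 0 < ε) (hε1 : ε < 1) :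
    ∃ C : ℝ≥0, ∀ (k n : ℤ) (r : ℝ) (i : ℕ) (g : bciSpace),
      n2 (wcrv b e (2 ^ k) (2 ^ n * r)
        ((1 - tr ((2:ℝ) ^ (k - (i + 1 : ℕ)) • ((1:ℝ), (0:ℝ)))) g : bciSpace))
      ≤ C * ENNReal.ofReal (2 ^ (-((1 - ε) * i))) * n2 g := by
  have hb0 : 0 < b := by linarith
  obtain ⟨C, hC, h⟩ := exists_integral_sq_curve_difference_le (b := 1 / b) (β := 2 ^ b)
    (by positivity) (by rw [one_div]; exact inv_ne_one.2 hb.ne')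
    (Real.one_le_rpow (by norm_num) hb0.le) (e / b + (1 / b - 1)) hε hε1
  refine ⟨((1 / b) ^ 2 * C).toNNReal, fun k n r i g => ?_⟩
  set δ : ℝ := 1 / 2 ^ (i + 1) with hδ
  have hδ0 : 0 < δ := by positivity
  have hgs : BCI fun z : ℝ × ℝ => (g : ℝ × ℝ → ℝ) z.swap := by
    obtain ⟨h1, h2, C, h3⟩ := bci g
    exact ⟨h1.comp continuous_swap, h2.swap, C, fun x => h3 _⟩
  obtain ⟨h1, h2⟩ := h _ (2 ^ n * r) (2 ^ k) δ hgs hδ0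
  have hle : δ ^ (1 - ε) ≤ 2 ^ (-((1 - ε) * i)) := by
    have : δ ≤ 2 ^ (-(i:ℝ)) := by
      rw [Real.rpow_neg (by norm_num), Real.rpow_natCast, hδ, ← one_div]
      exact one_div_le_one_div_of_le (by positivity) (pow_le_pow_right₀ (by norm_num) (by omega))
    calc δ ^ (1 - ε) ≤ ((2:ℝ) ^ (-(i:ℝ))) ^ (1 - ε) :=
          Real.rpow_le_rpow hδ0.le this (by linarith)
      _ = _ := by rw [← Real.rpow_mul (by norm_num)]; congr 1; ring
  rw [← ENNReal.ofReal.eq_1, ← ENNReal.ofReal_mul (by positivity)]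
  set F : ℝ × ℝ → ℝ := fun x => ∫ σ in Ioc (1:ℝ) (2 ^ b), σ ^ (e / b + (1 / b - 1)) *
    ((g : ℝ × ℝ → ℝ) (x - (2 ^ n * r * σ, 2 ^ k * σ ^ (1 / b))).swap
      - (g : ℝ × ℝ → ℝ) (x - (2 ^ n * r * σ, 2 ^ k * σ ^ (1 / b)) - (0, 2 ^ k * δ)).swap) with hF
  have hw : ∀ x, wcrv b e (2 ^ k) (2 ^ n * r)
        ((1 - tr ((2:ℝ) ^ (k - (i + 1 : ℕ)) • ((1:ℝ), (0:ℝ)))) g : bciSpace) x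
      = 1 / b * F x.swap := by
    intro x
    unfold wcrv
    have hv : (2:ℝ) ^ (k - (i + 1 : ℕ)) • ((1:ℝ), (0:ℝ)) = (2 ^ k * δ, 0) := by
      rw [zpow_sub₀ (by norm_num), zpow_natCast, hδ]
      ext
      · simp; field_simp
      · simp
    rw [hv, setIntegral_curve_swap hb0 e (fun s σ =>
      ((((1 - tr (2 ^ k * δ, 0)) g : bciSpace) : ℝ × ℝ → ℝ) (x - (2 ^ k * s, 2 ^ n * r * σ))))]
    simp only [LinearMap.sub_apply, Module.End.one_apply, Submodule.coe_sub, Pi.sub_apply,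
      tr_apply, hF]
    rfl
  have hsw : ∀ G : ℝ × ℝ → ℝ, ∫ x : ℝ × ℝ, G x.swap = ∫ x, G x := fun G => by
    rw [Measure.volume_eq_prod]
    exact integral_prod_swap G
  refine n2_le_of_integral_le (by positivity) (bci g) ?_ ?_
  · simp_rw [hw, mul_pow]
    exact (h1.swap).const_mul _
  · simp_rw [hw, mul_pow]
    rw [integral_const_mul, hsw (fun x => F x ^ 2), mul_assoc, mul_assoc]
    rw [hsw (fun x => (g : ℝ × ℝ → ℝ) x ^ 2)] at h2
    refine mul_le_mul_of_nonneg_left (h2.trans ?_) (by positivity)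
    rw [mul_assoc]
    have : 0 ≤ ∫ x, (g : ℝ × ℝ → ℝ) x ^ 2 := integral_nonneg fun x => sq_nonneg _
    gcongr

lemma bx_sub_shift (y : bciSpace) (e z : ℝ × ℝ) {δ : ℝ} (hδ : 0 < δ) (t₁ t₂ : ℝ) :
    (bx (δ • e) y : ℝ × ℝ → ℝ) (z - t₂ • e) - (bx (δ • e) y : ℝ × ℝ → ℝ) (z - t₁ • e)
      = -(1 / δ) * ∫ τ in t₁..t₂, ((1 - tr (δ • e)) y : bciSpace).1 (z - τ • e) := by
  set φ : ℝ → ℝ := fun τ => (y : ℝ × ℝ → ℝ) (z - τ • e) with hφ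
  have hφc : Continuous φ := (bci y).cont.comp (by fun_prop)
  have hi : ∀ a c : ℝ, IntervalIntegrable φ volume a c := fun a c => hφc.intervalIntegrable _ _
  have h1 : ∀ t, (bx (δ • e) y : ℝ × ℝ → ℝ) (z - t • e) = (1 / δ) * ∫ τ in t..(t + δ), φ τ := by
    intro t
    rw [bx_apply, ← intervalIntegral.integral_of_le zero_le_one]
    have := intervalIntegral.integral_comp_mul_add (a := 0) (b := 1) φ hδ.ne' t
    rw [mul_zero, zero_add, mul_one, smul_eq_mul, add_comm δ t] at this
    rw [one_div, ← this]
    refine intervalIntegral.integral_congr fun r _ => ?_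
    simp only [hφ]
    rw [show z - t • e - r • δ • e = z - (δ * r + t) • e by module]
  have h2 : ∫ τ in t₁..t₂, ((1 - tr (δ • e)) y : bciSpace).1 (z - τ • e)
      = (∫ τ in t₁..t₂, φ τ) - ∫ τ in (t₁ + δ)..(t₂ + δ), φ τ := by
    have h3 := intervalIntegral.integral_comp_add_right (a := t₁) (b := t₂) φ δ
    have hc2 : Continuous fun τ => φ (τ + δ) := hφc.comp (by fun_prop)
    rw [← h3, ← intervalIntegral.integral_sub (hi _ _) (hc2.intervalIntegrable _ _)]
    refine intervalIntegral.integral_congr fun r _ => ?_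
    simp only [LinearMap.sub_apply, Module.End.one_apply, Submodule.coe_sub, Pi.sub_apply,
      tr_apply, hφ]
    rw [show z - r • e - δ • e = z - (r + δ) • e by module]
  rw [h1, h1, h2]
  have h4 := intervalIntegral.integral_add_adjacent_intervals (hi t₁ t₂) (hi t₂ (t₂ + δ))
  have h5 := intervalIntegral.integral_add_adjacent_intervals (hi t₁ (t₁ + δ))
    (hi (t₁ + δ) (t₂ + δ))
  have h6 : (∫ τ in t₂..(t₂ + δ), φ τ) = (∫ τ in t₁..(t₁ + δ), φ τ)
    + (∫ τ in (t₁ + δ)..(t₂ + δ), φ τ) - ∫ τ in t₁..t₂, φ τ := by linarith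
  rw [h6]
  ring

lemma enorm_crv_bx_sub_le {b : ℝ} (k n : ℤ) {δ : ℝ} (hδ : 0 < δ) (y : bciSpace)
    {ρ₁ ρ₂ : ℝ} (hρ : ρ₁ ≤ ρ₂) (x : ℝ × ℝ) :
    ‖(crv b (2 ^ k) (2 ^ n * ρ₂) (bx (δ • ((0:ℝ), (1:ℝ))) y) : ℝ × ℝ → ℝ) x
      - (crv b (2 ^ k) (2 ^ n * ρ₁) (bx (δ • ((0:ℝ), (1:ℝ))) y) : ℝ × ℝ → ℝ) x‖ₑ
    ≤ ENNReal.ofReal (2 ^ n / δ) * ∫⁻ r in Ioc ρ₁ ρ₂,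
        ‖wcrv b b (2 ^ k) (2 ^ n * r) ((1 - tr (δ • ((0:ℝ), (1:ℝ)))) y : bciSpace) x‖ₑ := by
  set e : ℝ × ℝ := ((0:ℝ), (1:ℝ)) with he
  set g : bciSpace := (1 - tr (δ • e)) y with hg
  set h : bciSpace := bx (δ • e) y with hh
  have hgm : Measurable (g : ℝ × ℝ → ℝ) := (bci g).cont.measurable
  have hpt : ∀ s ∈ Ioc (1:ℝ) 2, (h : ℝ × ℝ → ℝ) (x - (2 ^ k * s, 2 ^ n * ρ₂ * s ^ b))
      - (h : ℝ × ℝ → ℝ) (x - (2 ^ k * s, 2 ^ n * ρ₁ * s ^ b))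
      = -(2 ^ n / δ) * ∫ r in Ioc ρ₁ ρ₂, s ^ b *
        (g : ℝ × ℝ → ℝ) (x - (2 ^ k * s, 2 ^ n * r * s ^ b)) := by
    intro s hs
    have hs0 : 0 < s := by linarith [hs.1]
    have hsb : 0 < 2 ^ n * s ^ b := by positivity
    have h1 := bx_sub_shift y e (x - (2 ^ k * s, 0)) hδ (2 ^ n * ρ₁ * s ^ b) (2 ^ n * ρ₂ * s ^ b)
    have hp : ∀ t : ℝ, x - (2 ^ k * s, 0) - t • e = x - (2 ^ k * s, t) := fun t => by
      ext <;> simp [he]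
    simp only [hp] at h1
    rw [← hh, ← hg] at h1
    rw [h1, integral_const_mul, ← intervalIntegral.integral_of_le hρ]
    have h2 := intervalIntegral.integral_comp_mul_left (a := ρ₁) (b := ρ₂)
      (fun τ => (g : ℝ × ℝ → ℝ) (x - (2 ^ k * s, τ))) hsb.ne'
    rw [smul_eq_mul] at h2
    have h3 : ∀ ρ : ℝ, 2 ^ n * s ^ b * ρ = 2 ^ n * ρ * s ^ b := fun ρ => by ring
    simp only [h3] at h2
    rw [h2]
    field_simp
  obtain ⟨C, hC⟩ := (bci g).bdd
  have hrw : (crv b (2 ^ k) (2 ^ n * ρ₂) h : ℝ × ℝ → ℝ) x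
      - (crv b (2 ^ k) (2 ^ n * ρ₁) h : ℝ × ℝ → ℝ) x
      = -(2 ^ n / δ) * ∫ r in Ioc ρ₁ ρ₂, wcrv b b (2 ^ k) (2 ^ n * r) g x := by
    rw [crv_apply, crv_apply, ← integral_sub (integrable_comp_sub _ (bci h) (measurable_curve _ _ _) x)
      (integrable_comp_sub _ (bci h) (measurable_curve _ _ _) x),
      setIntegral_congr_fun measurableSet_Ioc hpt, integral_const_mul]
    unfold wcrv
    rw [integral_integral_swap]
    have hm : Measurable fun z : ℝ × ℝ => z.1 ^ b := measurable_fst.pow_const _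
    refine Integrable.of_bound (C := 2 ^ |b| * C) ?_ ?_
    · exact Measurable.aestronglyMeasurable (by simp only [Function.uncurry_def]; fun_prop)
    · rw [Measure.prod_restrict]
      filter_upwards [ae_restrict_mem (measurableSet_Ioc.prod measurableSet_Ioc)] with z hz
      have h1 := rpow_le_of_mem_Icc ⟨hz.1.1.le, hz.1.2⟩ b
      have h0 : 0 ≤ z.1 ^ b := Real.rpow_nonneg (by linarith [hz.1.1]) _
      simp only [Function.uncurry_def, Real.norm_eq_abs, abs_mul, abs_of_nonneg h0]
      exact mul_le_mul h1 (hC _) (abs_nonneg _) (by positivity)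
  rw [hrw, enorm_mul, enorm_neg, Real.enorm_eq_ofReal_abs, abs_of_pos (by positivity)]
  exact mul_le_mul' le_rfl (enorm_integral_le_lintegral_enorm _)

lemma measurable_wcrv_uncurry (b e l m : ℝ) (g : bciSpace) :
    Measurable fun z : (ℝ × ℝ) × ℝ => wcrv b e l (m * z.2) g z.1 := by
  have hgm : Measurable (g : ℝ × ℝ → ℝ) := (bci g).cont.measurable
  have hm : ∀ c : ℝ, Measurable fun z : ((ℝ × ℝ) × ℝ) × ℝ => z.2 ^ c :=
    fun c => measurable_snd.pow_const _
  have h1 := hm b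
  have h2 := hm e
  have : Measurable fun z : ((ℝ × ℝ) × ℝ) × ℝ =>
      z.2 ^ e * (g : ℝ × ℝ → ℝ) (z.1.1 - (l * z.2, m * z.1.2 * z.2 ^ b)) := by fun_prop
  exact (this.stronglyMeasurable.integral_prod_right').measurable

lemma crv_eq_wcrv (b l m : ℝ) (f : bciSpace) (x : ℝ × ℝ) :
    (crv b l m f : ℝ × ℝ → ℝ) x = wcrv b 0 l m f x := by
  simp [crv_apply, wcrv]

lemma lintegral_iSup_window_sq_le {b : ℝ} (k n : ℤ) (j l : ℕ) (hjl : j ≤ l) (y : bciSpace)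
    {Λ : ℝ≥0∞} {P : Set ℝ} {ρ₀ : ℝ} (hρ₀ : ρ₀ ∈ Icc (1:ℝ) 4)
    (hP : ∀ ρ ∈ P, ρ ∈ Icc (1:ℝ) 4 ∧ |ρ - ρ₀| ≤ 2 / 2 ^ l)
    (h0 : n2 (crv b (2 ^ k) (2 ^ n * ρ₀)
      (bx ((2:ℝ) ^ (n - (j + 1 : ℕ)) • ((0:ℝ), (1:ℝ))) y) : bciSpace) ≤ Λ)
    (h1 : ∀ r ∈ Icc (1:ℝ) 4, n2 (wcrv b b (2 ^ k) (2 ^ n * r)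
      ((1 - tr ((2:ℝ) ^ (n - (j + 1 : ℕ)) • ((0:ℝ), (1:ℝ)))) y : bciSpace)) ≤ Λ) :
    ∫⁻ x, (⨆ ρ ∈ P, ‖(crv b (2 ^ k) (2 ^ n * ρ)
      (bx ((2:ℝ) ^ (n - (j + 1 : ℕ)) • ((0:ℝ), (1:ℝ))) y) : ℝ × ℝ → ℝ) x‖ₑ) ^ 2 ≤ 130 * Λ := by
  set δ : ℝ := 2 ^ (n - (j + 1 : ℕ)) with hδ
  have hδ0 : 0 < δ := by positivity
  set h : bciSpace := bx (δ • ((0:ℝ), (1:ℝ))) y with hh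
  set g : bciSpace := (1 - tr (δ • ((0:ℝ), (1:ℝ)))) y with hg
  set d : ℝ := 2 / 2 ^ l with hd
  have hd0 : 0 < d := by positivity
  set I : Set ℝ := Icc (1:ℝ) 4 ∩ Icc (ρ₀ - d) (ρ₀ + d) with hI
  set W : ℝ × ℝ → ℝ≥0∞ := fun x => ∫⁻ r in I, ‖wcrv b b (2 ^ k) (2 ^ n * r) g x‖ₑ with hW
  have hwm := (measurable_wcrv_uncurry b b (2 ^ k) (2 ^ n) g).enorm
  have hWm : Measurable W := Measurable.lintegral_prod_right' hwm
  set c : ℝ≥0∞ := ENNReal.ofReal (2 ^ n / δ) with hc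
  have hIsub : ∀ a a' : ℝ, a ∈ I → a' ∈ I → Ioc a a' ⊆ I := fun a a' ha ha' t ht =>
    ⟨⟨ha.1.1.trans ht.1.le, ht.2.trans ha'.1.2⟩, ⟨ha.2.1.trans ht.1.le, ht.2.trans ha'.2.2⟩⟩
  have hρ₀I : ρ₀ ∈ I := ⟨hρ₀, by constructor <;> linarith⟩
  have hpt : ∀ x, ∀ ρ ∈ P, ‖(crv b (2 ^ k) (2 ^ n * ρ) h : ℝ × ℝ → ℝ) x‖ₑ
      ≤ ‖(crv b (2 ^ k) (2 ^ n * ρ₀) h : ℝ × ℝ → ℝ) x‖ₑ + c * W x := by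
    intro x ρ hρ
    have hρI : ρ ∈ I := by
      obtain ⟨h1, h2⟩ := hP ρ hρ
      rw [abs_le] at h2
      exact ⟨h1, by constructor <;> linarith⟩
    have hdiff : ‖(crv b (2 ^ k) (2 ^ n * ρ) h : ℝ × ℝ → ℝ) x
        - (crv b (2 ^ k) (2 ^ n * ρ₀) h : ℝ × ℝ → ℝ) x‖ₑ ≤ c * W x := by
      rcases le_total ρ₀ ρ with hle | hle
      · exact (enorm_crv_bx_sub_le k n hδ0 y hle x).trans
          (mul_le_mul' le_rfl (lintegral_mono_set (hIsub _ _ hρ₀I hρI)))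
      · rw [← enorm_neg, neg_sub]
        exact (enorm_crv_bx_sub_le k n hδ0 y hle x).trans
          (mul_le_mul' le_rfl (lintegral_mono_set (hIsub _ _ hρI hρ₀I)))
    calc _ = ‖(crv b (2 ^ k) (2 ^ n * ρ₀) h : ℝ × ℝ → ℝ) x
        + ((crv b (2 ^ k) (2 ^ n * ρ) h : ℝ × ℝ → ℝ) x
        - (crv b (2 ^ k) (2 ^ n * ρ₀) h : ℝ × ℝ → ℝ) x)‖ₑ := by rw [add_sub_cancel]
      _ ≤ _ := (enorm_add_le _ _).trans (add_le_add le_rfl hdiff)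
  have hvolI : volume I ≤ ENNReal.ofReal (2 * d) := by
    refine (measure_mono inter_subset_right).trans (le_of_eq ?_)
    rw [Real.volume_Icc]
    congr 1
    ring
  have hW2 : ∫⁻ x, W x ^ 2 ≤ ENNReal.ofReal (2 * d) * (ENNReal.ofReal (2 * d) * Λ) := by
    have hIm : MeasurableSet I := measurableSet_Icc.inter measurableSet_Icc
    calc ∫⁻ x, W x ^ 2 ≤ ∫⁻ x, ENNReal.ofReal (2 * d) *
          ∫⁻ r in I, ‖wcrv b b (2 ^ k) (2 ^ n * r) g x‖ₑ ^ 2 := by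
          refine lintegral_mono fun x => ?_
          have := lintegral_rpow_le_measure_mul (volume.restrict I) one_lt_two
            (f := fun r => ‖wcrv b b (2 ^ k) (2 ^ n * r) g x‖ₑ)
            (hwm.comp (by fun_prop : Measurable fun r : ℝ => (x, r))).aemeasurable
          norm_num at this
          exact this.trans (mul_le_mul' hvolI le_rfl)
      _ = ENNReal.ofReal (2 * d) *
          ∫⁻ r in I, ∫⁻ x, ‖wcrv b b (2 ^ k) (2 ^ n * r) g x‖ₑ ^ 2 := by
          rw [lintegral_const_mul, lintegral_lintegral_swap]
          · exact (hwm.pow_const 2).aemeasurable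
          · exact Measurable.lintegral_prod_right' (hwm.pow_const 2)
      _ ≤ ENNReal.ofReal (2 * d) * ∫⁻ r in I, Λ :=
          mul_le_mul' le_rfl (setLIntegral_mono' hIm fun r hr => h1 r hr.1)
      _ ≤ _ := by
          rw [setLIntegral_const, mul_comm Λ]
          gcongr
  have hfm : Measurable fun x => ‖(crv b (2 ^ k) (2 ^ n * ρ₀) h : ℝ × ℝ → ℝ) x‖ₑ :=
    (bci _).cont.measurable.enorm
  have hsq : ∀ a c : ℝ≥0∞, (a + c) ^ 2 ≤ 2 * a ^ 2 + 2 * c ^ 2 := fun a c => by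
    have := ENNReal.rpow_add_le_mul_rpow_add_rpow a c one_le_two
    norm_num at this
    rw [← mul_add]
    exact this
  have hconst : c ^ 2 * (ENNReal.ofReal (2 * d) * ENNReal.ofReal (2 * d)) ≤ 64 := by
    rw [hc, ← ENNReal.ofReal_pow (by positivity), ← ENNReal.ofReal_mul (by positivity),
      ← ENNReal.ofReal_mul (by positivity)]
    refine ENNReal.ofReal_le_of_le_toReal ?_
    have e1 : 2 ^ n / δ * d ≤ 4 := by
      rw [hδ, hd, zpow_sub₀ (by norm_num), zpow_natCast, div_div_cancel₀ (by positivity), pow_succ]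
      have : (2:ℝ) ^ j ≤ 2 ^ l := pow_le_pow_right₀ (by norm_num) hjl
      rw [← mul_div_assoc, div_le_iff₀ (by positivity)]
      linarith
    have e2 : 0 ≤ 2 ^ n / δ * d := by positivity
    have e3 : (2 ^ n / δ) ^ 2 * (2 * d * (2 * d)) = 4 * (2 ^ n / δ * d) ^ 2 := by ring
    rw [e3]
    norm_num
    nlinarith
  calc _ ≤ ∫⁻ x, (‖(crv b (2 ^ k) (2 ^ n * ρ₀) h : ℝ × ℝ → ℝ) x‖ₑ + c * W x) ^ 2 := by
        refine lintegral_mono fun x => ?_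
        exact pow_le_pow_left₀ zero_le (iSup₂_le (hpt x)) 2
    _ ≤ ∫⁻ x, (2 * ‖(crv b (2 ^ k) (2 ^ n * ρ₀) h : ℝ × ℝ → ℝ) x‖ₑ ^ 2 + 2 * (c * W x) ^ 2) :=
        lintegral_mono fun x => hsq _ _
    _ = 2 * n2 (crv b (2 ^ k) (2 ^ n * ρ₀) h : bciSpace) + 2 * (c ^ 2 * ∫⁻ x, W x ^ 2) := by
        rw [lintegral_add_left (by fun_prop), lintegral_const_mul _ (by fun_prop),
          lintegral_const_mul _ (by fun_prop)]
        simp_rw [mul_pow]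
        rw [lintegral_const_mul _ (by fun_prop)]
        rfl
    _ ≤ 2 * Λ + 2 * (64 * Λ) := by
        refine add_le_add (mul_le_mul' le_rfl h0) (mul_le_mul' le_rfl ?_)
        refine (mul_le_mul' le_rfl hW2).trans ?_
        rw [← mul_assoc, ← mul_assoc, mul_assoc (c ^ 2)]
        exact mul_le_mul' hconst le_rfl
    _ = 130 * Λ := by ring

lemma n2_tr (a : ℝ × ℝ) (f : bciSpace) : n2 (tr a f : bciSpace) = n2 f := by
  unfold n2
  simp only [tr_apply]
  exact lintegral_sub_right_eq_self (fun x => ‖(f : ℝ × ℝ → ℝ) x‖ₑ ^ 2) a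

lemma n2_smul (c : ℝ) (f : bciSpace) : n2 (c • f : bciSpace) = ‖c‖ₑ ^ 2 * n2 f := by
  unfold n2
  simp only [Submodule.coe_smul, Pi.smul_apply, smul_eq_mul, enorm_mul, mul_pow]
  exact lintegral_const_mul _ ((bci f).cont.measurable.enorm.pow_const 2)

lemma n2_add_sub (f g : bciSpace) :
    n2 (f - g : bciSpace) + n2 (f + g : bciSpace) = 2 * n2 f + 2 * n2 g := by
  have hm : ∀ f : bciSpace, Measurable fun x => ‖(f : ℝ × ℝ → ℝ) x‖ₑ ^ 2 := fun f =>
    (bci f).cont.measurable.enorm.pow_const 2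
  unfold n2
  rw [← lintegral_add_left (hm _), ← lintegral_const_mul _ (hm _), ← lintegral_const_mul _ (hm _),
    ← lintegral_add_left ((hm _).const_mul _)]
  refine lintegral_congr fun x => ?_
  simp only [enorm_sq_eq_ofReal, Submodule.coe_add, Submodule.coe_sub, Pi.add_apply, Pi.sub_apply]
  rw [← ENNReal.ofReal_add (sq_nonneg _) (sq_nonneg _), ← ENNReal.ofReal_ofNat 2,
    ← ENNReal.ofReal_mul (by norm_num), ← ENNReal.ofReal_mul (by norm_num),
    ← ENNReal.ofReal_add (by positivity) (by positivity)]
  congr 1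
  ring

lemma n2_one_sub_tr_le (a : ℝ × ℝ) (f : bciSpace) : n2 ((1 - tr a) f : bciSpace) ≤ 4 * n2 f := by
  have h := n2_add_sub f (tr a f)
  rw [n2_tr] at h
  calc _ ≤ n2 (f - tr a f : bciSpace) + n2 (f + tr a f : bciSpace) := le_self_add
    _ = 4 * n2 f := by rw [h]; ring

lemma n2_bx_le (v : ℝ × ℝ) (f : bciSpace) : n2 (bx v f : bciSpace) ≤ n2 f := by
  have h := lintegral_lbox_rpow_le v (f := fun y => ‖(f : ℝ × ℝ → ℝ) y‖ₑ)
    (bci f).cont.measurable.enorm one_lt_two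
  norm_num at h
  refine le_trans (lintegral_mono fun x => ?_) h
  refine pow_le_pow_left₀ zero_le ?_ 2
  rw [bx_apply]
  exact enorm_integral_le_lintegral_enorm _

lemma n2_gp_le (v : ℝ × ℝ) (f : bciSpace) : n2 (gp v f : bciSpace) ≤ 4 * n2 f :=
  (n2_one_sub_tr_le v _).trans (mul_le_mul' le_rfl (n2_bx_le v f))

lemma n2_gp_add (v : ℝ × ℝ) (f : bciSpace) :
    n2 (gp v f : bciSpace) + 4 * n2 (bx ((2:ℝ) • v) f : bciSpace) = 4 * n2 (bx v f : bciSpace) := by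
  have h := n2_add_sub (bx v f) (tr v (bx v f))
  rw [n2_tr] at h
  have h2 : n2 (bx ((2:ℝ) • v) f : bciSpace)
      = ‖(1 / 2 : ℝ)‖ₑ ^ 2 * n2 (bx v f + tr v (bx v f) : bciSpace) := by
    rw [← n2_smul, bx_two_smul]
    rfl
  have h3 : (4:ℝ≥0∞) * ‖(1 / 2 : ℝ)‖ₑ ^ 2 = 1 := by
    rw [enorm_sq_eq_ofReal, ← ENNReal.ofReal_ofNat 4, ← ENNReal.ofReal_mul (by norm_num)]
    norm_num
  rw [h2, ← mul_assoc, h3, one_mul, show (4:ℝ≥0∞) = 2 + 2 by norm_num, add_mul, ← h]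
  rfl

lemma sum_n2_gp_le (e : ℝ × ℝ) (q : ℤ) (f : bciSpace) (S : Finset ℤ) :
    ∑ k ∈ S, n2 (gp ((2:ℝ) ^ (k - q) • e) f : bciSpace) ≤ 4 * n2 f := by
  refine sum_le_of_telescoping (fun k => 4 * n2 (bx ((2:ℝ) ^ (k - q) • e) f : bciSpace)) _
    (fun k => ?_) (fun k => mul_le_mul' le_rfl (n2_bx_le _ f)) S
  have := n2_gp_add ((2:ℝ) ^ (k - q) • e) f
  rw [← two_zpow_succ_smul, show k - q + 1 = k + 1 - q by ring] at this
  exact this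

lemma one_sub_tr_commute_cv (a : ℝ × ℝ) (μ : Measure (ℝ × ℝ)) [IsFiniteMeasure μ] :
    Commute (1 - tr a) (cv μ) :=
  Commute.sub_left (R := Module.End ℝ bciSpace) (Commute.one_left _) (cv_commute _ _)

lemma one_sub_tr_commute (a c : ℝ × ℝ) : Commute (1 - tr a) (1 - tr c) :=
  Commute.sub_right (R := Module.End ℝ bciSpace) (Commute.one_right _)
    (one_sub_tr_commute_cv a _)

lemma gp_commute_cv (v : ℝ × ℝ) (μ : Measure (ℝ × ℝ)) [IsFiniteMeasure μ] :
    Commute (gp v) (cv μ) := (one_sub_tr_commute_cv v μ).mul_left (cv_commute _ _)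

lemma gp_commute_one_sub_tr (v w : ℝ × ℝ) : Commute (gp v) (1 - tr w) :=
  Commute.sub_right (R := Module.End ℝ bciSpace) (Commute.one_right _) (gp_commute_cv v _)

lemma gp_eq (v : ℝ × ℝ) : gp v = bx v * (1 - tr v) := (one_sub_tr_commute_cv v _).eq

lemma gp_commute (v w : ℝ × ℝ) : Commute (gp v) (gp w) :=
  (gp_commute_one_sub_tr v w).mul_right (gp_commute_cv v _)

lemma smul_mul_smul_gap {R : Type*} [Ring R] [Algebra ℝ R] {S₁ S₂ g₁ g₂ : R} (c : ℝ)
    (h1 : Commute g₁ S₁) (h2 : Commute g₁ S₂) (h3 : Commute g₂ S₁) (h4 : Commute g₂ S₂)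
    (h5 : Commute g₂ g₁) :
    (c • (S₁ * (g₁ * g₁))) * (c • (S₂ * (g₂ * g₂)))
      = g₁ * (g₂ * ((c * c) • (S₁ * (S₂ * (g₁ * g₂))))) := by
  simp only [mul_smul_comm, smul_mul_assoc, smul_smul, mul_assoc]
  congr 1
  rw [h3.left_comm, h1.left_comm, h4.left_comm, h2.left_comm, h5.left_comm]

/-- The common factor of the two-parameter pieces. -/
def gapCore (v₁ v₂ : ℝ × ℝ) (f : bciSpace) : bciSpace :=
  ((-(1 / 4) : ℝ) * -(1 / 4)) • tr (-((2:ℝ) • v₁)) (tr (-((2:ℝ) • v₂)) (gp v₁ (gp v₂ f)))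

lemma n2_gapCore_le (v₁ v₂ : ℝ × ℝ) (f : bciSpace) :
    n2 (gapCore v₁ v₂ f) ≤ n2 (gp v₁ (gp v₂ f) : bciSpace) := by
  rw [gapCore, n2_smul, n2_tr, n2_tr]
  refine mul_le_of_le_one_left zero_le ?_
  rw [enorm_sq_eq_ofReal]
  refine ENNReal.ofReal_le_one.2 (by norm_num)

lemma tentGap_tentGap (v₁ v₂ : ℝ × ℝ) (f : bciSpace) : tentGap v₁ (tentGap v₂ f)
    = bx v₂ ((1 - tr v₂) (gp v₁ (gapCore v₁ v₂ f))) := by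
  have h1 := smul_mul_smul_gap (R := Module.End ℝ bciSpace) (S₁ := tr (-((2:ℝ) • v₁)))
    (S₂ := tr (-((2:ℝ) • v₂))) (-(1 / 4)) (gp_commute_cv v₁ _) (gp_commute_cv v₁ _)
    (gp_commute_cv v₂ _) (gp_commute_cv v₂ _) (gp_commute v₂ v₁)
  have h2 := congrArg (fun T : Module.End ℝ bciSpace => T f) h1
  have h3 : tentGap v₁ (tentGap v₂ f) = gp v₁ (gp v₂ (gapCore v₁ v₂ f)) := h2
  have h4 : Commute (gp v₁) (gp v₂) := gp_commute _ _
  rw [h3, ← Module.End.mul_apply, h4.eq, gp_eq v₂]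
  rfl

theorem exists_lintegral_iSup_Dop_sq_le {b ε : ℝ} (hb : 1 < b) (hε : 0 < ε) (hε1 : ε < 1) :
    ∃ C : ℝ≥0, ∀ (N K : Finset ℤ) (P : ℤ → ℤ → Finset ℝ) (i j M : ℕ) (ρ : ℕ → ℤ → ℤ → ℝ)
      (f : bciSpace), (∀ m n k, ρ m n k ∈ Icc (1:ℝ) 4) →
      (∀ n k, ∀ t ∈ P n k, t ∈ Icc (1:ℝ) 4 ∧ ∃ m < M, |t - ρ m n k| ≤ 2 / 2 ^ max i j) →
      ∫⁻ x, (⨆ n ∈ N, ⨆ k ∈ K, ⨆ t ∈ P n k, ‖Dop b k n t i j f x‖ₑ) ^ 2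
        ≤ C * M * ENNReal.ofReal (2 ^ (-((1 - ε) * (max i j : ℕ)))) * n2 f := by
  obtain ⟨C1, h1⟩ := exists_n2_wcrv_snd_le hb 0 hε hε1
  obtain ⟨C2, h2⟩ := exists_n2_wcrv_snd_le hb b hε hε1
  obtain ⟨C3, h3⟩ := exists_n2_wcrv_fst_le hb 0 hε hε1
  obtain ⟨C4, h4⟩ := exists_n2_wcrv_fst_le hb b hε hε1
  set C : ℝ≥0 := C1 + C2 + C3 + C4 with hC
  have hCle : (C1:ℝ≥0∞) ≤ C ∧ (C2:ℝ≥0∞) ≤ C ∧ (C3:ℝ≥0∞) ≤ C ∧ (C4:ℝ≥0∞) ≤ C := by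
    simp only [ENNReal.coe_le_coe, hC]
    refine ⟨?_, ?_, ?_, ?_⟩ <;> rw [← NNReal.coe_le_coe] <;> push_cast <;>
      linarith [C1.2, C2.2, C3.2, C4.2]
  refine ⟨130 * 16 * C * 16, fun N K P i j M ρ f hρ hP => ?_⟩
  set l := max i j with hl
  set G : ℝ≥0∞ := ENNReal.ofReal (2 ^ (-((1 - ε) * (l : ℕ)))) with hG
  set v₁ : ℤ → ℝ × ℝ := fun k => (2:ℝ) ^ (k - (i + 1 : ℕ)) • ((1:ℝ), (0:ℝ)) with hv₁
  set v₂ : ℤ → ℝ × ℝ := fun n => (2:ℝ) ^ (n - (j + 1 : ℕ)) • ((0:ℝ), (1:ℝ)) with hv₂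
  set Q : ℤ → ℤ → ℕ → Set ℝ := fun n k m => {t | t ∈ P n k ∧ |t - ρ m n k| ≤ 2 / 2 ^ l} with hQ
  have hDm : ∀ n k t, Measurable fun x => ‖Dop b k n t i j f x‖ₑ := fun n k t =>
    (bci _).cont.measurable.enorm
  have hwin : ∀ n k m, ∫⁻ x, (⨆ t ∈ Q n k m, ‖Dop b k n t i j f x‖ₑ) ^ 2
      ≤ 130 * (16 * C * G * n2 (gp (v₁ k) (gp (v₂ n) f) : bciSpace)) := by
    intro n k m
    set u := gapCore (v₁ k) (v₂ n) f with hu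
    set y := (1 - tr (v₂ n)) (gp (v₁ k) u) with hy
    have hun : n2 u ≤ n2 (gp (v₁ k) (gp (v₂ n) f) : bciSpace) := n2_gapCore_le _ _ _
    have hD : ∀ t x, Dop b k n t i j f x
        = (crv b (2 ^ k) (2 ^ n * t) (bx (v₂ n) y) : ℝ × ℝ → ℝ) x := fun t x => by
      unfold Dop
      rw [tentGap_tentGap]
    have hcw : ∀ g : bciSpace, n2 (crv b (2 ^ k) (2 ^ n * ρ m n k) g : bciSpace)
        = n2 (wcrv b 0 (2 ^ k) (2 ^ n * ρ m n k) g) := fun g => by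
      congr 1
      ext x
      exact crv_eq_wcrv _ _ _ _ _
    have hfin : ∀ (c : ℝ≥0) (z : ℝ≥0∞), (c:ℝ≥0∞) ≤ C → z ≤ 16 * n2 u →
        c * G * z ≤ 16 * C * G * n2 (gp (v₁ k) (gp (v₂ n) f) : bciSpace) := by
      intro c z hc hz
      calc (c:ℝ≥0∞) * G * z ≤ C * G * (16 * n2 (gp (v₁ k) (gp (v₂ n) f) : bciSpace)) :=
            mul_le_mul' (mul_le_mul' hc le_rfl) (hz.trans (mul_le_mul' le_rfl hun))
        _ = _ := by ring
    have h44 : ∀ z : ℝ≥0∞, 4 * (4 * z) = 16 * z := fun z => by rw [← mul_assoc]; norm_num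
    have h416 : ∀ z : ℝ≥0∞, 4 * z ≤ 16 * z := fun z => by gcongr; norm_num
    simp_rw [hD]
    refine lintegral_iSup_window_sq_le k n j l (le_max_right _ _) y (hρ m n k)
      (fun t ht => ⟨(hP n k t ht.1).1, ht.2⟩) ?_ fun r hr => ?_
    · rw [hcw]
      rcases le_total i j with hij | hij
      · have hlj : l = j := max_eq_right hij
        have e : bx (v₂ n) y = (1 - tr (v₂ n)) (bx (v₂ n) (gp (v₁ k) u)) := by
          change (bx (v₂ n) * (1 - tr (v₂ n))) (gp (v₁ k) u) = gp (v₂ n) (gp (v₁ k) u)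
          rw [gp_eq (v₂ n)]
        have := h1 k n (ρ m n k) j (bx (v₂ n) (gp (v₁ k) u)) (hρ m n k)
        change n2 (wcrv b 0 (2 ^ k) (2 ^ n * ρ m n k) (bx (v₂ n) y : bciSpace)) ≤ _
        rw [e]
        refine (this.trans (mul_le_mul' (le_of_eq ?_) le_rfl)).trans (hfin C1 _ hCle.1
          ((n2_bx_le _ _).trans ((n2_gp_le _ _).trans (h416 _))))
        rw [hG, hlj]
      · have hli : l = i := max_eq_left hij
        have e : bx (v₂ n) y = (1 - tr (v₁ k)) (bx (v₁ k) (gp (v₂ n) u)) := by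
          have h5 : bx (v₂ n) y = gp (v₁ k) (gp (v₂ n) u) := by
            change _ = (gp (v₁ k) * gp (v₂ n)) u
            rw [(gp_commute (v₁ k) (v₂ n)).eq, gp_eq (v₂ n)]
            rfl
          rw [h5]
          rfl
        have := h3 k n (ρ m n k) i (bx (v₁ k) (gp (v₂ n) u))
        change n2 (wcrv b 0 (2 ^ k) (2 ^ n * ρ m n k) (bx (v₂ n) y : bciSpace)) ≤ _
        rw [e]
        refine (this.trans (mul_le_mul' (le_of_eq ?_) le_rfl)).trans (hfin C3 _ hCle.2.2.1
          ((n2_bx_le _ _).trans ((n2_gp_le _ _).trans (h416 _))))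
        rw [hG, hli]
    · rcases le_total i j with hij | hij
      · have hlj : l = j := max_eq_right hij
        have := h2 k n r j y hr
        refine (this.trans (mul_le_mul' (le_of_eq ?_) le_rfl)).trans (hfin C2 _ hCle.2.1
          ((n2_one_sub_tr_le _ _).trans ((mul_le_mul' le_rfl (n2_gp_le _ _)).trans (h44 _).le)))
        rw [hG, hlj]
      · have hli : l = i := max_eq_left hij
        have e : (1 - tr (v₂ n)) y
            = (1 - tr (v₁ k)) ((1 - tr (v₂ n)) ((1 - tr (v₂ n)) (bx (v₁ k) u))) := by
          have h5 := one_sub_tr_commute (v₂ n) (v₁ k)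
          have h6 : ∀ g : bciSpace, (1 - tr (v₂ n)) ((1 - tr (v₁ k)) g)
              = (1 - tr (v₁ k)) ((1 - tr (v₂ n)) g) := fun g =>
            congrArg (fun T : Module.End ℝ bciSpace => T g) h5.eq
          rw [← h6, ← h6]
          rfl
        have := h4 k n r i ((1 - tr (v₂ n)) ((1 - tr (v₂ n)) (bx (v₁ k) u)))
        change n2 (wcrv b b (2 ^ k) (2 ^ n * r) ((1 - tr (v₂ n)) y : bciSpace)) ≤ _
        rw [e]
        refine (this.trans (mul_le_mul' (le_of_eq ?_) le_rfl)).trans (hfin C4 _ hCle.2.2.2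
          ((n2_one_sub_tr_le _ _).trans (((mul_le_mul' le_rfl ((n2_one_sub_tr_le _ _).trans
            (mul_le_mul' le_rfl (n2_bx_le _ _))))).trans (h44 _).le)))
        rw [hG, hli]
  have hsupm : ∀ n k m, Measurable fun x => (⨆ t ∈ Q n k m, ‖Dop b k n t i j f x‖ₑ) ^ 2 := by
    intro n k m
    have : (Q n k m).Countable := (P n k).finite_toSet.countable.mono fun t ht => ht.1
    exact (Measurable.biSup _ this fun t _ => hDm n k t).pow_const 2
  have hpt : ∀ x, (⨆ n ∈ N, ⨆ k ∈ K, ⨆ t ∈ P n k, ‖Dop b k n t i j f x‖ₑ) ^ 2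
      ≤ ∑ n ∈ N, ∑ k ∈ K, ∑ m ∈ Finset.range M,
        (⨆ t ∈ Q n k m, ‖Dop b k n t i j f x‖ₑ) ^ 2 := by
    intro x
    set S := ∑ n ∈ N, ∑ k ∈ K, ∑ m ∈ Finset.range M,
        (⨆ t ∈ Q n k m, ‖Dop b k n t i j f x‖ₑ) ^ 2 with hS
    have hroot : (⨆ n ∈ N, ⨆ k ∈ K, ⨆ t ∈ P n k, ‖Dop b k n t i j f x‖ₑ) ≤ S ^ (1 / 2 : ℝ) := by
      refine iSup₂_le fun n hn => iSup₂_le fun k hk => iSup₂_le fun t ht => ?_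
      obtain ⟨-, m, hm, htm⟩ := hP n k t ht
      have hsq : ‖Dop b k n t i j f x‖ₑ ^ 2 ≤ S := by
        calc _ ≤ (⨆ t ∈ Q n k m, ‖Dop b k n t i j f x‖ₑ) ^ 2 :=
              pow_le_pow_left₀ zero_le
                (le_iSup₂ (f := fun t (_ : t ∈ Q n k m) => ‖Dop b k n t i j f x‖ₑ) t ⟨ht, htm⟩) 2
          _ ≤ ∑ m ∈ Finset.range M, (⨆ t ∈ Q n k m, ‖Dop b k n t i j f x‖ₑ) ^ 2 :=
              Finset.single_le_sum
                (f := fun m => (⨆ t ∈ Q n k m, ‖Dop b k n t i j f x‖ₑ) ^ 2)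
                (fun _ _ => zero_le) (Finset.mem_range.2 hm)
          _ ≤ ∑ k ∈ K, ∑ m ∈ Finset.range M, (⨆ t ∈ Q n k m, ‖Dop b k n t i j f x‖ₑ) ^ 2 :=
              Finset.single_le_sum (f := fun k => ∑ m ∈ Finset.range M,
                (⨆ t ∈ Q n k m, ‖Dop b k n t i j f x‖ₑ) ^ 2) (fun _ _ => zero_le) hk
          _ ≤ _ := Finset.single_le_sum (f := fun n => ∑ k ∈ K, ∑ m ∈ Finset.range M,
                (⨆ t ∈ Q n k m, ‖Dop b k n t i j f x‖ₑ) ^ 2) (fun _ _ => zero_le) hn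
      calc ‖Dop b k n t i j f x‖ₑ = (‖Dop b k n t i j f x‖ₑ ^ (2:ℝ)) ^ (1 / 2 : ℝ) := by
            rw [← ENNReal.rpow_mul]; norm_num
        _ ≤ _ := ENNReal.rpow_le_rpow (by simpa using hsq) (by norm_num)
    calc _ ≤ (S ^ (1 / 2 : ℝ)) ^ 2 := pow_le_pow_left₀ zero_le hroot 2
      _ = S := by rw [← ENNReal.rpow_natCast, ← ENNReal.rpow_mul]; norm_num
  calc _ ≤ ∫⁻ x, ∑ n ∈ N, ∑ k ∈ K, ∑ m ∈ Finset.range M,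
        (⨆ t ∈ Q n k m, ‖Dop b k n t i j f x‖ₑ) ^ 2 := lintegral_mono hpt
    _ = ∑ n ∈ N, ∑ k ∈ K, ∑ m ∈ Finset.range M,
        ∫⁻ x, (⨆ t ∈ Q n k m, ‖Dop b k n t i j f x‖ₑ) ^ 2 := by
        rw [lintegral_finsetSum _ fun n _ => Finset.measurable_fun_sum _ fun k _ =>
          Finset.measurable_fun_sum _ fun m _ => hsupm n k m]
        refine Finset.sum_congr rfl fun n _ => ?_
        rw [lintegral_finsetSum _ fun k _ => Finset.measurable_fun_sum _ fun m _ => hsupm n k m]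
        refine Finset.sum_congr rfl fun k _ => ?_
        rw [lintegral_finsetSum _ fun m _ => hsupm n k m]
    _ ≤ ∑ n ∈ N, ∑ k ∈ K, ∑ m ∈ Finset.range M,
        130 * (16 * C * G * n2 (gp (v₁ k) (gp (v₂ n) f) : bciSpace)) :=
        Finset.sum_le_sum fun n _ => Finset.sum_le_sum fun k _ => Finset.sum_le_sum fun m _ =>
          hwin n k m
    _ = (130 * 16 * C * G * M) * ∑ n ∈ N, ∑ k ∈ K,
          n2 (gp (v₁ k) (gp (v₂ n) f) : bciSpace) := by
        rw [Finset.mul_sum]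
        refine Finset.sum_congr rfl fun n _ => ?_
        rw [Finset.mul_sum]
        refine Finset.sum_congr rfl fun k _ => ?_
        rw [Finset.sum_const, Finset.card_range, nsmul_eq_mul]
        ring
    _ ≤ (130 * 16 * C * G * M) * (4 * (4 * n2 f)) := by
        refine mul_le_mul' le_rfl ?_
        calc _ ≤ ∑ n ∈ N, 4 * n2 (gp (v₂ n) f : bciSpace) :=
              Finset.sum_le_sum fun n _ => sum_n2_gp_le _ _ _ K
          _ = 4 * ∑ n ∈ N, n2 (gp (v₂ n) f : bciSpace) := (Finset.mul_sum _ _ _).symm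
          _ ≤ _ := mul_le_mul' le_rfl (sum_n2_gp_le _ _ _ N)
    _ = _ := by
        push_cast
        ring

lemma lbox_shift_le_lbox (v : ℝ × ℝ) (f : ℝ × ℝ → ℝ≥0∞) {w₁ w A a : ℝ} (hw1 : 0 < w₁)
    (hw : 0 < w) (h1 : -A ≤ a) (h2 : a + w₁ ≤ w - A) (x : ℝ × ℝ) :
    lbox (w₁ • v) f (x - a • v) ≤ ENNReal.ofReal (w / w₁) * lbox (w • v) f (x + A • v) := by
  have e : ∀ c d y, 0 < c → lbox (c • v) f (y - d • v)
      = ENNReal.ofReal c⁻¹ * ∫⁻ r in Ioc d (c + d), f (y - r • v) := by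
    intro c d y hc
    have := setLIntegral_Ioc_comp_affine hc 0 1 d (fun r => f (y - r • v))
    rw [mul_zero, zero_add, mul_one] at this
    rw [← this]
    unfold lbox
    refine lintegral_congr fun r => ?_
    congr 1
    module
  have e2 : x + A • v = x - (-A) • v := by module
  rw [e2, e _ _ _ hw1, e _ _ _ hw, ← mul_assoc, ← ENNReal.ofReal_mul (by positivity)]
  have e3 : w / w₁ * w⁻¹ = w₁⁻¹ := by field_simp
  rw [e3]
  exact mul_le_mul' le_rfl (lintegral_mono_set (Ioc_subset_Ioc h1 (by linarith)))

lemma measurable_curveSup (b : ℝ) (K : Finset ℤ) (n : ℤ) (v : ℤ → ℝ × ℝ) (ρ θ₁ θ₂ : ℤ → ℝ)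
    {f : ℝ × ℝ → ℝ≥0∞} (hf : Measurable f) : Measurable (curveSup b K n v ρ θ₁ θ₂ f) := by
  unfold curveSup
  exact measurable_biSup_finset K fun k => Measurable.lintegral_prod_right'
    (measurable_curve_integrand (measurable_lbox (v k) hf) b _ _ _ _ _)

lemma crvBox_le {b : ℝ} (hb : 0 ≤ b) (k n : ℤ) {t ρ : ℝ} {i j : ℕ} (h : |t - ρ| ≤ 4 / 2 ^ j)
    {F : ℝ × ℝ → ℝ≥0∞} (hF : Measurable F) (x : ℝ × ℝ) :
    crvBox b k n t i j F x ≤ ENNReal.ofReal ((8 * 2 ^ b + 8) / 4) ^ 2 * ∫⁻ s in Ioc (1:ℝ) 2,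
      lbox ((2:ℝ) ^ (k - i) • (8 * 2 ^ b + 8 : ℝ) • ((1:ℝ), (0:ℝ)))
        (lbox ((2:ℝ) ^ (n - j) • (8 * 2 ^ b + 8 : ℝ) • ((0:ℝ), (1:ℝ))) F)
        (x - ((2:ℝ) ^ k * (s + -(2 / 2 ^ i)), (2:ℝ) ^ n * (ρ * s ^ b + -((4 * 2 ^ b + 2) / 2 ^ j)))) := by
  set w : ℝ := 8 * 2 ^ b + 8 with hw
  have h2b : (0:ℝ) < 2 ^ b := by positivity
  set c : ℝ≥0∞ := ENNReal.ofReal (w / 4) with hc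
  set v : ℝ × ℝ := (2:ℝ) ^ (n - j) • ((0:ℝ), (1:ℝ)) with hv
  set u : ℝ × ℝ := (2:ℝ) ^ (k - i) • ((1:ℝ), (0:ℝ)) with hu
  unfold crvBox
  rw [← lintegral_const_mul' _ _ (by finiteness)]
  refine setLIntegral_mono' measurableSet_Ioc fun s hs => ?_
  simp only [smul_comm _ (4:ℝ), smul_comm _ w, ← hv, ← hu]
  have hsb : s ^ b ≤ 2 ^ b := Real.rpow_le_rpow (by linarith [hs.1]) hs.2 hb
  have hsb0 : 0 < s ^ b := Real.rpow_pos_of_pos (by linarith [hs.1]) b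
  set a : ℝ := 2 ^ j * (t - ρ) * s ^ b - 2 with ha
  have h2j : (0:ℝ) < 2 ^ j := by positivity
  have hab : |2 ^ j * (t - ρ) * s ^ b| ≤ 4 * 2 ^ b := by
    rw [abs_mul, abs_mul, abs_of_pos h2j, abs_of_pos hsb0]
    refine mul_le_mul ?_ hsb hsb0.le (by norm_num)
    calc (2:ℝ) ^ j * |t - ρ| ≤ 2 ^ j * (4 / 2 ^ j) := mul_le_mul_of_nonneg_left h h2j.le
      _ = 4 := by field_simp
  obtain ⟨ha1, ha2⟩ := abs_le.1 hab
  set z : ℝ × ℝ := x - ((2:ℝ) ^ k * (s + -(2 / 2 ^ i)), (2:ℝ) ^ n * (ρ * s ^ b)) with hz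
  have hzj : (2:ℝ) ^ (n - j) = 2 ^ n / 2 ^ j := by rw [zpow_sub₀ (by norm_num), zpow_natCast]
  have e1 : x - ((2:ℝ) ^ k * (s + -(2 / 2 ^ i)), (2:ℝ) ^ n * (t * s ^ b + -(2 / 2 ^ j)))
      = z - a • v := by
    rw [hz, hv, ha, hzj]
    ext <;> simp
    field_simp
    ring
  have e2 : x - ((2:ℝ) ^ k * (s + -(2 / 2 ^ i)), (2:ℝ) ^ n * (ρ * s ^ b
      + -((4 * 2 ^ b + 2) / 2 ^ j))) = z + (4 * 2 ^ b + 2 : ℝ) • v := by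
    rw [hz, hv, hzj]
    ext <;> simp
    field_simp
    ring
  rw [e1, e2]
  have s1 : ∀ G : ℝ × ℝ → ℝ≥0∞, ∀ y, lbox ((4:ℝ) • u) G y ≤ c * lbox (w • u) G y := fun G y => by
    have := lbox_shift_le_lbox u G (w₁ := 4) (w := w) (A := 0) (a := 0) (by norm_num)
      (by positivity) (by norm_num) (by rw [hw]; linarith) y
    simpa using this
  have s2 : ∀ y, lbox ((4:ℝ) • v) F (y + (-a) • v)
      ≤ c * lbox (w • v) F (y + (4 * 2 ^ b + 2 : ℝ) • v) := fun y => by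
    have := lbox_shift_le_lbox v F (w₁ := 4) (w := w) (A := 4 * 2 ^ b + 2) (a := a) (by norm_num)
      (by positivity) (by linarith) (by rw [hw]; linarith) y
    rwa [sub_eq_add_neg, ← neg_smul] at this
  rw [sub_eq_add_neg, ← neg_smul, ← lbox_comp_add]
  have hm := measurable_lbox (w • v) hF
  calc _ ≤ lbox ((4:ℝ) • u) (fun y => c * lbox (w • v) F (y + (4 * 2 ^ b + 2 : ℝ) • v)) z :=
        lbox_mono _ s2 z
    _ = c * lbox ((4:ℝ) • u) (fun y => lbox (w • v) F (y + (4 * 2 ^ b + 2 : ℝ) • v)) z :=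
        lbox_const_mul _ _ (by fun_prop) _
    _ ≤ c * (c * lbox (w • u) (fun y => lbox (w • v) F (y + (4 * 2 ^ b + 2 : ℝ) • v)) z) :=
        mul_le_mul' le_rfl (s1 _ _)
    _ = _ := by rw [lbox_comp_add, ← mul_assoc, sq]

lemma enorm_Dop_le (b : ℝ) (k n : ℤ) (t : ℝ) (i j : ℕ) (f : bciSpace) (x : ℝ × ℝ) :
    ‖Dop b k n t i j f x‖ₑ
      ≤ 16 * crvBox b k n t (i + 1) (j + 1) (fun y => ‖(f : ℝ × ℝ → ℝ) y‖ₑ) x :=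
  enorm_crv_mul_le b k n t (i + 1) (j + 1) (enorm_tentGap_le _) (enorm_tentGap_le _) f x

theorem exists_lintegral_iSup_Dop_rpow_le {b q ε : ℝ} (hb : 1 < b) (hq : 1 < q) (hε : 0 < ε) :
    ∃ C : ℝ≥0, ∀ (N K : Finset ℤ) (P : ℤ → ℤ → Finset ℝ) (i j M : ℕ) (ρ : ℕ → ℤ → ℤ → ℝ)
      (f : bciSpace), (∀ m n k, ρ m n k ∈ Icc (1:ℝ) 4) →
      (∀ n k, ∀ t ∈ P n k, t ∈ Icc (1:ℝ) 4 ∧ ∃ m < M, |t - ρ m n k| ≤ 2 / 2 ^ max i j) →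
      ∫⁻ x, (⨆ n ∈ N, ⨆ k ∈ K, ⨆ t ∈ P n k, ‖Dop b k n t i j f x‖ₑ) ^ q
        ≤ C * M * ENNReal.ofReal (2 ^ (ε * (i + j))) * ∫⁻ x, ‖(f : ℝ × ℝ → ℝ) x‖ₑ ^ q := by
  set w : ℝ := 8 * 2 ^ b + 8 with hw
  have hw0 : 0 < w := by positivity
  set A : ℝ := 4 * 2 ^ b + 2 with hA
  have hA2 : 2 ≤ A := by rw [hA]; linarith [Real.rpow_pos_of_pos (zero_lt_two) b]
  obtain ⟨C, h⟩ := exists_lacunary_maximal (A := A) hq hε hw0 hb.le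
  set c : ℝ≥0 := (16 * Real.toNNReal (w / 4) ^ 2) ^ q with hc
  refine ⟨c * C * Real.toNNReal (2 ^ (2 * ε)), fun N K P i j M ρ f hρ hP => ?_⟩
  set F : ℝ × ℝ → ℝ≥0∞ := fun y => ‖(f : ℝ × ℝ → ℝ) y‖ₑ with hF
  have hFm : Measurable F := (bci f).cont.measurable.enorm
  set I := i + 1 with hI
  set J := j + 1 with hJ
  set S : ℕ → ℝ × ℝ → ℝ≥0∞ := fun m x => ⨆ n ∈ N, curveSup b K n
    (fun k => (2:ℝ) ^ (k - I) • w • ((1:ℝ), (0:ℝ))) (ρ m n) (fun _ => -(2 / 2 ^ I))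
    (fun _ => -(A / 2 ^ J)) (lbox ((2:ℝ) ^ (n - J) • w • ((0:ℝ), (1:ℝ))) F) x with hS
  have hSm : ∀ m, Measurable (S m) := fun m =>
    measurable_biSup_finset N fun n => measurable_curveSup _ _ _ _ _ _ _ (measurable_lbox _ hFm)
  have hpow1 : ∀ m : ℕ, (1:ℝ) ≤ 2 ^ m := fun m => one_le_pow₀ (by norm_num)
  have hSi : ∀ m, ∫⁻ x, S m x ^ q
      ≤ C * ENNReal.ofReal (2 ^ (ε * I)) * ENNReal.ofReal (2 ^ (ε * J)) * ∫⁻ x, F x ^ q := by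
    intro m
    refine h N K (ρ m) (fun _ _ => -(2 / 2 ^ I)) (fun _ _ => -(A / 2 ^ J)) I J F hFm (hρ m) ?_ ?_
    · intro n k
      rw [abs_neg, abs_of_nonneg (by positivity)]
      exact (div_le_self (by norm_num) (hpow1 I)).trans hA2
    · intro n k
      rw [abs_neg, abs_of_nonneg (by positivity)]
      exact div_le_self (by positivity) (hpow1 J)
  have hpt : ∀ x, (⨆ n ∈ N, ⨆ k ∈ K, ⨆ t ∈ P n k, ‖Dop b k n t i j f x‖ₑ) ^ q
      ≤ ∑ m ∈ Finset.range M, c * S m x ^ q := by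
    intro x
    have hq0 : 0 < q := by linarith
    rw [← ENNReal.le_rpow_inv_iff hq0]
    refine iSup₂_le fun n hn => iSup₂_le fun k hk => iSup₂_le fun t ht => ?_
    obtain ⟨-, m, hm, htm⟩ := hP n k t ht
    rw [ENNReal.le_rpow_inv_iff hq0]
    have h4 : |t - ρ m n k| ≤ 4 / 2 ^ J := by
      refine htm.trans ?_
      rw [hJ, pow_succ, div_le_div_iff₀ (by positivity) (by positivity)]
      have : (2:ℝ) ^ j ≤ 2 ^ max i j := pow_le_pow_right₀ (by norm_num) (le_max_right _ _)
      linarith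
    have h5 : ‖Dop b k n t i j f x‖ₑ ≤ (16 * ENNReal.ofReal (w / 4) ^ 2) * S m x := by
      refine (enorm_Dop_le b k n t i j f x).trans ?_
      rw [mul_assoc]
      refine mul_le_mul' le_rfl ((crvBox_le (by linarith) k n h4 hFm x).trans
        (mul_le_mul' le_rfl ?_))
      refine le_trans ?_ (le_iSup₂ (f := fun n (_ : n ∈ N) => curveSup b K n
        (fun k => (2:ℝ) ^ (k - I) • w • ((1:ℝ), (0:ℝ))) (ρ m n) (fun _ => -(2 / 2 ^ I))
        (fun _ => -(A / 2 ^ J)) (lbox ((2:ℝ) ^ (n - J) • w • ((0:ℝ), (1:ℝ))) F) x) n hn)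
      unfold curveSup
      exact le_iSup₂ (f := fun k (_ : k ∈ K) => ∫⁻ s in Ioc (1:ℝ) 2,
        lbox ((2:ℝ) ^ (k - I) • w • ((1:ℝ), (0:ℝ)))
        (lbox ((2:ℝ) ^ (n - J) • w • ((0:ℝ), (1:ℝ))) F) (x - ((2:ℝ) ^ k * (s + -(2 / 2 ^ I)),
          (2:ℝ) ^ n * (ρ m n k * s ^ b + -(A / 2 ^ J))))) k hk
    have hce : (16 * ENNReal.ofReal (w / 4) ^ 2) ^ q = (c : ℝ≥0∞) := by
      rw [hc, ENNReal.coe_rpow_of_nonneg _ hq0.le, ENNReal.ofReal.eq_1]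
      push_cast
      rfl
    calc ‖Dop b k n t i j f x‖ₑ ^ q ≤ ((16 * ENNReal.ofReal (w / 4) ^ 2) * S m x) ^ q :=
          ENNReal.rpow_le_rpow h5 hq0.le
      _ = c * S m x ^ q := by rw [ENNReal.mul_rpow_of_nonneg _ _ hq0.le, hce]
      _ ≤ _ := Finset.single_le_sum (f := fun m => c * S m x ^ q) (fun _ _ => zero_le)
          (Finset.mem_range.2 hm)
  have hexp : ENNReal.ofReal (2 ^ (ε * I)) * ENNReal.ofReal (2 ^ (ε * J))
      = (Real.toNNReal (2 ^ (2 * ε)) : ℝ≥0) * ENNReal.ofReal (2 ^ (ε * (i + j))) := by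
    rw [← ENNReal.ofReal.eq_1, ← ENNReal.ofReal_mul (by positivity),
      ← ENNReal.ofReal_mul (by positivity), ← Real.rpow_add (by norm_num),
      ← Real.rpow_add (by norm_num), hI, hJ]
    congr 2
    push_cast
    ring
  calc _ ≤ ∫⁻ x, ∑ m ∈ Finset.range M, c * S m x ^ q := lintegral_mono hpt
    _ = ∑ m ∈ Finset.range M, c * ∫⁻ x, S m x ^ q := by
        rw [lintegral_finsetSum _ fun m _ => ((hSm m).pow_const q).const_mul _]
        refine Finset.sum_congr rfl fun m _ => lintegral_const_mul _ ((hSm m).pow_const q)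
    _ ≤ ∑ m ∈ Finset.range M, c * (C * ENNReal.ofReal (2 ^ (ε * I))
          * ENNReal.ofReal (2 ^ (ε * J)) * ∫⁻ x, F x ^ q) :=
        Finset.sum_le_sum fun m _ => mul_le_mul' le_rfl (hSi m)
    _ = _ := by
        rw [Finset.sum_const, Finset.card_range, nsmul_eq_mul, mul_assoc (C:ℝ≥0∞), hexp]
        push_cast
        ring

lemma lintegral_Ioi_rpow {T s : ℝ} (hT : 0 < T) (hs : 0 < s) :
    ∫⁻ l in Ioi T, ENNReal.ofReal (l ^ (-s - 1)) = ENNReal.ofReal (T ^ (-s) / s) := by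
  rw [← ofReal_integral_eq_lintegral_ofReal (integrableOn_Ioi_rpow_of_lt (by linarith) hT),
    integral_Ioi_rpow_of_lt (by linarith) hT]
  · congr 1
    rw [sub_add_cancel, div_neg, neg_div, neg_neg]
  · exact (ae_restrict_iff' measurableSet_Ioi).2 (Eventually.of_forall fun l hl =>
      Real.rpow_nonneg (hT.trans hl).le _)

lemma lintegral_large_part_le {p q : ℝ} (hq : 0 < q) (hqp : q < p) {c a : ℝ} (hc : 0 < c)
    (ha : 0 ≤ a) : ∫⁻ l in Ioi (0:ℝ), ENNReal.ofReal (l ^ (p - q - 1))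
        * ENNReal.ofReal (max (a - c * l) 0) ^ q
      ≤ ENNReal.ofReal (1 / (p - q)) * ENNReal.ofReal (c ^ (q - p)) * ENNReal.ofReal a ^ p := by
  have h := layer_cake_scalar (s := p - q) (by linarith) (ENNReal.ofReal (a / c))
  calc _ ≤ ∫⁻ l in Ioi (0:ℝ), (if ENNReal.ofReal l < ENNReal.ofReal (a / c)
          then ENNReal.ofReal (l ^ (p - q - 1)) else 0) * ENNReal.ofReal a ^ q := by
        refine setLIntegral_mono' measurableSet_Ioi fun l hl => ?_
        have hl : 0 < l := hl
        split_ifs with h1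
        · refine mul_le_mul' le_rfl (ENNReal.rpow_le_rpow (ENNReal.ofReal_le_ofReal ?_) hq.le)
          exact max_le (by nlinarith) ha
        · rw [ENNReal.ofReal_lt_ofReal_iff_of_nonneg hl.le, lt_div_iff₀ hc, not_lt] at h1
          rw [max_eq_right (by linarith), ENNReal.ofReal_zero, ENNReal.zero_rpow_of_pos hq, mul_zero]
          exact zero_le
    _ = ENNReal.ofReal (1 / (p - q)) * ENNReal.ofReal (a / c) ^ (p - q) * ENNReal.ofReal a ^ q := by
        rw [lintegral_mul_const', h]
        exact ENNReal.rpow_ne_top_of_nonneg hq.le ENNReal.ofReal_ne_top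
    _ = _ := by
        rw [ENNReal.ofReal_rpow_of_nonneg (by positivity) (by linarith),
          ENNReal.ofReal_rpow_of_nonneg ha hq.le, ENNReal.ofReal_rpow_of_nonneg ha (by linarith),
          ← ENNReal.ofReal_mul (by have := sub_pos.2 hqp; positivity),
          ← ENNReal.ofReal_mul (by have := sub_pos.2 hqp; positivity),
          ← ENNReal.ofReal_mul (by have := sub_pos.2 hqp; positivity),
          ← ENNReal.ofReal_mul (by have := sub_pos.2 hqp; positivity)]
        congr 1
        rw [Real.div_rpow ha hc.le, show q - p = -(p - q) by ring, Real.rpow_neg hc.le,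
          show p = (p - q) + q by ring, Real.rpow_add_of_nonneg ha (by linarith) hq.le]
        ring_nf

lemma lintegral_small_part_le {p : ℝ} (hp : 1 < p) (hp2 : p < 2) {c a : ℝ} (hc : 0 < c)
    (ha : 0 ≤ a) : ∫⁻ l in Ioi (0:ℝ), ENNReal.ofReal (l ^ (p - 3))
        * ENNReal.ofReal (min a (c * l)) ^ 2
      ≤ ENNReal.ofReal (1 / p + 1 / (2 - p)) * ENNReal.ofReal (c ^ (2 - p))
        * ENNReal.ofReal a ^ p := by
  rcases ha.eq_or_lt with rfl | ha
  · refine le_of_eq_of_le ?_ zero_le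
    rw [← lintegral_zero]
    refine setLIntegral_congr_fun measurableSet_Ioi fun l hl => ?_
    have hl : 0 < l := hl
    rw [min_eq_left (by positivity)]
    simp
  set T := a / c with hT
  have hT0 : 0 < T := by positivity
  have hac : a = T * c := by rw [hT]; field_simp
  rw [← Ioo_union_Ici_eq_Ioi hT0]
  refine (lintegral_union_le _ _ _).trans ?_
  have h1 : ∫⁻ l in Ioo 0 T, ENNReal.ofReal (l ^ (p - 3)) * ENNReal.ofReal (min a (c * l)) ^ 2
      ≤ ENNReal.ofReal (c ^ 2 * (T ^ p / p)) := by
    rw [ENNReal.ofReal_mul (by positivity), ← lintegral_rpow_Ioo (by linarith) hT0.le,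
      ← lintegral_const_mul' _ _ ENNReal.ofReal_ne_top]
    refine setLIntegral_mono' measurableSet_Ioo fun l hl => ?_
    have hl0 := hl.1
    rw [← ENNReal.ofReal_pow (by positivity), ← ENNReal.ofReal_mul (by positivity),
      ← ENNReal.ofReal_mul (by positivity)]
    refine ENNReal.ofReal_le_ofReal ?_
    calc l ^ (p - 3) * min a (c * l) ^ 2 ≤ l ^ (p - 3) * (c * l) ^ 2 := by
          gcongr
          exact min_le_right _ _
      _ = c ^ 2 * (l ^ (p - 3) * l ^ (2:ℝ)) := by norm_cast; ring
      _ = _ := by rw [← Real.rpow_add hl0]; ring_nf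
  have h2 : ∫⁻ l in Ici T, ENNReal.ofReal (l ^ (p - 3)) * ENNReal.ofReal (min a (c * l)) ^ 2
      ≤ ENNReal.ofReal (a ^ 2 * (T ^ (-(2 - p)) / (2 - p))) := by
    rw [setLIntegral_congr Ioi_ae_eq_Ici.symm, ENNReal.ofReal_mul (by positivity),
      ← lintegral_Ioi_rpow hT0 (by linarith), ← lintegral_const_mul' _ _ ENNReal.ofReal_ne_top]
    refine setLIntegral_mono' measurableSet_Ioi fun l hl => ?_
    have hl0 : 0 < l := hT0.trans hl
    rw [← ENNReal.ofReal_pow (by positivity), ← ENNReal.ofReal_mul (by positivity),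
      ← ENNReal.ofReal_mul (by positivity)]
    refine ENNReal.ofReal_le_ofReal ?_
    calc l ^ (p - 3) * min a (c * l) ^ 2 ≤ l ^ (p - 3) * a ^ 2 := by
          gcongr
          exact min_le_left _ _
      _ = _ := by ring_nf
  refine (add_le_add h1 h2).trans (le_of_eq ?_)
  have hp2' : 0 < 2 - p := by linarith
  rw [ENNReal.ofReal_rpow_of_nonneg ha.le (by linarith), ← ENNReal.ofReal_mul (by positivity),
    ← ENNReal.ofReal_mul (by positivity), ← ENNReal.ofReal_add (by positivity) (by positivity)]
  congr 1
  rw [hac, Real.mul_rpow hT0.le hc.le, Real.rpow_neg hT0.le, Real.rpow_sub hT0, Real.rpow_sub hc]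
  norm_cast
  field_simp

lemma BCI.min_const {f : ℝ × ℝ → ℝ} (hf : BCI f) (h0 : ∀ x, 0 ≤ f x) {a : ℝ} (ha : 0 ≤ a) :
    BCI fun x => min (f x) a := by
  have hb : ∀ x, |min (f x) a| ≤ |f x| := fun x => by
    rw [abs_of_nonneg (le_min (h0 x) ha), abs_of_nonneg (h0 x)]
    exact min_le_left _ _
  have hc : Continuous fun x => min (f x) a := hf.cont.min continuous_const
  obtain ⟨C, hC⟩ := hf.bdd
  exact ⟨hc, hf.int.mono hc.aestronglyMeasurable (Eventually.of_forall hb), C,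
    fun x => (hb x).trans (hC x)⟩

lemma measure_lt_le_lintegral_rpow {α : Type*} [MeasurableSpace α] (μ : Measure α) {q l : ℝ}
    (hq : 0 < q) (hl : 0 < l) {f : α → ℝ≥0∞} (hf : Measurable f) :
    μ {x | ENNReal.ofReal l < f x} ≤ ENNReal.ofReal (l ^ (-q)) * ∫⁻ x, f x ^ q ∂μ := by
  have h := mul_meas_ge_le_lintegral (μ := μ) (hf.pow_const q) (ENNReal.ofReal (l ^ q))
  have h1 : {x | ENNReal.ofReal l < f x} ⊆ {x | ENNReal.ofReal (l ^ q) ≤ f x ^ q} := by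
    intro x hx
    change ENNReal.ofReal (l ^ q) ≤ f x ^ q
    rw [← ENNReal.ofReal_rpow_of_pos hl]
    exact ENNReal.rpow_le_rpow (le_of_lt hx) hq.le
  have h2 : ENNReal.ofReal (l ^ (-q)) * ENNReal.ofReal (l ^ q) = 1 := by
    rw [← ENNReal.ofReal_mul (by positivity), ← Real.rpow_add hl]
    simp
  calc μ {x | ENNReal.ofReal l < f x}
      = ENNReal.ofReal (l ^ (-q)) * (ENNReal.ofReal (l ^ q) * μ {x | ENNReal.ofReal l < f x}) := by
        rw [← mul_assoc, h2, one_mul]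
    _ ≤ _ := mul_le_mul' le_rfl ((mul_le_mul' le_rfl (measure_mono h1)).trans h)

theorem exists_interpolation_le {p q : ℝ} (hq : 1 < q) (hqp : q < p) (hp2 : p ≤ 2) :
    ∃ C : ℝ≥0, ∀ (T : bciSpace → ℝ × ℝ → ℝ≥0∞) (A B : ℝ≥0∞) (c : ℝ), 0 < c →
      A ≠ ∞ → B ≠ ∞ →
      (∀ f, Measurable (T f)) → (∀ f g x, T (f + g) x ≤ T f x + T g x) →
      (∀ f, ∫⁻ x, T f x ^ q ≤ A * ∫⁻ x, ‖(f : ℝ × ℝ → ℝ) x‖ₑ ^ q) →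
      (∀ f, ∫⁻ x, T f x ^ 2 ≤ B * ∫⁻ x, ‖(f : ℝ × ℝ → ℝ) x‖ₑ ^ 2) →
      ∀ f : bciSpace, (∀ x, 0 ≤ (f : ℝ × ℝ → ℝ) x) →
        ∫⁻ x, T f x ^ p ≤ C * (A * ENNReal.ofReal (c ^ (q - p)) + B * ENNReal.ofReal (c ^ (2 - p)))
          * ∫⁻ x, ‖(f : ℝ × ℝ → ℝ) x‖ₑ ^ p := by
  rcases hp2.eq_or_lt with rfl | hp2
  · refine ⟨1, fun T A B c hc _ _ _ _ _ hB f _ => ?_⟩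
    have := hB f
    simp only [sub_self, Real.rpow_zero, ENNReal.ofReal_one, mul_one, ENNReal.coe_one, one_mul,
      ENNReal.rpow_ofNat]
    exact this.trans (mul_le_mul' le_add_self le_rfl)
  have hp0 : 0 < p := by linarith
  refine ⟨Real.toNNReal p * 4 * (Real.toNNReal (1 / (p - q)) + Real.toNNReal (1 / p + 1 / (2 - p))),
    fun T A B c hc hA' hB' hm hadd hA hB f h0 => ?_⟩
  have hfm := (bci f).cont.measurable
  set F : ℝ × ℝ → ℝ := (f : ℝ × ℝ → ℝ) with hF
  have hfe : ∀ x, ‖F x‖ₑ = ENNReal.ofReal (F x) := fun x => Real.enorm_of_nonneg (h0 x)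
  simp only [hfe]
  set X := ∫⁻ x, ENNReal.ofReal (F x) ^ p with hX
  have hlevel : ∀ l ∈ Ioi (0:ℝ), ENNReal.ofReal (l ^ (p - 1)) * volume {x | ENNReal.ofReal l < T f x}
      ≤ 4 * A * (∫⁻ x, ENNReal.ofReal (l ^ (p - q - 1)) * ENNReal.ofReal (max (F x - c * l) 0) ^ q)
        + 4 * B * ∫⁻ x, ENNReal.ofReal (l ^ (p - 3)) * ENNReal.ofReal (min (F x) (c * l)) ^ 2 := by
    intro l hl
    have hl : 0 < l := hl
    set h : bciSpace := ⟨fun x => min (F x) (c * l), (bci f).min_const h0 (by positivity)⟩ with hh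
    set g : bciSpace := f - h with hg
    have hgx : ∀ x, (g : ℝ × ℝ → ℝ) x = max (F x - c * l) 0 := fun x => by
      change F x - min (F x) (c * l) = _
      rcases le_total (F x) (c * l) with h1 | h1
      · rw [min_eq_left h1, max_eq_right (by linarith), sub_self]
      · rw [min_eq_right h1, max_eq_left (by linarith)]
    have hsub : {x | ENNReal.ofReal l < T f x} ⊆ {x | ENNReal.ofReal (l / 2) < T g x}
        ∪ {x | ENNReal.ofReal (l / 2) < T h x} := by
      intro x hx
      by_contra hcon
      simp only [mem_union, mem_ofPred_eq, not_or, not_lt] at hcon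
      have h1 : T f x ≤ T g x + T h x := by
        have := hadd g h x
        rwa [hg, sub_add_cancel] at this
      have h2 := h1.trans (add_le_add hcon.1 hcon.2)
      rw [← ENNReal.ofReal_add (by positivity) (by positivity), add_halves] at h2
      exact absurd hx (not_lt.2 h2)
    have h1 : volume {x | ENNReal.ofReal (l / 2) < T g x} ≤ ENNReal.ofReal ((l / 2) ^ (-q))
        * (A * ∫⁻ x, ENNReal.ofReal (max (F x - c * l) 0) ^ q) := by
      refine (measure_lt_le_lintegral_rpow volume (q := q) (by linarith) (by positivity)
        (hm g)).trans (mul_le_mul' le_rfl ((hA g).trans (le_of_eq ?_)))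
      congr 1
      refine lintegral_congr fun x => ?_
      rw [hgx, Real.enorm_of_nonneg (le_max_right _ _)]
    have h2 : volume {x | ENNReal.ofReal (l / 2) < T h x} ≤ ENNReal.ofReal ((l / 2) ^ (-2:ℝ))
        * (B * ∫⁻ x, ENNReal.ofReal (min (F x) (c * l)) ^ 2) := by
      have h3 := hB h
      refine (measure_lt_le_lintegral_rpow volume (q := 2) (by norm_num) (by positivity)
        (hm h)).trans (mul_le_mul' le_rfl ?_)
      simp only [ENNReal.rpow_ofNat]
      refine h3.trans (le_of_eq ?_)
      congr 1
      refine lintegral_congr fun x => ?_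
      change ‖min (F x) (c * l)‖ₑ ^ 2 = _
      rw [Real.enorm_of_nonneg (le_min (h0 x) (by positivity))]
    have e1 : ENNReal.ofReal (l ^ (p - 1)) * ENNReal.ofReal ((l / 2) ^ (-q))
        ≤ 4 * ENNReal.ofReal (l ^ (p - q - 1)) := by
      rw [← ENNReal.ofReal_mul (by positivity), ← ENNReal.ofReal_ofNat 4,
        ← ENNReal.ofReal_mul (by norm_num)]
      refine ENNReal.ofReal_le_ofReal ?_
      rw [Real.div_rpow hl.le (by norm_num), Real.rpow_neg (by norm_num : (0:ℝ) ≤ 2), div_inv_eq_mul,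
        ← mul_assoc, ← Real.rpow_add hl, mul_comm, show p - 1 + -q = p - q - 1 by ring]
      refine mul_le_mul_of_nonneg_right ?_ (by positivity)
      calc (2:ℝ) ^ q ≤ 2 ^ (2:ℝ) := Real.rpow_le_rpow_of_exponent_le (by norm_num) (by linarith)
        _ = 4 := by norm_num
    have e2 : ENNReal.ofReal (l ^ (p - 1)) * ENNReal.ofReal ((l / 2) ^ (-2:ℝ))
        ≤ 4 * ENNReal.ofReal (l ^ (p - 3)) := by
      rw [← ENNReal.ofReal_mul (by positivity), ← ENNReal.ofReal_ofNat 4,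
        ← ENNReal.ofReal_mul (by norm_num)]
      refine ENNReal.ofReal_le_ofReal ?_
      rw [Real.div_rpow hl.le (by norm_num), Real.rpow_neg (by norm_num : (0:ℝ) ≤ 2), div_inv_eq_mul,
        ← mul_assoc, ← Real.rpow_add hl, mul_comm, show p - 1 + -2 = p - 3 by ring]
      refine mul_le_mul_of_nonneg_right ?_ (by positivity)
      norm_num
    rw [lintegral_const_mul' _ _ ENNReal.ofReal_ne_top,
      lintegral_const_mul' _ _ ENNReal.ofReal_ne_top]
    calc _ ≤ ENNReal.ofReal (l ^ (p - 1)) * (_ + _) := mul_le_mul' le_rfl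
          ((measure_mono hsub).trans ((measure_union_le _ _).trans (add_le_add h1 h2)))
      _ = (ENNReal.ofReal (l ^ (p - 1)) * ENNReal.ofReal ((l / 2) ^ (-q)))
            * (A * ∫⁻ x, ENNReal.ofReal (max (F x - c * l) 0) ^ q)
          + (ENNReal.ofReal (l ^ (p - 1)) * ENNReal.ofReal ((l / 2) ^ (-2:ℝ)))
            * (B * ∫⁻ x, ENNReal.ofReal (min (F x) (c * l)) ^ 2) := by ring
      _ ≤ _ := add_le_add (mul_le_mul' e1 le_rfl) (mul_le_mul' e2 le_rfl)
      _ = _ := by ring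
  have hswap1 : (∫⁻ l in Ioi (0:ℝ), ∫⁻ x, ENNReal.ofReal (l ^ (p - q - 1))
      * ENNReal.ofReal (max (F x - c * l) 0) ^ q)
      ≤ ENNReal.ofReal (1 / (p - q)) * ENNReal.ofReal (c ^ (q - p)) * X := by
    rw [lintegral_lintegral_swap, hX, ← lintegral_const_mul' _ _ (by finiteness)]
    · exact lintegral_mono fun x => lintegral_large_part_le (by linarith) hqp hc (h0 x)
    · have hm1 : Measurable fun z : ℝ × (ℝ × ℝ) => z.1 ^ (p - q - 1) := measurable_fst.pow_const _
      have hm2 : Measurable fun z : ℝ × (ℝ × ℝ) => ENNReal.ofReal (max (F z.2 - c * z.1) 0) := by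
        fun_prop
      exact (hm1.ennreal_ofReal.mul (hm2.pow_const q)).aemeasurable
  have hswap2 : (∫⁻ l in Ioi (0:ℝ), ∫⁻ x, ENNReal.ofReal (l ^ (p - 3))
      * ENNReal.ofReal (min (F x) (c * l)) ^ 2)
      ≤ ENNReal.ofReal (1 / p + 1 / (2 - p)) * ENNReal.ofReal (c ^ (2 - p)) * X := by
    rw [lintegral_lintegral_swap, hX, ← lintegral_const_mul' _ _ (by finiteness)]
    · exact lintegral_mono fun x => lintegral_small_part_le (by linarith) hp2 hc (h0 x)
    · have hm1 : Measurable fun z : ℝ × (ℝ × ℝ) => z.1 ^ (p - 3) := measurable_fst.pow_const _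
      have hm2 : Measurable fun z : ℝ × (ℝ × ℝ) => ENNReal.ofReal (min (F z.2) (c * z.1)) := by
        fun_prop
      exact (hm1.ennreal_ofReal.mul (hm2.pow_const 2)).aemeasurable
  have hmm : Measurable fun l : ℝ => 4 * A * ∫⁻ x, ENNReal.ofReal (l ^ (p - q - 1))
      * ENNReal.ofReal (max (F x - c * l) 0) ^ q := by
    have hm1 : Measurable fun z : ℝ × (ℝ × ℝ) => z.1 ^ (p - q - 1) := measurable_fst.pow_const _
    have hm2 : Measurable fun z : ℝ × (ℝ × ℝ) => ENNReal.ofReal (max (F z.2 - c * z.1) 0) := by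
      fun_prop
    exact (Measurable.lintegral_prod_right' (hm1.ennreal_ofReal.mul (hm2.pow_const q))).const_mul _
  rw [lintegral_rpow_layer_cake volume hp0 (hm f)]
  set a₁ := ENNReal.ofReal (1 / (p - q)) with ha₁
  set a₂ := ENNReal.ofReal (1 / p + 1 / (2 - p)) with ha₂
  set Y := A * ENNReal.ofReal (c ^ (q - p)) with hY
  set Z := B * ENNReal.ofReal (c ^ (2 - p)) with hZ
  calc _ ≤ ENNReal.ofReal p * (4 * A * (a₁ * ENNReal.ofReal (c ^ (q - p)) * X)
          + 4 * B * (a₂ * ENNReal.ofReal (c ^ (2 - p)) * X)) := by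
        refine mul_le_mul' le_rfl ((setLIntegral_mono' measurableSet_Ioi hlevel).trans ?_)
        rw [lintegral_add_left hmm, lintegral_const_mul' _ _ (by finiteness),
          lintegral_const_mul' _ _ (by finiteness)]
        exact add_le_add (mul_le_mul' le_rfl hswap1) (mul_le_mul' le_rfl hswap2)
    _ = ENNReal.ofReal p * 4 * (a₁ * Y + a₂ * Z) * X := by rw [hY, hZ]; ring
    _ ≤ ENNReal.ofReal p * 4 * ((a₁ + a₂) * (Y + Z)) * X := by
        refine mul_le_mul' (mul_le_mul' le_rfl ?_) le_rfl
        rw [mul_add]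
        exact add_le_add (mul_le_mul' le_self_add le_rfl) (mul_le_mul' le_add_self le_rfl)
    _ = _ := by
        push_cast
        rw [ha₁, ha₂]
        simp only [ENNReal.ofReal]
        ring

lemma tsum_pow_add_ne_top {r : ℝ≥0∞} (hr : r < 1) : ∑' z : ℕ × ℕ, r ^ (z.1 + z.2) ≠ ∞ := by
  rw [ENNReal.tsum_prod (f := fun i j => r ^ (i + j))]
  simp only [pow_add, ENNReal.tsum_mul_left, ENNReal.tsum_mul_right, ENNReal.tsum_geometric]
  have h : (1 - r)⁻¹ ≠ ∞ := ENNReal.inv_ne_top.2 (tsub_pos_of_lt hr).ne'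
  exact ENNReal.mul_ne_top h h

lemma tsum_rpow_le {ι : Type*} [Countable ι] {p : ℝ} (hp : 1 < p) (hp2 : p ≤ 2) {w : ι → ℝ≥0∞}
    (hw0 : ∀ z, w z ≠ 0) (hw1 : ∀ z, w z ≤ 1) (a : ι → ℝ≥0∞) :
    (∑' z, a z) ^ p ≤ (∑' z, w z) ^ (p - 1) * ∑' z, (w z)⁻¹ * a z ^ p := by
  let _ : MeasurableSpace ι := ⊤
  have hwt : ∀ z, w z ≠ ∞ := fun z => ((hw1 z).trans_lt ENNReal.one_lt_top).ne
  have hm : ∀ g : ι → ℝ≥0∞, Measurable g := fun g => measurable_from_top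
  have h := lintegral_rpow_le_measure_mul (Measure.count.withDensity w) hp
    (hm fun z => a z / w z).aemeasurable
  simp only [lintegral_withDensity_eq_lintegral_mul _ (hm w) (hm _), lintegral_count,
    Pi.mul_apply, withDensity_apply _ MeasurableSet.univ, Measure.restrict_univ] at h
  have e1 : ∀ z, w z * (a z / w z) = a z := fun z => ENNReal.mul_div_cancel (hw0 z) (hwt z)
  simp only [e1] at h
  refine h.trans (mul_le_mul' le_rfl (ENNReal.tsum_le_tsum fun z => ?_))
  rw [div_eq_mul_inv, ENNReal.mul_rpow_of_nonneg _ _ (by linarith), ENNReal.inv_rpow,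
    ← ENNReal.rpow_neg, mul_comm (a z ^ p), ← mul_assoc]
  refine mul_le_mul' ?_ le_rfl
  nth_rw 1 [← ENNReal.rpow_one (w z)]
  rw [← ENNReal.rpow_add _ _ (hw0 z) (hwt z), ← ENNReal.rpow_neg_one]
  exact ENNReal.rpow_le_rpow_of_exponent_ge (hw1 z) (by linarith)

lemma exists_lintegral_tsum_rpow_le {p : ℝ} (hp : 1 < p) (hp2 : p ≤ 2) {r : ℝ≥0∞} (hr0 : r ≠ 0)
    (hr : r < 1) : ∃ W : ℝ≥0, ∀ (a : ℕ × ℕ → ℝ × ℝ → ℝ≥0∞) (X : ℝ≥0∞),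
      (∀ z, Measurable (a z)) → (∀ z, ∫⁻ x, a z x ^ p ≤ (r ^ (z.1 + z.2)) ^ 2 * X) →
      ∫⁻ x, (∑' z, a z x) ^ p ≤ W * X := by
  set W := ∑' z : ℕ × ℕ, r ^ (z.1 + z.2) with hW
  have hWt : W ≠ ∞ := tsum_pow_add_ne_top hr
  have hWt' : W ^ (p - 1) * W ≠ ∞ :=
    ENNReal.mul_ne_top (ENNReal.rpow_ne_top_of_nonneg (by linarith) hWt) hWt
  refine ⟨(W ^ (p - 1) * W).toNNReal, fun a X ha h => ?_⟩
  rw [ENNReal.coe_toNNReal hWt']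
  have hw0 : ∀ z : ℕ × ℕ, r ^ (z.1 + z.2) ≠ 0 := fun z => pow_ne_zero _ hr0
  have hw1 : ∀ z : ℕ × ℕ, r ^ (z.1 + z.2) ≤ 1 := fun z => pow_le_one₀ zero_le hr.le
  have hwt : ∀ z : ℕ × ℕ, r ^ (z.1 + z.2) ≠ ∞ := fun z =>
    ((hw1 z).trans_lt ENNReal.one_lt_top).ne
  calc _ ≤ ∫⁻ x, W ^ (p - 1) * ∑' z : ℕ × ℕ, (r ^ (z.1 + z.2))⁻¹ * a z x ^ p :=
        lintegral_mono fun x => tsum_rpow_le hp hp2 hw0 hw1 _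
    _ = W ^ (p - 1) * ∑' z : ℕ × ℕ, (r ^ (z.1 + z.2))⁻¹ * ∫⁻ x, a z x ^ p := by
        rw [lintegral_const_mul' _ _ (ENNReal.rpow_ne_top_of_nonneg (by linarith) hWt),
          lintegral_tsum fun z => (((ha z).pow_const p).const_mul _).aemeasurable]
        congr 1
        refine tsum_congr fun z => lintegral_const_mul _ ((ha z).pow_const p)
    _ ≤ W ^ (p - 1) * ∑' z : ℕ × ℕ, r ^ (z.1 + z.2) * X := by
        refine mul_le_mul' le_rfl (ENNReal.tsum_le_tsum fun z => ?_)
        refine (mul_le_mul' le_rfl (h z)).trans (le_of_eq ?_)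
        rw [sq, ← mul_assoc, ← mul_assoc, ENNReal.inv_mul_cancel (hw0 z) (hwt z), one_mul]
    _ = _ := by rw [ENNReal.tsum_mul_right, mul_assoc]

lemma Dop_add (b : ℝ) (k n : ℤ) (t : ℝ) (i j : ℕ) (f g : bciSpace) (x : ℝ × ℝ) :
    Dop b k n t i j (f + g) x = Dop b k n t i j f x + Dop b k n t i j g x := by
  unfold Dop
  rw [map_add, map_add, map_add]
  rfl

/-- The maximal function of the two-parameter pieces over a finite set of parameters. -/
def DopSup (b : ℝ) (N K : Finset ℤ) (P : ℤ → ℤ → Finset ℝ) (i j : ℕ) (f : bciSpace)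
    (x : ℝ × ℝ) : ℝ≥0∞ :=
  ⨆ n ∈ N, ⨆ k ∈ K, ⨆ t ∈ P n k, ‖Dop b k n t i j f x‖ₑ

lemma measurable_DopSup (b : ℝ) (N K : Finset ℤ) (P : ℤ → ℤ → Finset ℝ) (i j : ℕ)
    (f : bciSpace) : Measurable (DopSup b N K P i j f) := by
  unfold DopSup
  refine measurable_biSup_finset N fun n => measurable_biSup_finset K fun k => ?_
  exact Measurable.biSup _ (P n k).countable_toSet fun t _ => (bci _).cont.measurable.enorm

lemma le_DopSup {b : ℝ} {N K : Finset ℤ} {P : ℤ → ℤ → Finset ℝ} {n k : ℤ} {t : ℝ} (hn : n ∈ N)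
    (hk : k ∈ K) (ht : t ∈ P n k) (i j : ℕ) (f : bciSpace) (x : ℝ × ℝ) :
    ‖Dop b k n t i j f x‖ₑ ≤ DopSup b N K P i j f x :=
  ((le_iSup₂ (f := fun t (_ : t ∈ P n k) => ‖Dop b k n t i j f x‖ₑ) t ht).trans
    (le_iSup₂ (f := fun k (_ : k ∈ K) => ⨆ t ∈ P n k, ‖Dop b k n t i j f x‖ₑ) k hk)).trans
    (le_iSup₂ (f := fun n (_ : n ∈ N) => ⨆ k ∈ K, ⨆ t ∈ P n k, ‖Dop b k n t i j f x‖ₑ) n hn)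

lemma DopSup_add_le (b : ℝ) (N K : Finset ℤ) (P : ℤ → ℤ → Finset ℝ) (i j : ℕ)
    (f g : bciSpace) (x : ℝ × ℝ) :
    DopSup b N K P i j (f + g) x ≤ DopSup b N K P i j f x + DopSup b N K P i j g x := by
  refine iSup₂_le fun n hn => iSup₂_le fun k hk => iSup₂_le fun t ht => ?_
  rw [Dop_add]
  exact (enorm_add_le _ _).trans (add_le_add (le_DopSup hn hk ht i j f x)
    (le_DopSup hn hk ht i j g x))

/-- At every dyadic scale `2⁻ˡ` the sets `P n k` are covered by `D * 2 ^ (d * l)` intervals. -/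
def CoveredBy (d D : ℝ) (P : ℤ → ℤ → Set ℝ) : Prop :=
  ∀ l : ℕ, ∃ M : ℕ, (M : ℝ) ≤ D * 2 ^ (d * l) ∧ ∃ ρ : ℕ → ℤ → ℤ → ℝ,
    (∀ m n k, ρ m n k ∈ Icc (1:ℝ) 4) ∧ ∀ n k, ∀ t ∈ P n k, ∃ m < M, |t - ρ m n k| ≤ 2 / 2 ^ l

theorem exists_lintegral_DopSup_rpow_le {b p d D : ℝ} (hb : 1 < b) (hp2 : p ≤ 2) (hd0 : 0 ≤ d)
    (hd : d < p - 1) (hD : 0 ≤ D) : ∃ r : ℝ≥0∞, r ≠ 0 ∧ r < 1 ∧ ∃ C : ℝ≥0,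
      ∀ (N K : Finset ℤ) (P : ℤ → ℤ → Finset ℝ) (f : bciSpace),
      (∀ x, 0 ≤ (f : ℝ × ℝ → ℝ) x) → (∀ n k, ∀ t ∈ P n k, t ∈ Icc (1:ℝ) 4) →
      CoveredBy d D (fun n k => P n k) → ∀ i j : ℕ, ∫⁻ x, DopSup b N K P i j f x ^ p
        ≤ (r ^ (i + j)) ^ 2 * (C * ∫⁻ x, ‖(f : ℝ × ℝ → ℝ) x‖ₑ ^ p) := by
  set κ := p - 1 - d with hκ
  have hκ0 : 0 < κ := by rw [hκ]; linarith
  have hκ1 : κ ≤ 1 := by rw [hκ]; linarith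
  obtain ⟨C1, h1⟩ := exists_lintegral_iSup_Dop_rpow_le (q := 1 + κ / 4) (ε := κ / 8) hb
    (by linarith) (by linarith)
  obtain ⟨C2, h2⟩ := exists_lintegral_iSup_Dop_sq_le (ε := κ / 8) hb (by linarith) (by linarith)
  obtain ⟨C3, h3⟩ := exists_interpolation_le (p := p) (q := 1 + κ / 4) (by linarith)
    (by linarith) hp2
  have hr1 : (2:ℝ) ^ (-(κ / 8)) < 1 :=
    Real.rpow_lt_one_of_one_lt_of_neg (by norm_num) (by linarith)
  refine ⟨ENNReal.ofReal (2 ^ (-(κ / 8))), ?_, ?_, C3 * (C1 + C2) * D.toNNReal, ?_⟩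
  · exact (ENNReal.ofReal_pos.2 (by positivity)).ne'
  · exact ENNReal.ofReal_lt_one.2 hr1
  intro N K P f h0 hP hcov i j
  set l := max i j with hl
  obtain ⟨M, hM, ρ, hρ, hPρ⟩ := hcov l
  have hlr : (i:ℝ) + j ≤ 2 * l := by
    have e1 : (i:ℝ) ≤ l := by exact_mod_cast le_max_left i j
    have e2 : (j:ℝ) ≤ l := by exact_mod_cast le_max_right i j
    linarith
  have hl0 : (0:ℝ) ≤ l := Nat.cast_nonneg _
  have hP' : ∀ n k, ∀ t ∈ P n k, t ∈ Icc (1:ℝ) 4 ∧ ∃ m < M, |t - ρ m n k| ≤ 2 / 2 ^ max i j :=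
    fun n k t ht => ⟨hP n k t ht, hPρ n k t ht⟩
  have hMe : (M:ℝ≥0∞) ≤ D.toNNReal * ENNReal.ofReal (2 ^ (d * l)) := by
    rw [← ENNReal.ofReal.eq_1, ← ENNReal.ofReal_mul hD, ← ENNReal.ofReal_natCast]
    exact ENNReal.ofReal_le_ofReal hM
  set Y : ℝ≥0∞ := (ENNReal.ofReal (2 ^ (-(κ / 8))) ^ (i + j)) ^ 2 with hY
  have hYle : ∀ s : ℝ, s ≤ -(κ / 2) * l → ENNReal.ofReal (2 ^ s) ≤ Y := by
    intro s hs
    rw [hY, ← pow_mul, ← ENNReal.ofReal_pow (by positivity), ← Real.rpow_natCast, ← Real.rpow_mul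
      (by norm_num)]
    refine ENNReal.ofReal_le_ofReal (Real.rpow_le_rpow_of_exponent_le (by norm_num) (hs.trans ?_))
    push_cast
    nlinarith
  have key := h3 (DopSup b N K P i j) (C1 * M * ENNReal.ofReal (2 ^ (κ / 8 * (i + j))))
    (C2 * M * ENNReal.ofReal (2 ^ (-((1 - κ / 8) * (max i j : ℕ))))) (2 ^ (l:ℝ)) (by positivity)
    (by finiteness) (by finiteness) (measurable_DopSup _ _ _ _ _ _) (DopSup_add_le _ _ _ _ _ _)
    (fun f => h1 N K P i j M ρ f hρ hP') (fun f => h2 N K P i j M ρ f hρ hP') f h0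
  refine key.trans ?_
  rw [← mul_assoc]
  refine mul_le_mul' ?_ le_rfl
  rw [← hl, ← Real.rpow_mul (by norm_num), ← Real.rpow_mul (by norm_num)]
  have hmain : ∀ (c : ℝ≥0∞) (s t : ℝ), d * l + s + t ≤ -(κ / 2) * l →
      c * M * ENNReal.ofReal (2 ^ s) * ENNReal.ofReal (2 ^ t) ≤ c * (D.toNNReal * Y) := by
    intro c s t h
    calc _ ≤ c * (D.toNNReal * ENNReal.ofReal (2 ^ (d * l))) * ENNReal.ofReal (2 ^ s)
          * ENNReal.ofReal (2 ^ t) :=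
          mul_le_mul' (mul_le_mul' (mul_le_mul' le_rfl hMe) le_rfl) le_rfl
      _ = c * (D.toNNReal * ENNReal.ofReal (2 ^ (d * l + s + t))) := by
          rw [Real.rpow_add (by norm_num), Real.rpow_add (by norm_num),
            ENNReal.ofReal_mul (by positivity), ENNReal.ofReal_mul (by positivity)]
          ring
      _ ≤ _ := mul_le_mul' le_rfl (mul_le_mul' le_rfl (hYle _ h))
  calc _ ≤ (C3:ℝ≥0∞) * (C1 * (D.toNNReal * Y) + C2 * (D.toNNReal * Y)) := by
        refine mul_le_mul' le_rfl (add_le_add (hmain _ _ _ ?_) (hmain _ _ _ ?_))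
        · nlinarith
        · nlinarith
    _ = _ := by
        push_cast
        ring

theorem exists_lintegral_iSup_crv_rpow_le {b p d D : ℝ} (hb : 1 < b) (hp : 1 < p) (hp2 : p ≤ 2)
    (hd0 : 0 ≤ d) (hd : d < p - 1) (hD : 0 ≤ D) : ∃ C : ℝ≥0,
      ∀ (N K : Finset ℤ) (P : ℤ → ℤ → Finset ℝ) (f : bciSpace),
      UniformContinuous (f : ℝ × ℝ → ℝ) →
      (∀ x, 0 ≤ (f : ℝ × ℝ → ℝ) x) → (∀ n k, ∀ t ∈ P n k, t ∈ Icc (1:ℝ) 4) →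
      CoveredBy d D (fun n k => P n k) →
      ∫⁻ x, (⨆ n ∈ N, ⨆ k ∈ K, ⨆ t ∈ P n k, ‖(crv b (2 ^ k) (2 ^ n * t) f : ℝ × ℝ → ℝ) x‖ₑ) ^ p
        ≤ C * ∫⁻ x, ‖(f : ℝ × ℝ → ℝ) x‖ₑ ^ p := by
  have hp0 : 0 ≤ p := by linarith
  obtain ⟨r, hr0, hr1, C1, h1⟩ := exists_lintegral_DopSup_rpow_le hb hp2 hd0 hd hD
  obtain ⟨W, hW⟩ := exists_lintegral_tsum_rpow_le hp hp2 hr0 hr1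
  obtain ⟨C2, h2⟩ := exists_enorm_crv_le hb.le
  obtain ⟨C4, h4⟩ := exists_lintegral_dmax_fst_rpow_le hp
  obtain ⟨C5, h5⟩ := exists_lintegral_dmax_snd_rpow_le hp
  refine ⟨4 * (C2 ^ p * (C5 * C4) + C2 ^ p * (C4 * C5) + W * C1), fun N K P f hf h0 hP hcov => ?_⟩
  set F : ℝ × ℝ → ℝ≥0∞ := fun y => ‖(f : ℝ × ℝ → ℝ) y‖ₑ with hF
  have hFm : Measurable F := (bci f).cont.measurable.enorm
  set a : ℕ × ℕ → ℝ × ℝ → ℝ≥0∞ := fun z => DopSup b N K P z.1 z.2 f with ha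
  have ham : ∀ z, Measurable (a z) := fun z => measurable_DopSup _ _ _ _ _ _ _
  set G₁ := dmax (0, 1) (dmax (1, 0) F) with hG₁
  set G₂ := dmax (1, 0) (dmax (0, 1) F) with hG₂
  have hG₁m : Measurable G₁ := measurable_dmax _ (measurable_dmax _ hFm)
  have hG₂m : Measurable G₂ := measurable_dmax _ (measurable_dmax _ hFm)
  have hadd : ∀ u v : ℝ≥0∞, (u + v) ^ p ≤ 2 * (u ^ p + v ^ p) := fun u v => by
    refine (ENNReal.rpow_add_le_mul_rpow_add_rpow u v hp.le).trans (mul_le_mul' ?_ le_rfl)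
    calc (2:ℝ≥0∞) ^ (p - 1) ≤ 2 ^ (1:ℝ) :=
          ENNReal.rpow_le_rpow_of_exponent_le (by norm_num) (by linarith)
      _ = 2 := ENNReal.rpow_one 2
  have hpt : ∀ x, (⨆ n ∈ N, ⨆ k ∈ K, ⨆ t ∈ P n k,
      ‖(crv b (2 ^ k) (2 ^ n * t) f : ℝ × ℝ → ℝ) x‖ₑ) ^ p
      ≤ 4 * (C2 ^ p * G₁ x ^ p + C2 ^ p * G₂ x ^ p + (∑' z, a z x) ^ p) := by
    intro x
    have hle : (⨆ n ∈ N, ⨆ k ∈ K, ⨆ t ∈ P n k,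
        ‖(crv b (2 ^ k) (2 ^ n * t) f : ℝ × ℝ → ℝ) x‖ₑ) ≤ C2 * G₁ x + C2 * G₂ x + ∑' z, a z x := by
      refine iSup₂_le fun n hn => iSup₂_le fun k hk => iSup₂_le fun t ht => ?_
      exact (h2 k n t f (hP n k t ht) hf x).trans (add_le_add le_rfl
        (ENNReal.tsum_le_tsum fun z => le_DopSup hn hk ht _ _ f x))
    refine (ENNReal.rpow_le_rpow hle hp0).trans ((hadd _ _).trans ?_)
    have h2' : (∑' z, a z x) ^ p ≤ 2 * (∑' z, a z x) ^ p := by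
      rw [two_mul]
      exact le_self_add
    calc _ ≤ 2 * (2 * ((C2 * G₁ x) ^ p + (C2 * G₂ x) ^ p) + 2 * (∑' z, a z x) ^ p) :=
          mul_le_mul' le_rfl (add_le_add (hadd _ _) h2')
      _ = _ := by
          rw [ENNReal.mul_rpow_of_nonneg _ _ hp0, ENNReal.mul_rpow_of_nonneg _ _ hp0]
          ring
  have hC2 : ((C2:ℝ≥0∞) ^ p) ≠ ∞ := ENNReal.rpow_ne_top_of_nonneg hp0 ENNReal.coe_ne_top
  have hG₁i : ∫⁻ x, G₁ x ^ p ≤ C5 * (C4 * ∫⁻ x, F x ^ p) :=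
    (h5 _ (measurable_dmax _ hFm)).trans (mul_le_mul' le_rfl (h4 _ hFm))
  have hG₂i : ∫⁻ x, G₂ x ^ p ≤ C4 * (C5 * ∫⁻ x, F x ^ p) :=
    (h4 _ (measurable_dmax _ hFm)).trans (mul_le_mul' le_rfl (h5 _ hFm))
  have hai := hW a (C1 * ∫⁻ x, F x ^ p) ham fun z => h1 N K P f h0 hP hcov z.1 z.2
  calc _ ≤ ∫⁻ x, 4 * (C2 ^ p * G₁ x ^ p + C2 ^ p * G₂ x ^ p + (∑' z, a z x) ^ p) :=
        lintegral_mono hpt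
    _ = 4 * (C2 ^ p * ∫⁻ x, G₁ x ^ p) + 4 * (C2 ^ p * ∫⁻ x, G₂ x ^ p)
          + 4 * ∫⁻ x, (∑' z, a z x) ^ p := by
        have hm1 : Measurable fun x => (C2:ℝ≥0∞) ^ p * G₁ x ^ p := (hG₁m.pow_const p).const_mul _
        have hm2 : Measurable fun x => (C2:ℝ≥0∞) ^ p * G₂ x ^ p := (hG₂m.pow_const p).const_mul _
        have hm3 : Measurable fun x => (C2:ℝ≥0∞) ^ p * G₁ x ^ p + (C2:ℝ≥0∞) ^ p * G₂ x ^ p :=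
          hm1.add hm2
        rw [lintegral_const_mul' _ _ (by finiteness), lintegral_add_left hm3,
          lintegral_add_left hm1, lintegral_const_mul' _ _ hC2, lintegral_const_mul' _ _ hC2]
        ring
    _ ≤ 4 * (C2 ^ p * (C5 * (C4 * ∫⁻ x, F x ^ p))) + 4 * (C2 ^ p * (C4 * (C5 * ∫⁻ x, F x ^ p)))
          + 4 * (W * (C1 * ∫⁻ x, F x ^ p)) :=
        add_le_add (add_le_add (mul_le_mul' le_rfl (mul_le_mul' le_rfl hG₁i))
          (mul_le_mul' le_rfl (mul_le_mul' le_rfl hG₂i))) (mul_le_mul' le_rfl hai)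
    _ = _ := by
        push_cast
        rw [ENNReal.coe_rpow_of_nonneg _ hp0]
        ring

lemma UrSet_subset_biUnion (U : Set ℝ) (r : ℝ) {δ : ℝ} (hδ : 0 < δ) :
    UrSet U r ⊆ ⋃ a ∈ (Finset.range (⌈δ⁻¹⌉₊ + 1)).image (fun k : ℕ => 1 + k * δ), Icc a (a + δ) := by
  rintro t ⟨⟨h1, h2⟩, -⟩
  have h0 : 0 ≤ (t - 1) / δ := div_nonneg (by linarith) hδ.le
  have hk := Nat.floor_le h0
  have hk' := Nat.lt_floor_add_one ((t - 1) / δ)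
  rw [le_div_iff₀ hδ] at hk
  rw [div_lt_iff₀ hδ] at hk'
  refine mem_biUnion (x := 1 + (⌊(t - 1) / δ⌋₊ : ℝ) * δ) ?_ ⟨by linarith, by linarith⟩
  refine Finset.mem_coe.2 (Finset.mem_image_of_mem _ (Finset.mem_range.2 (Nat.lt_succ_of_le ?_)))
  refine (Nat.floor_le_floor ?_).trans (Nat.floor_le_ceil _)
  rw [div_le_iff₀ hδ, inv_mul_cancel₀ hδ.ne']
  linarith

lemma covN_spec (U : Set ℝ) (r : ℝ) {δ : ℝ} (hδ : 0 < δ) :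
    ∃ F : Finset ℝ, F.card = covN (UrSet U r) δ ∧ UrSet U r ⊆ ⋃ a ∈ F, Icc a (a + δ) :=
  Nat.sInf_mem (s := {n : ℕ | ∃ F : Finset ℝ, F.card = n ∧ UrSet U r ⊆ ⋃ a ∈ F, Icc a (a + δ)})
    ⟨_, _, rfl, UrSet_subset_biUnion U r hδ⟩

lemma covN_le (U : Set ℝ) (r : ℝ) {δ : ℝ} (hδ : 0 < δ) : (covN (UrSet U r) δ : ℝ) ≤ δ⁻¹ + 2 := by
  have h : covN (UrSet U r) δ ≤ ⌈δ⁻¹⌉₊ + 1 := by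
    refine (Nat.sInf_le (s := {n : ℕ | ∃ F : Finset ℝ, F.card = n ∧
      UrSet U r ⊆ ⋃ a ∈ F, Icc a (a + δ)}) ⟨_, rfl, UrSet_subset_biUnion U r hδ⟩).trans ?_
    exact Finset.card_image_le.trans (Finset.card_range _).le
  have h' : (covN (UrSet U r) δ : ℝ) ≤ (⌈δ⁻¹⌉₊ : ℝ) + 1 := by exact_mod_cast h
  have := Nat.ceil_lt_add_one (inv_nonneg.2 hδ.le)
  linarith

lemma log_covN_le (U : Set ℝ) (r : ℝ) {δ : ℝ} (hδ : 0 < δ) :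
    Real.log (covN (UrSet U r) δ) ≤ Real.log (δ⁻¹ + 2) := by
  have hδ' := inv_pos.2 hδ
  rcases Nat.eq_zero_or_pos (covN (UrSet U r) δ) with h | h
  · rw [h, Nat.cast_zero, Real.log_zero]
    exact Real.log_nonneg (by linarith)
  · exact Real.log_le_log (by exact_mod_cast h) (covN_le U r hδ)

lemma bddAbove_log_covN (U : Set ℝ) {δ : ℝ} (hδ : 0 < δ) :
    BddAbove (range fun r : {r : ℝ // 0 < r} => Real.log (covN (UrSet U (r : ℝ)) δ)) :=
  ⟨_, forall_mem_range.2 fun r => log_covN_le U r hδ⟩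

lemma exists_covN_le {U : Set ℝ} {p : ℝ} (hp : 1 < p) (h : pcr U < p) :
    ∃ d D : ℝ, 0 ≤ d ∧ d < p - 1 ∧ 0 ≤ D ∧ ∀ (l : ℕ) (r : ℝ), 0 < r →
      (covN (UrSet U r) ((2:ℝ) ^ l)⁻¹ : ℝ) ≤ D * 2 ^ (d * l) := by
  unfold pcr at h
  set g := fun δ : ℝ =>
      (⨆ r : {r : ℝ // 0 < r}, Real.log (covN (UrSet U (r : ℝ)) δ)) / Real.log δ⁻¹ with hg
  obtain ⟨d, hd1, hd2⟩ := exists_between (show max 0 (limsup g (𝓝[>] (0:ℝ))) < p - 1 from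
    max_lt (by linarith) (by linarith))
  have hd0 : 0 ≤ d := (le_max_left _ _).trans hd1.le
  have hne : Nonempty {r : ℝ // 0 < r} := ⟨⟨1, one_pos⟩⟩
  have hbd : IsBoundedUnder (· ≤ ·) (𝓝[>] (0:ℝ)) g := by
    refine ⟨2, ?_⟩
    rw [eventually_map]
    filter_upwards [Ioo_mem_nhdsGT (show (0:ℝ) < 1 / 2 by norm_num)] with δ hδ
    have h2 : 2 < δ⁻¹ := by
      rw [lt_inv_comm₀ two_pos hδ.1]
      simpa using hδ.2
    have hl : 0 < Real.log δ⁻¹ := Real.log_pos (by linarith)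
    rw [hg]
    simp only
    rw [div_le_iff₀ hl]
    refine ciSup_le fun r => (log_covN_le U r hδ.1).trans ?_
    rw [show 2 * Real.log δ⁻¹ = Real.log (δ⁻¹ ^ 2) by rw [Real.log_pow]; norm_num]
    exact Real.log_le_log (by linarith) (by nlinarith)
  have hev := eventually_lt_of_limsup_lt ((le_max_right _ _).trans_lt hd1) hbd
  have ht : Tendsto (fun l : ℕ => ((2:ℝ) ^ l)⁻¹) atTop (𝓝[>] 0) := by
    refine tendsto_nhdsWithin_iff.2 ⟨?_, Eventually.of_forall fun l => by simp⟩
    exact tendsto_inv_atTop_zero.comp (tendsto_pow_atTop_atTop_of_one_lt one_lt_two)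
  obtain ⟨L, hL⟩ := eventually_atTop.1 ((ht.eventually hev).and (eventually_ge_atTop 1))
  refine ⟨d, 2 ^ L + 3, hd0, hd2, by positivity, fun l r hr => ?_⟩
  have hpos : (0:ℝ) < ((2:ℝ) ^ l)⁻¹ := by positivity
  have hone : (1:ℝ) ≤ 2 ^ (d * l) := Real.one_le_rpow one_le_two (by positivity)
  have h2L : (0:ℝ) < 2 ^ L := by positivity
  rcases le_or_gt L l with hl | hl
  · obtain ⟨h1, h2⟩ := hL l hl
    rcases Nat.eq_zero_or_pos (covN (UrSet U r) ((2:ℝ) ^ l)⁻¹) with hc | hc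
    · rw [hc, Nat.cast_zero]
      positivity
    have hc' : (0:ℝ) < covN (UrSet U r) ((2:ℝ) ^ l)⁻¹ := by exact_mod_cast hc
    have hlog : 0 < Real.log (((2:ℝ) ^ l)⁻¹)⁻¹ := by
      rw [inv_inv]
      exact Real.log_pos (one_lt_pow₀ one_lt_two (by omega))
    rw [hg] at h1
    simp only at h1
    rw [div_lt_iff₀ hlog] at h1
    have h3 := (le_ciSup (bddAbove_log_covN U hpos) ⟨r, hr⟩).trans h1.le
    have h4 : (covN (UrSet U r) ((2:ℝ) ^ l)⁻¹ : ℝ) ≤ 2 ^ (d * l) := by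
      rw [← Real.log_le_log_iff hc' (by positivity), Real.log_rpow two_pos]
      refine h3.trans (le_of_eq ?_)
      rw [inv_inv, Real.log_pow]
      ring
    nlinarith
  · refine (covN_le U r hpos).trans ?_
    rw [inv_inv]
    have : (2:ℝ) ^ l ≤ 2 ^ L := pow_le_pow_right₀ one_le_two hl.le
    nlinarith

/-- The dilation parameters in `[1, 4]` that `U` contributes at the frequency scale `n` and the
curve scale `k`. -/
def dilations (b : ℝ) (U : Set ℝ) (n k : ℤ) : Set ℝ :=
  {t | ∃ u ∈ U, Int.log 2 u + ⌊k * b⌋ = n ∧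
    t = u / 2 ^ Int.log 2 u * (2:ℝ) ^ Int.fract (k * b)}

lemma div_zpow_log_mem_Icc {u : ℝ} (hu : 0 < u) : u / (2:ℝ) ^ Int.log 2 u ∈ Icc (1:ℝ) 2 := by
  have h1 := Int.zpow_log_le_self (b := 2) one_lt_two hu
  have h2 := Int.lt_zpow_succ_log_self (R := ℝ) (b := 2) one_lt_two u
  push_cast at h1 h2
  have hp : (0:ℝ) < 2 ^ Int.log 2 u := by positivity
  rw [zpow_add_one₀ two_ne_zero] at h2
  constructor
  · rwa [le_div_iff₀ hp, one_mul]
  · rw [div_le_iff₀ hp]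
    linarith

lemma two_rpow_fract_mem_Icc (x : ℝ) : (2:ℝ) ^ Int.fract x ∈ Icc (1:ℝ) 2 := by
  refine ⟨Real.one_le_rpow one_le_two (Int.fract_nonneg x), ?_⟩
  exact (Real.rpow_le_rpow_of_exponent_le one_le_two (Int.fract_lt_one x).le).trans
    (Real.rpow_one 2).le

lemma dilations_subset_Icc {U : Set ℝ} (hU : U ⊆ Ioi 0) (b : ℝ) (n k : ℤ) :
    dilations b U n k ⊆ Icc 1 4 := by
  rintro t ⟨u, hu, -, rfl⟩
  have h1 := div_zpow_log_mem_Icc (hU hu)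
  have h2 := two_rpow_fract_mem_Icc (k * b)
  exact ⟨by nlinarith [h1.1, h2.1], by nlinarith [h1.1, h2.1, h1.2, h2.2]⟩

lemma exists_enumeration {F : Finset ℝ} {M : ℕ} (h : F.card ≤ M) :
    ∃ g : ℕ → ℝ, ∀ a ∈ F, ∃ m < M, g m = a := by
  refine ⟨fun m => if hm : m < F.card then F.equivFin.symm ⟨m, hm⟩ else 0, fun a ha => ?_⟩
  refine ⟨F.equivFin ⟨a, ha⟩, (F.equivFin ⟨a, ha⟩).2.trans_le h, ?_⟩
  simp

lemma abs_sub_clamp_le {t x : ℝ} (ht : t ∈ Icc (1:ℝ) 4) : |t - max 1 (min 4 x)| ≤ |t - x| := by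
  obtain ⟨h1, h4⟩ := ht
  rcases le_total 4 x with h | h
  · rw [min_eq_left h, max_eq_right (by norm_num), abs_of_nonpos (by linarith),
      abs_of_nonpos (by linarith)]
    linarith
  · rw [min_eq_right h]
    rcases le_total 1 x with h' | h'
    · rw [max_eq_right h']
    · rw [max_eq_left h', abs_of_nonneg (by linarith), abs_of_nonneg (by linarith)]
      linarith

lemma coveredBy_dilations {U : Set ℝ} (hU : U ⊆ Ioi 0) {d D : ℝ} (b : ℝ) (hD : 0 ≤ D)
    (h : ∀ (l : ℕ) (r : ℝ), 0 < r →
      (covN (UrSet U r) ((2:ℝ) ^ l)⁻¹ : ℝ) ≤ D * 2 ^ (d * l)) :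
    CoveredBy d D (dilations b U) := by
  intro l
  have hpos : (0:ℝ) < ((2:ℝ) ^ l)⁻¹ := by positivity
  refine ⟨⌊D * 2 ^ (d * l)⌋₊, Nat.floor_le (by positivity), ?_⟩
  have hg : ∀ n k : ℤ, ∃ g : ℕ → ℝ, ∀ t ∈ UrSet U (2 ^ (n - ⌊k * b⌋)),
      ∃ m < ⌊D * 2 ^ (d * l)⌋₊, t ∈ Icc (g m) (g m + ((2:ℝ) ^ l)⁻¹) := by
    intro n k
    obtain ⟨F, hF, hc⟩ := covN_spec U (2 ^ (n - ⌊k * b⌋)) hpos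
    obtain ⟨g, hg⟩ := exists_enumeration
      (hF.le.trans (Nat.le_floor (h l (2 ^ (n - ⌊k * b⌋)) (by positivity))))
    refine ⟨g, fun t ht => ?_⟩
    obtain ⟨a, ha, hta⟩ := mem_iUnion₂.1 (hc ht)
    obtain ⟨m, hm, rfl⟩ := hg a ha
    exact ⟨m, hm, hta⟩
  choose g hg using hg
  refine ⟨fun m n k => max 1 (min 4 (g n k m * 2 ^ Int.fract (k * b))), fun m n k =>
    ⟨le_max_left _ _, max_le (by norm_num) (min_le_left _ _)⟩, ?_⟩
  intro n k t ht
  have ht' := dilations_subset_Icc hU b n k ht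
  obtain ⟨u, hu, rfl, rfl⟩ := ht
  have hmem : u / 2 ^ Int.log 2 u ∈ UrSet U (2 ^ (Int.log 2 u + ⌊k * b⌋ - ⌊k * b⌋)) := by
    refine ⟨div_zpow_log_mem_Icc (hU hu), ?_⟩
    rw [add_sub_cancel_right, mul_div_cancel₀ _ (by positivity)]
    exact hu
  obtain ⟨m, hm, h1, h2⟩ := hg _ k _ hmem
  refine ⟨m, hm, (abs_sub_clamp_le ht').trans ?_⟩
  have hs := two_rpow_fract_mem_Icc (k * b)
  rw [← sub_mul, abs_mul, abs_of_nonneg (by linarith), abs_of_nonneg (by linarith [hs.1]),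
    div_eq_mul_inv (2:ℝ) (2 ^ l), mul_comm (2:ℝ)]
  exact mul_le_mul (by linarith) hs.2 (by linarith [hs.1]) hpos.le

lemma CoveredBy.mono {d D : ℝ} {P Q : ℤ → ℤ → Set ℝ} (h : CoveredBy d D P)
    (hQ : ∀ n k, Q n k ⊆ P n k) : CoveredBy d D Q := by
  intro l
  obtain ⟨M, hM, ρ, h1, h2⟩ := h l
  exact ⟨M, hM, ρ, h1, fun n k t ht => h2 n k t (hQ n k ht)⟩

lemma integral_Ioc_two_mul {G : ℝ → ℝ} (k : ℤ) :
    ∫ t in ((2:ℝ) ^ k)..(2 ^ (k + 1)), G t = 2 ^ k * ∫ s in Ioc (1:ℝ) 2, G (2 ^ k * s) := by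
  have h := intervalIntegral.integral_comp_mul_left (a := 1) (b := 2) G
    (show (2:ℝ) ^ k ≠ 0 by positivity)
  rw [intervalIntegral.integral_of_le one_le_two, mul_one, smul_eq_mul] at h
  rw [h, ← mul_assoc, mul_inv_cancel₀ (by positivity), one_mul, zpow_add_one₀ two_ne_zero]

lemma average_le_of_dyadic {G : ℝ → ℝ} (hG : Measurable G) (hG0 : ∀ t, 0 ≤ G t) {C : ℝ}
    (hC : ∀ t, G t ≤ C) {S : ℝ} (h : ∀ k : ℤ, ∫ s in Ioc (1:ℝ) 2, G (2 ^ k * s) ≤ S) {R : ℝ}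
    (hR : 0 < R) : R⁻¹ * ∫ t in (0:ℝ)..R, G t ≤ 2 * S := by
  have hintg : ∀ a b : ℝ, IntervalIntegrable G volume a b := fun a b =>
    (intervalIntegrable_const (c := C)).mono_fun' hG.aestronglyMeasurable
      (Eventually.of_forall fun t => (Real.norm_of_nonneg (hG0 t)).le.trans (hC t))
  have hstep : ∀ k : ℤ, (∫ t in (0:ℝ)..(2 ^ (k + 1)), G t) - 2 ^ (k + 1) * S ≤
      (∫ t in (0:ℝ)..(2 ^ k), G t) - 2 ^ k * S := by
    intro k
    have h1 := intervalIntegral.integral_add_adjacent_intervals (hintg 0 (2 ^ k))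
      (hintg (2 ^ k) (2 ^ (k + 1)))
    rw [integral_Ioc_two_mul] at h1
    have h2 := mul_le_mul_of_nonneg_left (h k) (show (0:ℝ) ≤ 2 ^ k by positivity)
    rw [zpow_add_one₀ two_ne_zero] at h1 ⊢
    linarith
  have hS : 0 ≤ S := (setIntegral_nonneg measurableSet_Ioc fun s _ => hG0 _).trans (h 0)
  have hdesc : ∀ (k : ℤ) (j : ℕ), (∫ t in (0:ℝ)..(2 ^ k), G t) - 2 ^ k * S ≤
      (∫ t in (0:ℝ)..(2 ^ (k - j)), G t) - 2 ^ (k - j) * S := by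
    intro k j
    induction j with
    | zero => simp
    | succ j ih =>
      have h3 := hstep (k - (j + 1))
      rw [show k - (j + 1 : ℤ) + 1 = k - j by ring] at h3
      push_cast
      exact ih.trans h3
  have hsmall : ∀ a : ℝ, 0 ≤ a → ∫ t in (0:ℝ)..a, G t ≤ a * C := by
    intro a ha
    refine (intervalIntegral.integral_mono_on ha (hintg 0 a) intervalIntegrable_const
      fun t _ => hC t).trans (le_of_eq ?_)
    simp
  have hk : ∀ k : ℤ, ∫ t in (0:ℝ)..(2 ^ k), G t ≤ 2 ^ k * S := by
    intro k
    have ht : Tendsto (fun j : ℕ => (2:ℝ) ^ k * C * (1 / 2) ^ j) atTop (𝓝 0) := by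
      have := (tendsto_pow_atTop_nhds_zero_of_lt_one (r := (1 / 2 : ℝ)) (by norm_num)
        (by norm_num)).const_mul ((2:ℝ) ^ k * C)
      rwa [mul_zero] at this
    refine sub_nonpos.1 (ge_of_tendsto' ht fun j => (hdesc k j).trans ?_)
    have h4 := hsmall (2 ^ (k - j)) (by positivity)
    have h5 : (0:ℝ) ≤ 2 ^ (k - j) * S := by positivity
    rw [zpow_sub₀ two_ne_zero, zpow_natCast] at h4 h5 ⊢
    rw [one_div, inv_pow]
    have e : (2:ℝ) ^ k / 2 ^ j * C = 2 ^ k * C * (2 ^ j)⁻¹ := by ring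
    linarith
  have h1 := Int.zpow_log_le_self (b := 2) one_lt_two hR
  have h2 := Int.lt_zpow_succ_log_self (R := ℝ) (b := 2) one_lt_two R
  push_cast at h1 h2
  have h3 := intervalIntegral.integral_add_adjacent_intervals (hintg 0 R)
    (hintg R (2 ^ (Int.log 2 R + 1)))
  have h4 : 0 ≤ ∫ t in R..(2 ^ (Int.log 2 R + 1)), G t :=
    intervalIntegral.integral_nonneg h2.le fun t _ => hG0 t
  have h5 := hk (Int.log 2 R + 1)
  rw [inv_mul_le_iff₀ hR]
  rw [zpow_add_one₀ two_ne_zero] at h3 h4 h5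
  have h6 := mul_le_mul_of_nonneg_right h1 hS
  linarith

/-- The dilation `(y₁, y₂) ↦ (y₁, c y₂)` of the plane. -/
def vertDil {c : ℝ} (hc : c ≠ 0) : ℝ × ℝ ≃ᵐ ℝ × ℝ :=
  (MeasurableEquiv.refl ℝ).prodCongr (MeasurableEquiv.mulLeft₀ c hc)

lemma vertDil_apply {c : ℝ} (hc : c ≠ 0) (y : ℝ × ℝ) : vertDil hc y = (y.1, c * y.2) := rfl

lemma map_vertDil {c : ℝ} (hc : c ≠ 0) :
    Measure.map (vertDil hc) (volume : Measure (ℝ × ℝ)) = ENNReal.ofReal |c⁻¹| • volume := by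
  have h1 : (vertDil hc : ℝ × ℝ → ℝ × ℝ) = Prod.map id (c * ·) := rfl
  rw [h1, Measure.volume_eq_prod, ← Measure.map_prod_map _ _ measurable_id
    (measurable_const_mul c), Measure.map_id, Real.map_volume_mul_left hc,
    Measure.prod_smul_right]

lemma lintegral_comp_vertDil {c : ℝ} (hc : c ≠ 0) (g : ℝ × ℝ → ℝ≥0∞) :
    ∫⁻ x, g (vertDil hc x) = ENNReal.ofReal |c⁻¹| * ∫⁻ x, g x := by
  rw [← lintegral_map_equiv, map_vertDil, lintegral_smul_measure, smul_eq_mul]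

lemma SchwartzMap.exists_abs_le (f : SchwartzMap (ℝ × ℝ) ℝ) : ∃ C, ∀ x, |f x| ≤ C := by
  obtain ⟨C, -, hC⟩ := f.decay 0 0
  exact ⟨C, fun x => by simpa using hC x⟩

lemma bci_abs_comp_vertDil {c : ℝ} (hc : c ≠ 0) (f : SchwartzMap (ℝ × ℝ) ℝ) :
    BCI (fun y => |f (vertDil hc y)|) := by
  refine ⟨?_, ?_, ?_⟩
  · simp only [vertDil_apply]
    exact (f.continuous.comp (by fun_prop)).abs
  · refine Integrable.abs ?_
    refine (integrable_map_equiv (μ := volume) (vertDil hc) (f : ℝ × ℝ → ℝ)).1 ?_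
    rw [map_vertDil]
    exact f.integrable.smul_measure ENNReal.ofReal_ne_top
  · obtain ⟨C, hC⟩ := f.exists_abs_le
    exact ⟨C, fun x => by rw [abs_abs]; exact hC _⟩

lemma uniformContinuous_abs_comp_vertDil {c : ℝ} (hc : c ≠ 0) (f : SchwartzMap (ℝ × ℝ) ℝ) :
    UniformContinuous (fun y => |f (vertDil hc y)|) := by
  have h1 : UniformContinuous (f : ℝ × ℝ → ℝ) := ZeroAtInftyContinuousMap.uniformContinuous f.toZeroAtInfty
  have h2 : UniformContinuous (vertDil hc : ℝ × ℝ → ℝ × ℝ) := by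
    have : (vertDil hc : ℝ × ℝ → ℝ × ℝ) = fun y => (y.1, c • y.2) := rfl
    rw [this]
    exact uniformContinuous_fst.prodMk (uniformContinuous_snd.const_smul c)
  exact uniformContinuous_norm.comp (h1.comp h2)

/-- The function `y ↦ |f (y₁, c y₂)|`. -/
def absDil {c : ℝ} (hc : c ≠ 0) (f : SchwartzMap (ℝ × ℝ) ℝ) : bciSpace :=
  ⟨_, bci_abs_comp_vertDil hc f⟩

lemma absDil_apply {c : ℝ} (hc : c ≠ 0) (f : SchwartzMap (ℝ × ℝ) ℝ) (y : ℝ × ℝ) :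
    (absDil hc f : ℝ × ℝ → ℝ) y = |f (vertDil hc y)| := rfl

lemma crv_absDil {b cp : ℝ} (hc : cp ≠ 0) (cm u : ℝ) (f : SchwartzMap (ℝ × ℝ) ℝ) (k : ℤ)
    (x : ℝ × ℝ) :
    (crv b (2 ^ k) (u * ((2:ℝ) ^ k) ^ b) (absDil hc f) : ℝ × ℝ → ℝ) ((vertDil hc).symm x) =
      ∫ s in Ioc (1:ℝ) 2, |f (x - (2 ^ k * s, u * curve b cp cm (2 ^ k * s)))| := by
  rw [crv_apply]
  refine setIntegral_congr_fun measurableSet_Ioc fun s hs => ?_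
  have hs0 : 0 < s := one_pos.trans hs.1
  have hk : (0:ℝ) < 2 ^ k := by positivity
  rw [absDil_apply]
  obtain ⟨y, rfl⟩ := (vertDil hc).surjective x
  rw [MeasurableEquiv.symm_apply_apply, curve, if_pos (mul_pos hk hs0),
    Real.mul_rpow hk.le hs0.le]
  simp only [vertDil_apply]
  congr 2
  ext
  · rfl
  · simp only [Prod.snd_sub]
    ring

lemma continuous_crv_apply (b l c : ℝ) (F : bciSpace) (y : ℝ × ℝ) :
    Continuous fun u : ℝ => (crv b l (u * c) F : ℝ × ℝ → ℝ) y := by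
  simp only [crv_apply]
  obtain ⟨C, hC⟩ := (bci F).bdd
  refine continuous_of_dominated (bound := fun _ => C) (fun u => ?_)
    (fun u => Eventually.of_forall fun s => hC _) (integrable_const C)
    (Eventually.of_forall fun s => (bci F).cont.comp (by fun_prop))
  refine ((bci F).cont.measurable.comp ?_).aestronglyMeasurable
  fun_prop

lemma measurable_curve_param (b cp cm : ℝ) : Measurable (curve b cp cm) := by
  unfold curve
  refine Measurable.ite measurableSet_Ioi (by fun_prop) ?_
  exact Measurable.ite measurableSet_Iio (by fun_prop) measurable_const

lemma enorm_calM_le {b cp cm : ℝ} (hc : cp ≠ 0) {U U₀ : Set ℝ} (hU : U.Nonempty)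
    (hUU₀ : U ⊆ closure U₀) (f : SchwartzMap (ℝ × ℝ) ℝ) (x : ℝ × ℝ) :
    ‖calM b cp cm U f x‖ₑ ≤ 2 * ⨆ i : U₀ × ℤ,
      ‖(crv b (2 ^ i.2) (i.1 * ((2:ℝ) ^ i.2) ^ b) (absDil hc f) : ℝ × ℝ → ℝ)
        ((vertDil hc).symm x)‖ₑ := by
  set X := ⨆ i : U₀ × ℤ,
      ‖(crv b (2 ^ i.2) (i.1 * ((2:ℝ) ^ i.2) ^ b) (absDil hc f) : ℝ × ℝ → ℝ)
        ((vertDil hc).symm x)‖ₑ with hX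
  rcases eq_or_ne X ∞ with hinf | hinf
  · rw [hinf, ENNReal.mul_top two_ne_zero]
    exact le_top
  obtain ⟨C, hC⟩ := f.exists_abs_le
  have h0 : ∀ u ∈ U, ∀ k : ℤ, (crv b (2 ^ k) (u * ((2:ℝ) ^ k) ^ b) (absDil hc f) : ℝ × ℝ → ℝ)
      ((vertDil hc).symm x) ≤ X.toReal := by
    intro u hu k
    have hcl : IsClosed {u : ℝ | (crv b (2 ^ k) (u * ((2:ℝ) ^ k) ^ b) (absDil hc f) :
        ℝ × ℝ → ℝ) ((vertDil hc).symm x) ≤ X.toReal} :=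
      isClosed_le (continuous_crv_apply _ _ _ _ _) continuous_const
    refine closure_minimal ?_ hcl (hUU₀ hu)
    intro v hv
    have h := le_iSup (fun i : U₀ × ℤ =>
      ‖(crv b (2 ^ i.2) (i.1 * ((2:ℝ) ^ i.2) ^ b) (absDil hc f) : ℝ × ℝ → ℝ)
        ((vertDil hc).symm x)‖ₑ) (⟨v, hv⟩, k)
    have h' := ENNReal.toReal_mono hinf h
    rw [toReal_enorm] at h'
    exact (le_abs_self _).trans h'
  have h1 : ∀ u ∈ U, Mu b cp cm u f x ≤ 2 * X.toReal := by
    intro u hu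
    have : Nonempty {R : ℝ // 0 < R} := ⟨⟨1, one_pos⟩⟩
    refine ciSup_le fun R => average_le_of_dyadic (C := C) ?_ (fun t => abs_nonneg _)
      (fun t => hC _) (fun k => ?_) R.2
    · have hm := measurable_curve_param b cp cm
      exact (f.continuous.measurable.comp (by fun_prop)).abs
    · rw [← crv_absDil hc]
      exact h0 u hu k
  have hne : Nonempty U := hU.to_subtype
  have h2 : calM b cp cm U f x ≤ 2 * X.toReal := ciSup_le fun u => h1 u u.2
  have h3 : 0 ≤ calM b cp cm U f x := by
    refine Real.iSup_nonneg fun u => Real.iSup_nonneg fun R => ?_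
    exact mul_nonneg (inv_nonneg.2 R.2.le)
      (intervalIntegral.integral_nonneg R.2.le fun t _ => abs_nonneg _)
  rw [Real.enorm_of_nonneg h3]
  refine (ENNReal.ofReal_le_ofReal h2).trans (le_of_eq ?_)
  rw [ENNReal.ofReal_mul two_pos.le, ENNReal.ofReal_toReal hinf, ENNReal.ofReal_ofNat]

lemma zpow_mul_dilation (b u : ℝ) (k : ℤ) :
    (2:ℝ) ^ (Int.log 2 u + ⌊k * b⌋) * (u / 2 ^ Int.log 2 u * (2:ℝ) ^ Int.fract (k * b)) =
      u * ((2:ℝ) ^ k) ^ b := by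
  have h : ((2:ℝ) ^ k) ^ b = 2 ^ ⌊k * b⌋ * (2:ℝ) ^ Int.fract (k * b) := by
    rw [← Real.rpow_intCast, ← Real.rpow_mul two_pos.le, ← Real.rpow_intCast,
      ← Real.rpow_add two_pos, Int.floor_add_fract]
  rw [h, zpow_add₀ two_ne_zero]
  have : (2:ℝ) ^ Int.log 2 u ≠ 0 := by positivity
  field_simp

lemma exists_lintegral_iSup_crv_absDil_le {b p d D : ℝ} (hb : 1 < b) (hp : 1 < p) (hp2 : p ≤ 2)
    (hd0 : 0 ≤ d) (hd : d < p - 1) (hD : 0 ≤ D) {U : Set ℝ} (hU : U ⊆ Ioi 0)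
    (hcov : CoveredBy d D (dilations b U)) {c : ℝ} (hc : c ≠ 0) :
    ∃ C : ℝ≥0, ∀ (U₀ : Set ℝ), U₀ ⊆ U → U₀.Countable → ∀ f : SchwartzMap (ℝ × ℝ) ℝ,
      ∫⁻ y, (⨆ i : U₀ × ℤ, ‖(crv b (2 ^ i.2) (i.1 * ((2:ℝ) ^ i.2) ^ b) (absDil hc f) :
        ℝ × ℝ → ℝ) y‖ₑ) ^ p ≤ C * ∫⁻ y, ‖(absDil hc f : ℝ × ℝ → ℝ) y‖ₑ ^ p := by
  obtain ⟨C, hC⟩ := exists_lintegral_iSup_crv_rpow_le hb hp hp2 hd0 hd hD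
  refine ⟨C, fun U₀ hU₀ hcount f => ?_⟩
  have := hcount.to_subtype
  refine lintegral_iSup_rpow_le (by linarith) (fun i => (bci _).cont.measurable.enorm)
    fun J => ?_
  set P : ℤ → ℤ → Finset ℝ := fun n k =>
    ((J.image Prod.fst).filter fun u : U₀ => Int.log 2 (u : ℝ) + ⌊k * b⌋ = n).image
      fun u : U₀ => (u : ℝ) / 2 ^ Int.log 2 (u : ℝ) * (2:ℝ) ^ Int.fract (k * b) with hP
  have hPs : ∀ n k, (P n k : Set ℝ) ⊆ dilations b U n k := by
    intro n k t ht
    obtain ⟨u, hu, rfl⟩ := Finset.mem_image.1 (Finset.mem_coe.1 ht)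
    exact ⟨u, hU₀ u.2, (Finset.mem_filter.1 hu).2, rfl⟩
  refine le_trans (lintegral_mono fun y => ENNReal.rpow_le_rpow ?_ (by linarith))
    (hC (J.image fun i => Int.log 2 (i.1 : ℝ) + ⌊i.2 * b⌋) (J.image Prod.snd) P (absDil hc f)
      (uniformContinuous_abs_comp_vertDil hc f) (fun y => abs_nonneg _)
      (fun n k t ht => dilations_subset_Icc hU b n k (hPs n k ht)) (hcov.mono hPs))
  refine iSup₂_le fun i hi => ?_
  have ht : (i.1 : ℝ) / 2 ^ Int.log 2 (i.1 : ℝ) * (2:ℝ) ^ Int.fract (i.2 * b) ∈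
      P (Int.log 2 (i.1 : ℝ) + ⌊i.2 * b⌋) i.2 :=
    Finset.mem_image_of_mem _ (Finset.mem_filter.2 ⟨Finset.mem_image_of_mem _ hi, rfl⟩)
  refine le_trans (le_of_eq ?_) (le_iSup₂_of_le _ (Finset.mem_image_of_mem _ hi)
    (le_iSup₂_of_le _ (Finset.mem_image_of_mem _ hi) (le_iSup₂_of_le _ ht le_rfl)))
  rw [zpow_mul_dilation]

theorem statement0 (b cp cm : ℝ) (hb : 1 < b) (hcp : cp ≠ 0) (hcm : cm ≠ 0)
    (U : Set ℝ) (hUne : U.Nonempty) (hUsub : U ⊆ Ioi (0:ℝ)) (p : ℝ) (hp1 : 1 < p) (hp2 : p ≤ 2) (hpcr : pcr U < p) :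
    ∃ C : ℝ, ∀ f : SchwartzMap (ℝ × ℝ) ℝ,
      eLpNorm (calM b cp cm U ⇑f) (eN p) volume
        ≤ ENNReal.ofReal C * eLpNorm ⇑f (eN p) volume := by
  obtain ⟨d, D, hd0, hd, hD, hcov⟩ := exists_covN_le hp1 hpcr
  obtain ⟨C, hC⟩ := exists_lintegral_iSup_crv_absDil_le hb hp1 hp2 hd0 hd hD hUsub
    (coveredBy_dilations hUsub b hD hcov) hcp
  obtain ⟨U₀, hU₀, hcount, hdense⟩ := 
    (TopologicalSpace.IsSeparable.of_separableSpace U).exists_countable_dense_subset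
  have hp0 : 0 < p := by linarith
  refine ⟨2 * (C : ℝ) ^ (1 / p), fun f => ?_⟩
  have he0 : eN p ≠ 0 := (ENNReal.ofReal_pos.2 hp0).ne'
  have het : eN p ≠ ∞ := ENNReal.ofReal_ne_top
  have hetr : (eN p).toReal = p := ENNReal.toReal_ofReal hp0.le
  rw [eLpNorm_eq_lintegral_rpow_enorm_toReal he0 het, eLpNorm_eq_lintegral_rpow_enorm_toReal he0 het, hetr]
  have hmain : ∫⁻ x, ‖calM b cp cm U f x‖ₑ ^ p ≤ 2 ^ p * (C * ∫⁻ x, ‖f x‖ₑ ^ p) := by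
    set S : ℝ × ℝ → ℝ≥0∞ := fun y => ⨆ i : U₀ × ℤ,
      ‖(crv b (2 ^ i.2) (i.1 * ((2:ℝ) ^ i.2) ^ b) (absDil hcp f) : ℝ × ℝ → ℝ) y‖ₑ with hS
    have hκ0 : ENNReal.ofReal |cp⁻¹| ≠ 0 := by simpa using hcp
    have h1 : ∫⁻ y, ‖(absDil hcp f : ℝ × ℝ → ℝ) y‖ₑ ^ p =
        ENNReal.ofReal |cp⁻¹| * ∫⁻ x, ‖f x‖ₑ ^ p := by
      rw [← lintegral_comp_vertDil hcp]
      simp only [absDil_apply, Real.enorm_abs]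
    have h2 : ∫⁻ y, S y ^ p =
        ENNReal.ofReal |cp⁻¹| * ∫⁻ x, S ((vertDil hcp).symm x) ^ p := by
      rw [← lintegral_comp_vertDil hcp]
      simp only [MeasurableEquiv.symm_apply_apply]
    have h3 : ∫⁻ x, S ((vertDil hcp).symm x) ^ p ≤ C * ∫⁻ x, ‖f x‖ₑ ^ p := by
      have h4 := hC U₀ hU₀ hcount f
      rw [h1, h2, mul_left_comm] at h4
      exact (ENNReal.mul_le_mul_iff_right hκ0 ENNReal.ofReal_ne_top).1 h4
    have h2t : (2:ℝ≥0∞) ^ p ≠ ∞ := ENNReal.rpow_ne_top_of_nonneg hp0.le ENNReal.ofNat_ne_top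
    refine le_trans (lintegral_mono fun x => ?_) (mul_le_mul' (le_refl (2 ^ p)) h3 |>.trans'
      (lintegral_const_mul' _ _ h2t).le)
    rw [← ENNReal.mul_rpow_of_nonneg _ _ hp0.le]
    exact ENNReal.rpow_le_rpow (enorm_calM_le hcp hUne hdense f x) hp0.le
  have hp' : 0 ≤ 1 / p := by positivity
  refine (ENNReal.rpow_le_rpow hmain hp').trans (le_of_eq ?_)
  rw [ENNReal.mul_rpow_of_nonneg _ _ hp', ENNReal.mul_rpow_of_nonneg _ _ hp',
    ← ENNReal.rpow_mul, mul_one_div_cancel hp0.ne', ENNReal.rpow_one, ← mul_assoc,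
    ENNReal.ofReal_mul two_pos.le, ENNReal.ofReal_ofNat,
    ← ENNReal.ofReal_rpow_of_nonneg C.coe_nonneg hp', ENNReal.ofReal_coe_nnreal]

end
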